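/- arXiv:1304.8032 — 2 statements merged into one kernel-verified Lean document; each statement's English description precedes it below -/
import Mathlib

section
/- Let α ≥ 0, let F : S^N → ℝ be uniformly elliptic with constants 0 < λ ≤ Λ, let h be Lipschitz continuous on B₁, and let f be continuous and bounded on B₁. Let H : B₁ × ℝ^N → ℝ be such that H(·,0) is bounded and there exist β₁, β₂ ∈ (0, 1+α] and C > 0 with |H(x,q) − H(x,0)| ≤ C(|q|^{β₁} + |q|^{β₂}) for all x, q. Then every bounded viscosity solution u of |∇u|^α(F(D²u) + h(x)·∇u) + H(x,∇u) = f(x) in B₁ is Hölder continuous: for every γ ∈ (0,1) and every r < 1, u is γ-Hölder continuous on B_r with a constant depending only on γ, r, N, λ, Λ, α, β₁, β₂, C, ‖u‖_∞, ‖f‖_∞, ‖H(·,0)‖_∞, ‖h‖_∞, Lip(h). -/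
open Metric Set Real
open scoped RealInnerProductSpace

noncomputable section

/-- `ℝ^N` with the euclidean structure. -/
abbrev Euc (N : ℕ) : Type := EuclideanSpace ℝ (Fin N)

/-- The Hessian matrix `D²φ(x)` of a function `φ` at a point `x`. -/
def hess {N : ℕ} (φ : Euc N → ℝ) (x : Euc N) : Matrix (Fin N) (Fin N) ℝ :=
  Matrix.of fun i j =>
    iteratedFDeriv ℝ 2 φ x ![EuclideanSpace.single i (1 : ℝ), EuclideanSpace.single j (1 : ℝ)]

/-- `F` is uniformly elliptic with ellipticity constants `lam ≤ Lam`: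
`lam * tr P ≤ F (M + P) - F M ≤ Lam * tr P` for symmetric `M` and positive semidefinite `P`. -/
def UnifElliptic {N : ℕ} (lam Lam : ℝ) (F : Matrix (Fin N) (Fin N) ℝ → ℝ) : Prop :=
  ∀ M P : Matrix (Fin N) (Fin N) ℝ, M.IsSymm → P.PosSemidef →
    lam * Matrix.trace P ≤ F (M + P) - F M ∧ F (M + P) - F M ≤ Lam * Matrix.trace P

/-- Standard viscosity subsolution of `G(x, ∇u, D²u) = f(x)` on `Ω`. -/
def ViscSub {N : ℕ} (Ω : Set (Euc N)) (G : Euc N → Euc N → Matrix (Fin N) (Fin N) ℝ → ℝ)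
    (f u : Euc N → ℝ) : Prop :=
  ∀ x₀ ∈ Ω, ∀ φ : Euc N → ℝ, ContDiff ℝ 2 φ →
    IsLocalMaxOn (fun x => u x - φ x) Ω x₀ →
    f x₀ ≤ G x₀ (gradient φ x₀) (hess φ x₀)

/-- Standard viscosity supersolution of `G(x, ∇u, D²u) = f(x)` on `Ω`. -/
def ViscSuper {N : ℕ} (Ω : Set (Euc N)) (G : Euc N → Euc N → Matrix (Fin N) (Fin N) ℝ → ℝ)
    (f u : Euc N → ℝ) : Prop :=
  ∀ x₀ ∈ Ω, ∀ φ : Euc N → ℝ, ContDiff ℝ 2 φ →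
    IsLocalMinOn (fun x => u x - φ x) Ω x₀ →
    G x₀ (gradient φ x₀) (hess φ x₀) ≤ f x₀

/-- Standard viscosity solution. -/
def ViscSol {N : ℕ} (Ω : Set (Euc N)) (G : Euc N → Euc N → Matrix (Fin N) (Fin N) ℝ → ℝ)
    (f u : Euc N → ℝ) : Prop :=
  ViscSub Ω G f u ∧ ViscSuper Ω G f u

/-- `u` is not constant on any neighbourhood of `x₀`. -/
def NotLocallyConst {N : ℕ} (u : Euc N → ℝ) (x₀ : Euc N) : Prop :=
  ∀ δ > 0, ∃ y ∈ ball x₀ δ, u y ≠ u x₀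

/-- Viscosity subsolution in the singular sense: test functions have nonvanishing gradient and
are only tested at points where `u` is not locally constant. -/
def ViscSubSing {N : ℕ} (Ω : Set (Euc N)) (G : Euc N → Euc N → Matrix (Fin N) (Fin N) ℝ → ℝ)
    (f u : Euc N → ℝ) : Prop :=
  ∀ x₀ ∈ Ω, NotLocallyConst u x₀ → ∀ φ : Euc N → ℝ, ContDiff ℝ 2 φ →
    gradient φ x₀ ≠ 0 → IsLocalMaxOn (fun x => u x - φ x) Ω x₀ →
    f x₀ ≤ G x₀ (gradient φ x₀) (hess φ x₀)

/-- Viscosity supersolution in the singular sense. -/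
def ViscSuperSing {N : ℕ} (Ω : Set (Euc N)) (G : Euc N → Euc N → Matrix (Fin N) (Fin N) ℝ → ℝ)
    (f u : Euc N → ℝ) : Prop :=
  ∀ x₀ ∈ Ω, NotLocallyConst u x₀ → ∀ φ : Euc N → ℝ, ContDiff ℝ 2 φ →
    gradient φ x₀ ≠ 0 → IsLocalMinOn (fun x => u x - φ x) Ω x₀ →
    G x₀ (gradient φ x₀) (hess φ x₀) ≤ f x₀

/-- Viscosity solution in the singular sense. -/
def ViscSolSing {N : ℕ} (Ω : Set (Euc N)) (G : Euc N → Euc N → Matrix (Fin N) (Fin N) ℝ → ℝ)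
    (f u : Euc N → ℝ) : Prop :=
  ViscSubSing Ω G f u ∧ ViscSuperSing Ω G f u

/-- Viscosity subsolution for the `α`-dependent notion: for `α = 0` it is the standard notion,
for `α ≠ 0` the singular one. -/
def ViscSubA {N : ℕ} (α : ℝ) (Ω : Set (Euc N))
    (G : Euc N → Euc N → Matrix (Fin N) (Fin N) ℝ → ℝ) (f u : Euc N → ℝ) : Prop :=
  ∀ x₀ ∈ Ω, ∀ φ : Euc N → ℝ, ContDiff ℝ 2 φ →
    IsLocalMaxOn (fun x => u x - φ x) Ω x₀ →
    (α = 0 ∨ (NotLocallyConst u x₀ ∧ gradient φ x₀ ≠ 0)) →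
    f x₀ ≤ G x₀ (gradient φ x₀) (hess φ x₀)

/-- Viscosity supersolution for the `α`-dependent notion. -/
def ViscSuperA {N : ℕ} (α : ℝ) (Ω : Set (Euc N))
    (G : Euc N → Euc N → Matrix (Fin N) (Fin N) ℝ → ℝ) (f u : Euc N → ℝ) : Prop :=
  ∀ x₀ ∈ Ω, ∀ φ : Euc N → ℝ, ContDiff ℝ 2 φ →
    IsLocalMinOn (fun x => u x - φ x) Ω x₀ →
    (α = 0 ∨ (NotLocallyConst u x₀ ∧ gradient φ x₀ ≠ 0)) →
    G x₀ (gradient φ x₀) (hess φ x₀) ≤ f x₀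

/-- Viscosity solution for the `α`-dependent notion. -/
def ViscSolA {N : ℕ} (α : ℝ) (Ω : Set (Euc N))
    (G : Euc N → Euc N → Matrix (Fin N) (Fin N) ℝ → ℝ) (f u : Euc N → ℝ) : Prop :=
  ViscSubA α Ω G f u ∧ ViscSuperA α Ω G f u

section Envelope

variable {E : Type*} [NormedAddCommGroup E] [InnerProductSpace ℝ E]

/-- A coercive lower semicontinuous perturbation of the squared distance attains its minimum. -/
theorem exists_forall_add_sq_le [FiniteDimensional ℝ E] {g : E → ℝ} (hg : LowerSemicontinuous g)
    {κ c : ℝ} (hκ : 0 < κ) (b₀ : E) (hlow : ∀ a, c - κ / 2 * ‖a - b₀‖ ^ 2 ≤ g a) (x : E) :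
    ∃ a, ∀ a', g a + κ * ‖x - a‖ ^ 2 ≤ g a' + κ * ‖x - a'‖ ^ 2 := by
  set D := ‖x - b₀‖ with hD
  set Δ := |(g x - c) / κ| with hΔ
  have hD0 : 0 ≤ D := norm_nonneg _
  have hΔ0 : 0 ≤ Δ := abs_nonneg _
  set ρ := 2 * D + 2 + Δ + D ^ 2 with hρ
  have hρ0 : 0 ≤ ρ := by positivity
  have hlsc : LowerSemicontinuous fun a => g a + κ * ‖x - a‖ ^ 2 :=
    hg.add (Continuous.lowerSemicontinuous (by fun_prop))
  obtain ⟨a, -, ha⟩ := LowerSemicontinuousOn.exists_isMinOn (s := closedBall x ρ)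
    ⟨x, mem_closedBall_self hρ0⟩ (isCompact_closedBall x ρ) (hlsc.lowerSemicontinuousOn _)
  refine ⟨a, fun a' => ?_⟩
  rcases le_or_gt (dist a' x) ρ with h | h
  · exact ha (mem_closedBall.2 h)
  · have h1 : g a + κ * ‖x - a‖ ^ 2 ≤ g x := by
      simpa using ha (mem_closedBall_self hρ0)
    refine h1.trans ?_
    have h2 := hlow a'
    rw [dist_comm, dist_eq_norm] at h
    set l := ‖x - a'‖ with hl
    have h3 : ‖a' - b₀‖ ≤ l + D := by
      rw [hl, hD, norm_sub_rev x a']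
      simpa using norm_add_le (a' - x) (x - b₀)
    have h4 : ‖a' - b₀‖ ^ 2 ≤ (l + D) ^ 2 := pow_le_pow_left₀ (norm_nonneg _) h3 2
    have h5 : Δ ≤ l ^ 2 - (l + D) ^ 2 / 2 := by nlinarith
    have h6 : g x - c ≤ κ * Δ := by
      rw [hΔ, ← div_le_iff₀' hκ]
      exact le_abs_self _
    nlinarith

/-- The regularisation of a function `u` on a compact set `K`, obtained by taking a
sup-convolution followed by an inf-convolution. It is `C^{1,1}` with gradient `p`, lies above `u`
on `K`, and it shares its second order upper expansions with `u` wherever it is not as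
convex as the paraboloids of the inf-convolution. -/
theorem exists_regular_envelope [FiniteDimensional ℝ E] {K : Set E} (hK : IsCompact K)
    (hKne : K.Nonempty) {u : E → ℝ} (hu : ContinuousOn u K) {κ : ℝ} (hκ : 0 < κ) :
    ∃ (U : E → ℝ) (p : E → E),
      (∀ b ∈ K, ∀ x, u b ≤ U x + κ * ‖x - b‖ ^ 2) ∧
      (∀ x, ∃ b ∈ K, U x ≤ u b - κ / 2 * ‖x - b‖ ^ 2) ∧
      (∀ x x', |U x' - U x - ⟪p x, x' - x⟫| ≤ 3 * κ * ‖x' - x‖ ^ 2) ∧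
      LipschitzWith (Real.toNNReal (10 * κ)) p ∧
      (∀ x, (∀ e : E, (∀ τ ∈ Icc (0 : ℝ) 1,
          U (x + τ • e) = U x + τ * ⟪p x, e⟫ + κ * τ ^ 2 * ‖e‖ ^ 2) → e = 0) →
        x + (2 * κ)⁻¹ • p x ∈ K ∧ U x = u (x + (2 * κ)⁻¹ • p x) - ‖p x‖ ^ 2 / (4 * κ)) := by
  have hβ : ∀ a, ∃ b ∈ K, ∀ b' ∈ K, u b' - κ / 2 * ‖a - b'‖ ^ 2 ≤ u b - κ / 2 * ‖a - b‖ ^ 2 :=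
    fun a => hK.exists_isMaxOn hKne
      (hu.sub (Continuous.continuousOn (by fun_prop : Continuous fun b => κ / 2 * ‖a - b‖ ^ 2)))
  choose β hβK hβmax using hβ
  set g : E → ℝ := fun a => u (β a) - κ / 2 * ‖a - β a‖ ^ 2 with hg
  have hgdef : ∀ a, g a = u (β a) - κ / 2 * ‖a - β a‖ ^ 2 := fun _ => rfl
  have hgge : ∀ a, ∀ b ∈ K, u b - κ / 2 * ‖a - b‖ ^ 2 ≤ g a := hβmax
  have hlsc : LowerSemicontinuous g := by
    intro a y hy
    have hc : ContinuousAt (fun a' => u (β a) - κ / 2 * ‖a' - β a‖ ^ 2) a := by fun_prop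
    filter_upwards [hc.eventually (lt_mem_nhds hy)] with a' ha'
    exact ha'.trans_le (hgge a' _ (hβK a))
  obtain ⟨b₀, hb₀⟩ := hKne
  choose A hA using exists_forall_add_sq_le hlsc hκ b₀ (fun a => hgge a b₀ hb₀)
  have hsq : ∀ v w : E, ‖v + w‖ ^ 2 = ‖v‖ ^ 2 + 2 * ⟪v, w⟫ + ‖w‖ ^ 2 := norm_add_sq_real
  -- strong convexity at the minimiser
  have hstrong : ∀ x a, g (A x) + κ * ‖x - A x‖ ^ 2 + κ / 4 * ‖a - A x‖ ^ 2 ≤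
      g a + κ * ‖x - a‖ ^ 2 := by
    intro x a
    set v := (1 / 2 : ℝ) • (a - A x) with hv
    set m := A x + v with hm
    have ha : a = m + v := by rw [hm, hv]; module
    have h1 := hA x m
    have h2 := hgge (A x) _ (hβK m)
    have h3 := hgge a _ (hβK m)
    have h4 := hgdef m
    have e1 : A x - β m = (m - β m) + -v := by rw [hm]; abel
    have e2 : a - β m = (m - β m) + v := by rw [ha]; abel
    have e3 : x - A x = (x - m) + v := by rw [hm]; abel
    have e4 : x - a = (x - m) + -v := by rw [ha]; abel
    have e5 : a - A x = v + v := by rw [ha, hm]; abel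
    rw [e1, hsq, inner_neg_right, norm_neg] at h2
    rw [e2, hsq] at h3
    rw [e3, hsq] at h1 ⊢
    rw [e4, hsq, inner_neg_right, norm_neg, e5, hsq, real_inner_self_eq_norm_sq]
    nlinarith
  have hAlip : ∀ x x', ‖A x' - A x‖ ≤ 4 * ‖x' - x‖ := by
    intro x x'
    have h1 := hstrong x (A x')
    have h2 := hstrong x' (A x)
    have e1 : x' - A x' = (x - A x') + (x' - x) := by abel
    have e2 : x' - A x = (x - A x) + (x' - x) := by abel
    rw [e1, hsq, e2, hsq, norm_sub_rev (A x)] at h2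
    have h3 : ⟪x - A x, x' - x⟫ - ⟪x - A x', x' - x⟫ ≤ ‖A x' - A x‖ * ‖x' - x‖ := by
      rw [← inner_sub_left]
      have : x - A x - (x - A x') = A x' - A x := by abel
      rw [this]
      exact real_inner_le_norm _ _
    have h4 : κ * (‖A x' - A x‖ * ‖A x' - A x‖) ≤ κ * (‖A x' - A x‖ * (4 * ‖x' - x‖)) := by
      nlinarith
    have h5 := le_of_mul_le_mul_left h4 hκ
    rcases (norm_nonneg (A x' - A x)).eq_or_lt with h0 | h0
    · rw [← h0]; positivity
    · exact le_of_mul_le_mul_left h5 h0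
  refine ⟨fun x => g (A x) + κ * ‖x - A x‖ ^ 2, fun x => (2 * κ) • (x - A x), ?_, ?_, ?_, ?_, ?_⟩
  · intro b hb x
    have h1 := hgge (A x) b hb
    have e1 : A x - b = (x - b) + -(x - A x) := by abel
    rw [e1, hsq, inner_neg_right, norm_neg] at h1
    have h2 := hsq (x - b) (x - A x)
    have h3 := sq_nonneg ‖x - b + (x - A x)‖
    simp only
    nlinarith
  · intro x
    refine ⟨β x, hβK x, ?_⟩
    have h1 := hA x x
    simpa [hgdef x] using h1
  · intro x x'
    simp only [inner_smul_left, RCLike.conj_to_real]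
    have e1 : x' - A x = (x - A x) + (x' - x) := by abel
    have e2 : x' - A x' = (x - A x') + (x' - x) := by abel
    have h1 := hA x' (A x)
    have h2 := hstrong x (A x')
    rw [abs_le]
    have h3 : ⟪x - A x, x' - x⟫ - ⟪x - A x', x' - x⟫ ≤ ‖A x' - A x‖ * ‖x' - x‖ := by
      rw [← inner_sub_left]
      have : x - A x - (x - A x') = A x' - A x := by abel
      rw [this]
      exact real_inner_le_norm _ _
    constructor
    · rw [e2, hsq]
      nlinarith [sq_nonneg (‖A x' - A x‖ - 4 * ‖x' - x‖)]
    · rw [e1, hsq] at h1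
      nlinarith [sq_nonneg ‖x' - x‖]
  · refine LipschitzWith.of_dist_le_mul fun x' x => ?_
    rw [Real.coe_toNNReal _ (by positivity), dist_eq_norm, dist_eq_norm, ← smul_sub, norm_smul,
      Real.norm_of_nonneg (by positivity)]
    have e1 : x' - A x' - (x - A x) = (x' - x) - (A x' - A x) := by abel
    have h1 := norm_sub_le (x' - x) (A x' - A x)
    have h2 := hAlip x x'
    rw [e1]
    nlinarith
  · intro x hx
    set a := A x with ha
    set b := β a with hb
    have hz : (2 * κ)⁻¹ • (κ • (b - a) - (2 * κ) • (x - a)) = 0 := by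
      refine hx _ fun τ hτ => ?_
      set e := (2 * κ)⁻¹ • (κ • (b - a) - (2 * κ) • (x - a)) with he
      have hba : b - a = (2 : ℝ) • (e + (x - a)) := by
        rw [he]
        simp only [smul_sub, smul_add, smul_smul]
        match_scalars <;> field_simp <;> ring
      set x' := x + τ • e with hx'
      have hup := hA x' a
      have hlo : g a + κ * ‖x' - a‖ ^ 2 ≤ g (A x') + κ * ‖x' - A x'‖ ^ 2 := by
        have h1 := hA x (A x')
        have h2 := hgge (A x') b (hβK a)
        have h3 : g a = u b - κ / 2 * ‖a - b‖ ^ 2 := hgdef a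
        set d := A x' - a with hd
        have e1 : x - A x' = (x - a) + -d := by rw [hd]; abel
        have e2 : A x' - b = d + -(b - a) := by rw [hd]; abel
        have e3 : a - b = -(b - a) := by abel
        have e4 : x' - A x' = (x' - a) + -d := by rw [hd]; abel
        have e5 : ⟪x' - a, d⟫ = ⟪x - a, d⟫ + τ * ⟪e, d⟫ := by
          rw [hx', ← real_inner_smul_left, ← inner_add_left]
          congr 1; abel
        have e6 : ⟪d, b - a⟫ = 2 * (⟪x - a, d⟫ + ⟪e, d⟫) := by
          rw [hba, real_inner_smul_right, inner_add_right, real_inner_comm d e,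
            real_inner_comm d (x - a)]
          ring
        rw [← ha] at h1
        rw [e1, hsq, inner_neg_right, norm_neg] at h1
        rw [e2, hsq, inner_neg_right, norm_neg, e6] at h2
        rw [e3, norm_neg] at h3
        rw [e4, hsq (x' - a), inner_neg_right, norm_neg, e5]
        have i1 := mul_nonneg (sub_nonneg.2 hτ.2) (sub_nonneg.2 h1)
        have h2' : g a - κ / 2 * ‖d‖ ^ 2 + 2 * κ * (⟪x - a, d⟫ + ⟪e, d⟫) ≤ g (A x') := by
          linarith
        have i2 := mul_nonneg hτ.1 (sub_nonneg.2 h2')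
        have i3 : 0 ≤ τ * (κ * ‖d‖ ^ 2) := mul_nonneg hτ.1 (by positivity)
        nlinarith
      have hUx : g (A x') + κ * ‖x' - A x'‖ ^ 2 = g a + κ * ‖x' - a‖ ^ 2 := le_antisymm hup hlo
      have e1 : x' - a = (x - a) + τ • e := by rw [hx']; abel
      simp only [inner_smul_left, RCLike.conj_to_real]
      rw [hUx, e1, hsq, real_inner_smul_right, norm_smul, mul_pow, Real.norm_eq_abs, sq_abs]
      ring
    have hba : b - a = (2 : ℝ) • (x - a) := by
      have h1 : κ • (b - a) - (2 * κ) • (x - a) = 0 := by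
        rcases smul_eq_zero.1 hz with h | h
        · exact absurd h (by positivity)
        · exact h
      have h2 : κ • ((b - a) - (2 : ℝ) • (x - a)) = 0 := by
        rw [← h1, smul_sub, smul_smul, mul_comm]
      rcases smul_eq_zero.1 h2 with h | h
      · exact absurd h hκ.ne'
      · exact sub_eq_zero.1 h
    have hb' : x + (2 * κ)⁻¹ • (2 * κ) • (x - a) = b := by
      rw [smul_smul, inv_mul_cancel₀ (by positivity), one_smul, ← sub_add_cancel b a, hba]
      module
    simp only [← ha]
    rw [hb']
    refine ⟨hβK a, ?_⟩
    have h3 : g a = u b - κ / 2 * ‖a - b‖ ^ 2 := hgdef a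
    rw [h3, norm_sub_rev a b, hba, norm_smul, norm_smul, Real.norm_of_nonneg (by positivity),
      Real.norm_of_nonneg (by positivity)]
    field_simp
    ring

end Envelope

section Perturbation

open MeasureTheory Filter
open scoped Topology

/-- Locally Lipschitz maps send Haar null sets to null sets. -/
theorem addHaar_image_eq_zero_of_locally_lipschitz {V : Type*} [NormedAddCommGroup V]
    [NormedSpace ℝ V] [FiniteDimensional ℝ V] [MeasurableSpace V] [BorelSpace V]
    (μ : Measure V) [μ.IsAddHaarMeasure] {G : V → V} {s : Set V} (hs : μ s = 0)
    (hG : ∀ z ∈ s, ∃ C : NNReal, ∃ t ∈ 𝓝 z, LipschitzOnWith C G t) : μ (G '' s) = 0 := by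
  have key : (OuterMeasure.comap G μ.toOuterMeasure) s = 0 := by
    refine measure_null_of_locally_null _ fun z hz => ?_
    obtain ⟨C, t, ht, hC⟩ := hG z hz
    refine ⟨s ∩ t, inter_mem self_mem_nhdsWithin (mem_nhdsWithin_of_mem_nhds ht), ?_⟩
    set d : ℝ := (Module.finrank ℝ V : ℝ) with hd
    have h0 : (Measure.hausdorffMeasure d : Measure V) (s ∩ t) = 0 :=
      (Measure.absolutelyContinuous_isAddHaarMeasure _ μ)
        (measure_mono_null inter_subset_left hs)
    have h1 := (hC.mono (inter_subset_right (s := s))).hausdorffMeasure_image_le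
      (d := d) (Nat.cast_nonneg _)
    rw [h0, mul_zero, nonpos_iff_eq_zero] at h1
    rw [OuterMeasure.comap_apply]
    exact (Measure.absolutelyContinuous_isAddHaarMeasure μ
      (Measure.hausdorffMeasure d : Measure V)) h1
  rwa [OuterMeasure.comap_apply] at key

/-- For some arbitrarily small `ξ`, the solutions `z` of `G z = ξ` are differentiability points of
two given Lipschitz maps. -/
theorem exists_small_value_differentiableAt {E : Type*} [NormedAddCommGroup E]
    [InnerProductSpace ℝ E] [FiniteDimensional ℝ E] {p q : E → E} {Cp Cq : NNReal}
    (hp : LipschitzWith Cp p) (hq : LipschitzWith Cq q) {G : E × E → E × E} {O : Set (E × E)}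
    (hG : ∀ z ∈ O, ∃ C : NNReal, ∃ t ∈ 𝓝 z, LipschitzOnWith C G t) {η : ℝ} (hη : 0 < η) :
    ∃ ξ ∈ ball (0 : E × E) η, ∀ z ∈ O, G z = ξ →
      DifferentiableAt ℝ p z.1 ∧ DifferentiableAt ℝ q z.2 := by
  borelize E
  set μ : Measure (E × E) := (volume : Measure E).prod volume
  set T : Set (E × E) := {z | DifferentiableAt ℝ p z.1 ∧ DifferentiableAt ℝ q z.2}
  have hT : μ Tᶜ = 0 := by
    have h1 : ∀ᵐ z ∂μ, DifferentiableAt ℝ p z.1 :=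
      Measure.quasiMeasurePreserving_fst.ae hp.ae_differentiableAt
    have h2 : ∀ᵐ z ∂μ, DifferentiableAt ℝ q z.2 :=
      Measure.quasiMeasurePreserving_snd.ae hq.ae_differentiableAt
    exact mem_ae_iff.1 (h1.and h2)
  have h0 : μ (G '' (O ∩ Tᶜ)) = 0 :=
    addHaar_image_eq_zero_of_locally_lipschitz μ (measure_mono_null inter_subset_right hT)
      fun z hz => hG z hz.1
  have hpos : 0 < μ (ball 0 η) := measure_ball_pos μ 0 hη
  obtain ⟨ξ, hξ, hξ'⟩ : ∃ ξ ∈ ball (0 : E × E) η, ξ ∉ G '' (O ∩ Tᶜ) := by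
    by_contra! h
    exact hpos.ne' (measure_mono_null h h0)
  refine ⟨ξ, hξ, fun z hz hGz => ?_⟩
  by_contra hcon
  exact hξ' ⟨z, ⟨hz, hcon⟩, hGz⟩

end Perturbation

section SecondOrder

open Filter
open scoped Topology

/-- The second derivative is nonpositive at a local maximum. -/
theorem second_deriv_nonpos_of_isLocalMax {g g' : ℝ → ℝ} {c : ℝ} {t₀ : ℝ}
    (hg : ∀ᶠ t in 𝓝 t₀, HasDerivAt g (g' t) t) (hg' : HasDerivAt g' c t₀)
    (hmax : IsLocalMax g t₀) : c ≤ 0 := by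
  by_contra! hc
  have hd : deriv g =ᶠ[𝓝 t₀] g' := hg.mono fun t ht => ht.deriv
  have hdd : deriv (deriv g) t₀ = c := hd.deriv_eq.trans hg'.deriv
  have hmin : IsLocalMin g t₀ := isLocalMin_of_deriv_deriv_pos (hdd ▸ hc)
    hmax.deriv_eq_zero hg.self_of_nhds.continuousAt
  have hconst : g =ᶠ[𝓝 t₀] fun _ => g t₀ := by
    filter_upwards [hmax, hmin] with t h1 h2 using le_antisymm h1 h2
  have h0 : deriv (deriv g) t₀ = 0 := by
    rw [(hconst.deriv).deriv_eq]
    simp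
  exact hc.ne' (hdd ▸ h0)

variable {E : Type*} [NormedAddCommGroup E] [InnerProductSpace ℝ E]

theorem hasFDerivAt_of_abs_le_sq {U : E → ℝ} {x p : E} {C : ℝ}
    (h : ∀ x', |U x' - U x - ⟪p, x' - x⟫| ≤ C * ‖x' - x‖ ^ 2) :
    HasFDerivAt U (innerSL ℝ p) x := by
  rw [hasFDerivAt_iff_isLittleO]
  have h1 : (fun x' => U x' - U x - innerSL ℝ p (x' - x)) =O[𝓝 x]
      fun x' => ‖x' - x‖ ^ 2 :=
    Asymptotics.IsBigO.of_bound C (Eventually.of_forall fun x' => by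
      simpa using h x')
  refine h1.trans_isLittleO ?_
  have h2 := Asymptotics.isLittleO_norm_pow_norm_pow (E' := E) (m := 1) (n := 2) (by norm_num)
  have h3 := h2.comp_tendsto (k := fun x' => x' - x) (l' := 𝓝 x)
    (Continuous.tendsto' (by fun_prop) x 0 (sub_self x))
  simpa [Function.comp_def] using h3

theorem hasDerivAt_comp_add_smul {U : E → ℝ} {p : E → E}
    (hU : ∀ x, HasFDerivAt U (innerSL ℝ (p x)) x) (x v : E) (t : ℝ) :
    HasDerivAt (fun τ : ℝ => U (x + τ • v)) ⟪p (x + t • v), v⟫ t := by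
  have h1 : HasDerivAt (fun τ : ℝ => x + τ • v) v t := by
    simpa using ((hasDerivAt_id t).smul_const v).const_add x
  exact (hU (x + t • v)).comp_hasDerivAt t h1

theorem hasDerivAt_inner_comp_add_smul {p : E → E} {X : E →L[ℝ] E} {x : E}
    (hX : HasFDerivAt p X x) (v : E) :
    HasDerivAt (fun τ : ℝ => ⟪p (x + τ • v), v⟫) ⟪X v, v⟫ 0 := by
  have h1 : HasDerivAt (fun τ : ℝ => x + τ • v) v 0 := by
    simpa using ((hasDerivAt_id (0 : ℝ)).smul_const v).const_add x
  have h2 : HasFDerivAt p X (x + (0 : ℝ) • v) := by simpa using hX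
  have h3 := h2.comp_hasDerivAt (0 : ℝ) h1
  simpa using h3.inner ℝ (hasDerivAt_const (0 : ℝ) v)

/-- A differentiable function touched from above by a smooth function has the same gradient. -/
theorem eq_of_eventually_le_quadratic {U : E → ℝ} {x p q : E} {C : ℝ}
    (hU : HasFDerivAt U (innerSL ℝ p) x)
    (h : ∀ᶠ v in 𝓝 (0 : E), U (x + v) ≤ U x + ⟪q, v⟫ + C * ‖v‖ ^ 2) : p = q := by
  have hf : HasFDerivAt (fun v => U (x + v) - ⟪q, v⟫ - C * ‖v‖ ^ 2)
      (innerSL ℝ p - innerSL ℝ q) 0 := by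
    have h1 : HasFDerivAt (fun v => U (x + v)) (innerSL ℝ p) 0 := by
      rw [hasFDerivAt_comp_add_left]; simpa using hU
    have h2 : HasFDerivAt (fun v : E => C * ‖v‖ ^ 2) (0 : E →L[ℝ] ℝ) 0 := by
      simpa using ((hasStrictFDerivAt_norm_sq (0 : E)).hasFDerivAt.const_mul C)
    simpa using (h1.fun_sub (innerSL ℝ q).hasFDerivAt).fun_sub h2
  have hm : IsLocalMax (fun v => U (x + v) - ⟪q, v⟫ - C * ‖v‖ ^ 2) 0 := by
    filter_upwards [h] with v hv
    simp
    linarith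
  have h0 := hm.hasFDerivAt_eq_zero hf
  have h1 := congrArg (fun L : E →L[ℝ] ℝ => L (p - q)) h0
  simp only [sub_apply, innerSL_apply_apply, ← inner_sub_left, zero_apply,
    inner_self_eq_zero] at h1
  exact sub_eq_zero.1 h1

/-- Second order Taylor upper bound at a differentiability point of the gradient. -/
theorem eventually_le_taylor {U : E → ℝ} {p : E → E}
    (hU : ∀ x, HasFDerivAt U (innerSL ℝ (p x)) x) {x : E} {X : E →L[ℝ] E}
    (hX : HasFDerivAt p X x) {η : ℝ} (hη : 0 < η) :
    ∀ᶠ v in 𝓝 (0 : E), U (x + v) ≤ U x + ⟪p x, v⟫ + (⟪X v, v⟫ + η * ‖v‖ ^ 2) / 2 := by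
  rw [hasFDerivAt_iff_isLittleO_nhds_zero] at hX
  obtain ⟨δ, hδ, hball⟩ := Metric.eventually_nhds_iff_ball.1 (hX.bound hη)
  refine Metric.eventually_nhds_iff_ball.2 ⟨δ, hδ, fun v hv => ?_⟩
  set G : ℝ → ℝ := fun τ => U (x + τ • v) - τ * ⟪p x, v⟫ - τ ^ 2 * ((⟪X v, v⟫ + η * ‖v‖ ^ 2) / 2)
    with hG
  have hder : ∀ t, HasDerivAt G (⟪p (x + t • v), v⟫ - ⟪p x, v⟫
      - t * (⟪X v, v⟫ + η * ‖v‖ ^ 2)) t := by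
    intro t
    have e1 := (hasDerivAt_comp_add_smul hU x v t).sub ((hasDerivAt_id t).mul_const ⟪p x, v⟫)
    have e2 := e1.sub ((hasDerivAt_pow 2 t).mul_const ((⟪X v, v⟫ + η * ‖v‖ ^ 2) / 2))
    refine (e2.congr_deriv ?_)
    norm_num
    ring
  have hanti : AntitoneOn G (Icc 0 1) := by
    refine antitoneOn_of_deriv_nonpos (convex_Icc 0 1)
      (fun t _ => (hder t).continuousAt.continuousWithinAt)
      (fun t _ => (hder t).differentiableAt.differentiableWithinAt) fun t ht => ?_
    rw [interior_Icc] at ht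
    rw [(hder t).deriv]
    have htv : t • v ∈ ball (0 : E) δ := by
      rw [mem_ball_zero_iff, norm_smul, Real.norm_of_nonneg ht.1.le] at *
      nlinarith [norm_nonneg v, ht.2]
    have hb := hball _ htv
    rw [norm_smul, Real.norm_of_nonneg ht.1.le] at hb
    have e3 : ⟪p (x + t • v), v⟫ - ⟪p x, v⟫ - t * ⟪X v, v⟫ = ⟪p (x + t • v) - p x - X (t • v), v⟫ := by
      rw [inner_sub_left, inner_sub_left, map_smul, real_inner_smul_left]
    have e4 := real_inner_le_norm (p (x + t • v) - p x - X (t • v)) v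
    nlinarith [norm_nonneg v]
  have := hanti (left_mem_Icc.2 zero_le_one) (right_mem_Icc.2 zero_le_one) zero_le_one
  simp [hG] at this
  linarith

end SecondOrder

section TestFunctions

variable {N : ℕ}

/-- The matrix of the quadratic form `v ↦ ⟪A v, v⟫`. -/
def symMat (A : Euc N →L[ℝ] Euc N) : Matrix (Fin N) (Fin N) ℝ :=
  Matrix.of fun i j =>
    (⟪A (EuclideanSpace.single i 1), EuclideanSpace.single j 1⟫ +
      ⟪A (EuclideanSpace.single j 1), EuclideanSpace.single i 1⟫) / 2

theorem symMat_isSymm (A : Euc N →L[ℝ] Euc N) : (symMat A).IsSymm := by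
  ext i j
  simp [symMat, add_comm]

theorem symMat_add (A B : Euc N →L[ℝ] Euc N) : symMat (A + B) = symMat A + symMat B := by
  ext i j
  simp [symMat, inner_add_left]
  ring

theorem symMat_smul_one (c : ℝ) :
    symMat (c • ContinuousLinearMap.id ℝ (Euc N)) = c • (1 : Matrix (Fin N) (Fin N) ℝ) := by
  ext i j
  by_cases h : i = j
  · subst h; simp [symMat, real_inner_smul_left]
  · simp [symMat, h, Ne.symm h, real_inner_smul_left, EuclideanSpace.inner_single_left]

theorem dotProduct_symMat (A : Euc N →L[ℝ] Euc N) (v : Euc N) :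
    (v : Fin N → ℝ) ⬝ᵥ (symMat A).mulVec v = ⟪A v, v⟫ := by
  have hv : v = ∑ i, v i • EuclideanSpace.single i (1 : ℝ) := by
    ext j
    simp [Finset.sum_apply, Pi.single_apply]
  have h1 : ⟪A v, v⟫ = ∑ i, ∑ j, v i * v j *
      ⟪A (EuclideanSpace.single i 1), EuclideanSpace.single j 1⟫ := by
    conv_lhs => rw [hv]
    simp only [map_sum, map_smul, sum_inner, inner_sum, real_inner_smul_left,
      real_inner_smul_right]
    rw [Finset.sum_comm]
    refine Finset.sum_congr rfl fun i _ => Finset.sum_congr rfl fun j _ => ?_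
    ring
  have h2 : ⟪A v, v⟫ = ∑ i, ∑ j, v i * v j *
      ⟪A (EuclideanSpace.single j 1), EuclideanSpace.single i 1⟫ := by
    rw [h1, Finset.sum_comm]
    refine Finset.sum_congr rfl fun i _ => Finset.sum_congr rfl fun j _ => ?_
    ring
  have h3 : (v : Fin N → ℝ) ⬝ᵥ (symMat A).mulVec v =
      ((∑ i, ∑ j, v i * v j * ⟪A (EuclideanSpace.single i 1), EuclideanSpace.single j 1⟫) +
      ∑ i, ∑ j, v i * v j * ⟪A (EuclideanSpace.single j 1), EuclideanSpace.single i 1⟫) / 2 := by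
    simp only [dotProduct, Matrix.mulVec, symMat, Matrix.of_apply, Finset.mul_sum,
      ← Finset.sum_add_distrib, Finset.sum_div]
    refine Finset.sum_congr rfl fun i _ => Finset.sum_congr rfl fun j _ => ?_
    ring
  rw [h3, ← h1, ← h2]
  ring

/-- The quadratic polynomial with gradient `p` at `b` and second derivative given by `A`. -/
def quadTest (p : Euc N) (A : Euc N →L[ℝ] Euc N) (b w : Euc N) : ℝ :=
  ⟪p, w - b⟫ + ⟪A (w - b), w - b⟫ / 2

theorem contDiff_quadTest (p : Euc N) (A : Euc N →L[ℝ] Euc N) (b : Euc N) :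
    ContDiff ℝ 2 (quadTest p A b) := by
  unfold quadTest
  have h1 : ContDiff ℝ 2 fun w : Euc N => w - b := by fun_prop
  exact (contDiff_const.inner ℝ h1).add (((A.contDiff.comp h1).inner ℝ h1).div_const 2)

theorem hasFDerivAt_quadTest (p : Euc N) (A : Euc N →L[ℝ] Euc N) (b w : Euc N) :
    HasFDerivAt (quadTest p A b) (innerSL ℝ p +
      (1 / 2 : ℝ) • (innerSL ℝ (A (w - b)) + (innerSL ℝ (w - b)).comp A)) w := by
  have h0 : HasFDerivAt (fun w : Euc N => w - b) (ContinuousLinearMap.id ℝ (Euc N)) w :=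
    (hasFDerivAt_id w).sub_const b
  have h1 := (A.hasFDerivAt (x := w - b)).comp w h0
  have h2 := (h1.inner ℝ h0).mul_const (1 / 2 : ℝ)
  have h3 := ((innerSL ℝ p).hasFDerivAt (x := w - b)).comp w h0
  have h4 := h3.fun_add h2
  refine (h4.congr_of_eventuallyEq ?_).congr_fderiv ?_
  · exact Filter.Eventually.of_forall fun w => by simp [quadTest]; ring
  · ext v
    simp [real_inner_comm, inner_sub_left, inner_sub_right, mul_add, mul_sub]

theorem gradient_quadTest (p : Euc N) (A : Euc N →L[ℝ] Euc N) (b : Euc N) :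
    gradient (quadTest p A b) b = p := by
  have h : HasGradientAt (quadTest p A b) p b := by
    rw [hasGradientAt_iff_hasFDerivAt]
    refine (hasFDerivAt_quadTest p A b b).congr_fderiv ?_
    ext v
    simp
  exact h.gradient

theorem hess_quadTest (p : Euc N) (A : Euc N →L[ℝ] Euc N) (b : Euc N) :
    hess (quadTest p A b) b = symMat A := by
  have h1 : fderiv ℝ (quadTest p A b) = fun w => innerSL ℝ p +
      (1 / 2 : ℝ) • (innerSL ℝ (A (w - b)) + (innerSL ℝ (w - b)).comp A) :=
    funext fun w => (hasFDerivAt_quadTest p A b w).fderiv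
  ext i j
  simp only [hess, Matrix.of_apply, iteratedFDeriv_two_apply]
  rw [h1]
  have h0 : HasFDerivAt (fun w : Euc N => w - b) (ContinuousLinearMap.id ℝ (Euc N)) b :=
    (hasFDerivAt_id b).sub_const b
  have h2 : HasFDerivAt (fun w => innerSL ℝ (A (w - b)))
      ((innerSL ℝ).comp A : Euc N →L[ℝ] Euc N →L[ℝ] ℝ) b := by
    exact HasFDerivAt.comp (f := fun w => w - b) b
      (((innerSL ℝ).comp A : Euc N →L[ℝ] Euc N →L[ℝ] ℝ).hasFDerivAt) h0
  have h3 : HasFDerivAt (fun w => (innerSL ℝ (w - b)).comp A)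
      (((ContinuousLinearMap.compL ℝ (Euc N) (Euc N) ℝ).flip A).comp (innerSL ℝ)) b := by
    exact HasFDerivAt.comp (f := fun w => w - b) b
      (((ContinuousLinearMap.compL ℝ (Euc N) (Euc N) ℝ).flip A).comp (innerSL ℝ)).hasFDerivAt h0
  rw [(((h2.fun_add h3).fun_const_smul (1 / 2 : ℝ)).const_add (innerSL ℝ p)).fderiv]
  simp [symMat, real_inner_comm]
  ring

end TestFunctions

section Ellipticity

variable {N : ℕ}

/-- The trace of a positive semidefinite matrix bounds its quadratic form. -/
theorem dotProduct_mulVec_le_trace {P : Matrix (Fin N) (Fin N) ℝ} (hP : P.PosSemidef)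
    (v : Euc N) : (v : Fin N → ℝ) ⬝ᵥ P.mulVec v ≤ P.trace * ‖v‖ ^ 2 := by
  obtain ⟨m, w, rfl⟩ := Matrix.posSemidef_iff_eq_sum_vecMulVec.1 hP
  rw [Matrix.trace_sum, Finset.sum_mul, Matrix.sum_mulVec, dotProduct_sum]
  refine Finset.sum_le_sum fun i _ => ?_
  have h1 : (v : Fin N → ℝ) ⬝ᵥ (Matrix.vecMulVec (w i) (star (w i))).mulVec v =
      (∑ k, w i k * v k) ^ 2 := by
    rw [Matrix.vecMulVec_mulVec]
    simp [dotProduct, sq, Finset.sum_mul, Finset.mul_sum]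
    refine Finset.sum_congr rfl fun k _ => Finset.sum_congr rfl fun l _ => ?_
    ring
  have h2 : (Matrix.vecMulVec (w i) (star (w i))).trace = ∑ k, w i k ^ 2 := by
    simp [Matrix.trace, Matrix.vecMulVec_apply, sq]
  rw [h1, h2, EuclideanSpace.norm_sq_eq]
  simpa using Finset.sum_mul_sq_le_sq_mul_sq Finset.univ (w i) v

/-- Uniform ellipticity when the difference of the two matrices is bounded above by `m` and is very
negative in one direction. -/
theorem UnifElliptic.sub_le {lam Lam : ℝ} {F : Matrix (Fin N) (Fin N) ℝ → ℝ}
    (hF : UnifElliptic lam Lam F) (hlam : 0 ≤ lam) {m c : ℝ} (hm : 0 ≤ m)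
    {A B : Euc N →L[ℝ] Euc N} (hm' : ∀ v, ⟪A v + B v, v⟫ ≤ m * ‖v‖ ^ 2) {e : Euc N}
    (he : ‖e‖ = 1) (hc : ⟪A e + B e, e⟫ ≤ m - c) :
    F (symMat A) - F (symMat (-B)) ≤ Lam * (m * N) - lam * c := by
  set I := ContinuousLinearMap.id ℝ (Euc N)
  have hpos : ∀ D : Euc N →L[ℝ] Euc N, (∀ v, 0 ≤ ⟪D v, v⟫) → (symMat D).PosSemidef := by
    intro D hD
    refine Matrix.PosSemidef.of_dotProduct_mulVec_nonneg ?_ fun v => ?_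
    · rw [Matrix.IsHermitian, Matrix.conjTranspose_eq_transpose_of_trivial]
      exact symMat_isSymm D
    · have := dotProduct_symMat D (WithLp.toLp 2 v)
      simp only [star_trivial]
      exact this.symm ▸ hD _
  set P := m • I - (A + B) with hP
  have hPv : ∀ v, ⟪P v, v⟫ = m * ‖v‖ ^ 2 - ⟪A v + B v, v⟫ := by
    intro v
    simp [hP, I, inner_sub_left, real_inner_smul_left]
  have hPpos := hpos P fun v => by rw [hPv]; linarith [hm' v]
  have hmpos := hpos (m • I) fun v => by
    simp only [I, smul_apply, ContinuousLinearMap.id_apply, real_inner_smul_left,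
      real_inner_self_eq_norm_sq]
    positivity
  have h1 := (hF (symMat A) (symMat P) (symMat_isSymm A) hPpos).1
  have h2 := (hF (symMat (-B)) (symMat (m • I)) (symMat_isSymm _) hmpos).2
  have h3 : symMat A + symMat P = symMat (-B) + symMat (m • I) := by
    rw [← symMat_add, ← symMat_add]
    congr 1
    rw [hP]
    abel
  have h4 := dotProduct_mulVec_le_trace hPpos e
  rw [dotProduct_symMat, hPv, he] at h4
  have h5 : (symMat (m • I)).trace = m * N := by
    rw [symMat_smul_one]
    simp
  rw [h3] at h1
  rw [h5] at h2
  have h6 : lam * c ≤ lam * (symMat P).trace := by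
    refine mul_le_mul_of_nonneg_left ?_ hlam
    linarith
  linarith

end Ellipticity

section Doubling

open Filter
open scoped Topology

variable {E : Type*} [NormedAddCommGroup E] [InnerProductSpace ℝ E]

theorem norm_add_rpow_le {γ : ℝ} (hγ0 : 0 ≤ γ) (hγ2 : γ ≤ 2) {w : E} (hw : w ≠ 0) (v : E) :
    ‖w + v‖ ^ γ ≤ ‖w‖ ^ γ + γ * ‖w‖ ^ (γ - 2) * ⟪w, v⟫ + γ / 2 * ‖w‖ ^ (γ - 2) * ‖v‖ ^ 2 := by
  have hd : 0 < ‖w‖ := norm_pos_iff.2 hw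
  set s := (2 * ⟪w, v⟫ + ‖v‖ ^ 2) / ‖w‖ ^ 2 with hs
  have h1 : ‖w + v‖ ^ 2 = ‖w‖ ^ 2 * (1 + s) := by
    rw [norm_add_sq_real, hs]; field_simp; ring
  have hs1 : -1 ≤ s := by
    have : 0 ≤ ‖w‖ ^ 2 * (1 + s) := h1 ▸ sq_nonneg _
    have := nonneg_of_mul_nonneg_right this (by positivity)
    linarith
  have h2 : ∀ t : ℝ, 0 ≤ t → t ^ γ = (t ^ 2) ^ (γ / 2) := fun t ht => by
    rw [← Real.rpow_natCast_mul ht]; congr 1; push_cast; ring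
  have h3 : ‖w‖ ^ (γ - 2) * ‖w‖ ^ 2 = ‖w‖ ^ γ := by
    rw [← Real.rpow_natCast, ← Real.rpow_add hd]; norm_num
  calc ‖w + v‖ ^ γ = ‖w‖ ^ γ * (1 + s) ^ (γ / 2) := by
        rw [h2 _ (norm_nonneg _), h1, Real.mul_rpow (by positivity) (by linarith),
          ← h2 _ (norm_nonneg _)]
    _ ≤ ‖w‖ ^ γ * (1 + γ / 2 * s) :=
        mul_le_mul_of_nonneg_left
          (rpow_one_add_le_one_add_mul_self hs1 (by linarith) (by linarith)) (by positivity)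
    _ = ‖w‖ ^ γ + γ / 2 * ‖w‖ ^ (γ - 2) * (‖w‖ ^ 2 * s) := by rw [← h3]; ring
    _ = _ := by rw [hs, mul_div_cancel₀ _ (by positivity)]; ring

theorem exists_lipschitzOnWith_rpow_smul [FiniteDimensional ℝ E] (c s : ℝ) {w : E} (hw : w ≠ 0) :
    ∃ C : NNReal, ∃ t ∈ 𝓝 w, LipschitzOnWith C (fun w : E => (c * ‖w‖ ^ s) • w) t := by
  refine ContDiffAt.exists_lipschitzOnWith (𝕂 := ℝ) ?_
  have h1 : ContDiffAt ℝ 1 (fun w : E => ‖w‖) w := contDiffAt_norm ℝ hw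
  exact (contDiffAt_const.mul (h1.rpow_const_of_ne (norm_ne_zero_iff.2 hw))).smul contDiffAt_id

variable {U V : E → ℝ} {p q : E → E} {X Y : E →L[ℝ] E} {x y : E}

/-- Second order condition along a line at a maximum of `U x + V y - k`. -/
theorem inner_add_inner_le_of_isLocalMax (hU : ∀ x, HasFDerivAt U (innerSL ℝ (p x)) x)
    (hV : ∀ y, HasFDerivAt V (innerSL ℝ (q y)) y) (hX : HasFDerivAt p X x)
    (hY : HasFDerivAt q Y y) {v w : E} {ψ ψ' : ℝ → ℝ} {c L a b m : ℝ}
    (hψ : ∀ᶠ t in 𝓝 0, HasDerivAt ψ (ψ' t) t) (hψ' : HasDerivAt ψ' c 0)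
    (hmax : IsLocalMax (fun τ : ℝ => U (x + τ • v) + V (y + τ • w) - L * ψ τ
      - (a + b * τ + m * τ ^ 2)) 0) :
    ⟪X v, v⟫ + ⟪Y w, w⟫ ≤ L * c + 2 * m := by
  have h1 : ∀ᶠ t in 𝓝 (0 : ℝ), HasDerivAt (fun τ : ℝ => U (x + τ • v) + V (y + τ • w) - L * ψ τ
      - (a + b * τ + m * τ ^ 2)) (⟪p (x + t • v), v⟫ + ⟪q (y + t • w), w⟫ - L * ψ' t
      - (b + 2 * m * t)) t := by
    filter_upwards [hψ] with t ht
    have hq : HasDerivAt (fun τ : ℝ => a + b * τ + m * τ ^ 2) (b + 2 * m * t) t := by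
      refine (((hasDerivAt_id t).const_mul b).const_add a |>.add
        ((hasDerivAt_pow 2 t).const_mul m)).congr_deriv ?_
      norm_num
      ring
    exact (((hasDerivAt_comp_add_smul hU x v t).add (hasDerivAt_comp_add_smul hV y w t)).sub
      (ht.const_mul L)).sub hq
  have h2 : HasDerivAt (fun t : ℝ => ⟪p (x + t • v), v⟫ + ⟪q (y + t • w), w⟫ - L * ψ' t
      - (b + 2 * m * t)) (⟪X v, v⟫ + ⟪Y w, w⟫ - L * c - 2 * m) 0 := by
    have hq : HasDerivAt (fun τ : ℝ => b + 2 * m * τ) (2 * m) 0 := by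
      simpa using ((hasDerivAt_id (0 : ℝ)).const_mul (2 * m)).const_add b
    exact (((hasDerivAt_inner_comp_add_smul hX v).add (hasDerivAt_inner_comp_add_smul hY w)).sub
      (hψ'.const_mul L)).sub hq
  linarith [second_deriv_nonpos_of_isLocalMax h1 h2 hmax]

/-- The doubled functional `U x + V y - L |x - y|^γ - M |x - x₀|²`, tilted by `ξ`. -/
def doubled (U V : E → ℝ) (L M γ : ℝ) (x₀ : E) (ξ z : E × E) : ℝ :=
  U z.1 + V z.2 - L * ‖z.1 - z.2‖ ^ γ - M * ‖z.1 - x₀‖ ^ 2 - ⟪ξ.1, z.1⟫ - ⟪ξ.2, z.2⟫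

variable {L M γ : ℝ} {x₀ : E} {ξ : E × E}

theorem fst_le_of_isLocalMax (hL : 0 ≤ L) (hγ0 : 0 ≤ γ) (hγ1 : γ ≤ 1) (hxy : x ≠ y)
    (hmax : IsLocalMax (doubled U V L M γ x₀ ξ) (x, y)) :
    ∀ᶠ v in 𝓝 (0 : E), U (x + v) ≤ U x +
      ⟪(L * γ * ‖x - y‖ ^ (γ - 2)) • (x - y) + (2 * M) • (x - x₀) + ξ.1, v⟫ +
      (L * γ / 2 * ‖x - y‖ ^ (γ - 2) + M) * ‖v‖ ^ 2 := by
  have hc : Tendsto (fun v : E => (x + v, y)) (𝓝 0) (𝓝 (x, y)) :=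
    Continuous.tendsto' (by fun_prop) _ _ (by simp)
  filter_upwards [hc.eventually hmax] with v hv
  have h1 := norm_add_rpow_le hγ0 (by linarith) (sub_ne_zero.2 hxy) v
  have e1 : x + v - y = x - y + v := by abel
  have e2 : x + v - x₀ = x - x₀ + v := by abel
  simp only [doubled] at hv
  rw [e1, e2, norm_add_sq_real, inner_add_right] at hv
  rw [inner_add_left, inner_add_left, real_inner_smul_left, real_inner_smul_left]
  nlinarith [mul_le_mul_of_nonneg_left h1 hL]

theorem snd_le_of_isLocalMax (hL : 0 ≤ L) (hγ0 : 0 ≤ γ) (hγ1 : γ ≤ 1) (hxy : x ≠ y)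
    (hmax : IsLocalMax (doubled U V L M γ x₀ ξ) (x, y)) :
    ∀ᶠ v in 𝓝 (0 : E), V (y + v) ≤ V y +
      ⟪-((L * γ * ‖x - y‖ ^ (γ - 2)) • (x - y)) + ξ.2, v⟫ +
      (L * γ / 2 * ‖x - y‖ ^ (γ - 2)) * ‖v‖ ^ 2 := by
  have hc : Tendsto (fun v : E => (x, y + v)) (𝓝 0) (𝓝 (x, y)) :=
    Continuous.tendsto' (by fun_prop) _ _ (by simp)
  filter_upwards [hc.eventually hmax] with v hv
  have h1 := norm_add_rpow_le hγ0 (by linarith) (sub_ne_zero.2 hxy) (-v)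
  have e1 : x - (y + v) = x - y + -v := by abel
  simp only [doubled] at hv
  rw [e1, inner_add_right] at hv
  rw [inner_neg_right, norm_neg] at h1
  rw [inner_add_left, inner_neg_left, real_inner_smul_left]
  nlinarith [mul_le_mul_of_nonneg_left h1 hL]

theorem inner_add_inner_le_of_isLocalMax_doubled
    (hU : ∀ x, HasFDerivAt U (innerSL ℝ (p x)) x)
    (hV : ∀ y, HasFDerivAt V (innerSL ℝ (q y)) y) (hX : HasFDerivAt p X x)
    (hY : HasFDerivAt q Y y) (hmax : IsLocalMax (doubled U V L M γ x₀ ξ) (x, y)) (v : E) :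
    ⟪X v, v⟫ + ⟪Y v, v⟫ ≤ 2 * M * ‖v‖ ^ 2 := by
  have hc : Tendsto (fun τ : ℝ => (x + τ • v, y + τ • v)) (𝓝 0) (𝓝 (x, y)) :=
    Continuous.tendsto' (by fun_prop) _ _ (by simp)
  have key := inner_add_inner_le_of_isLocalMax hU hV hX hY (v := v) (w := v)
    (ψ := fun _ => ‖x - y‖ ^ γ) (ψ' := fun _ => 0) (c := 0) (L := L)
    (a := M * ‖x - x₀‖ ^ 2 + ⟪ξ.1, x⟫ + ⟪ξ.2, y⟫)
    (b := 2 * M * ⟪x - x₀, v⟫ + ⟪ξ.1, v⟫ + ⟪ξ.2, v⟫) (m := M * ‖v‖ ^ 2)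
    (Eventually.of_forall fun t => hasDerivAt_const _ _) (hasDerivAt_const _ _) ?_
  · linarith
  · have hfun : (fun τ : ℝ => U (x + τ • v) + V (y + τ • v) - L * ‖x - y‖ ^ γ
        - (M * ‖x - x₀‖ ^ 2 + ⟪ξ.1, x⟫ + ⟪ξ.2, y⟫ +
          (2 * M * ⟪x - x₀, v⟫ + ⟪ξ.1, v⟫ + ⟪ξ.2, v⟫) * τ + M * ‖v‖ ^ 2 * τ ^ 2)) =
        fun τ : ℝ => doubled U V L M γ x₀ ξ (x + τ • v, y + τ • v) := by
      funext τ
      have e1 : x + τ • v - (y + τ • v) = x - y := by abel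
      have e2 : x + τ • v - x₀ = x - x₀ + τ • v := by abel
      simp only [doubled]
      rw [e1, e2, norm_add_sq_real, norm_smul, mul_pow, Real.norm_eq_abs, sq_abs]
      simp only [inner_add_right, real_inner_smul_right]
      ring
    rw [hfun]
    have h0 : (x + (0 : ℝ) • v, y + (0 : ℝ) • v) = (x, y) := by simp
    filter_upwards [hc.eventually hmax] with τ hτ
    rwa [h0]

theorem inner_add_inner_le_of_isLocalMax_doubled_direction
    (hU : ∀ x, HasFDerivAt U (innerSL ℝ (p x)) x)
    (hV : ∀ y, HasFDerivAt V (innerSL ℝ (q y)) y) (hX : HasFDerivAt p X x)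
    (hY : HasFDerivAt q Y y) (hmax : IsLocalMax (doubled U V L M γ x₀ ξ) (x, y)) {e : E} {d : ℝ}
    (hd : 0 < d) (he : ‖e‖ = 1) (hxy : x - y = d • e) :
    ⟪X e, e⟫ + ⟪Y e, e⟫ ≤ 2 * M - 4 * (L * γ * (1 - γ) * d ^ (γ - 2)) := by
  have hc : Tendsto (fun τ : ℝ => (x + τ • e, y + τ • (-e))) (𝓝 0) (𝓝 (x, y)) :=
    Continuous.tendsto' (by fun_prop) _ _ (by simp)
  have hpos : ∀ᶠ t : ℝ in 𝓝 0, 0 < d + 2 * t :=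
    (Continuous.tendsto' (by fun_prop : Continuous fun t : ℝ => d + 2 * t) 0 d
      (by simp)).eventually (lt_mem_nhds hd)
  have hlin : ∀ t : ℝ, HasDerivAt (fun t : ℝ => d + 2 * t) 2 t := fun t => by
    simpa using ((hasDerivAt_id t).const_mul 2).const_add d
  have hψ : ∀ᶠ t : ℝ in 𝓝 0, HasDerivAt (fun t : ℝ => (d + 2 * t) ^ γ)
      (2 * γ * (d + 2 * t) ^ (γ - 1)) t := by
    filter_upwards [hpos] with t ht
    exact (hlin t).rpow_const (Or.inl ht.ne')
  have hψ' : HasDerivAt (fun t : ℝ => 2 * γ * (d + 2 * t) ^ (γ - 1))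
      (4 * γ * (γ - 1) * d ^ (γ - 2)) 0 := by
    have h1 := ((hlin 0).rpow_const (p := γ - 1) (Or.inl (by simpa using hd.ne'))).const_mul (2 * γ)
    refine h1.congr_deriv ?_
    rw [show γ - 1 - 1 = γ - 2 by ring]
    simp only [mul_zero, add_zero]
    ring
  have key := inner_add_inner_le_of_isLocalMax hU hV hX hY (v := e) (w := -e) (L := L)
    (a := M * ‖x - x₀‖ ^ 2 + ⟪ξ.1, x⟫ + ⟪ξ.2, y⟫)
    (b := 2 * M * ⟪x - x₀, e⟫ + ⟪ξ.1, e⟫ - ⟪ξ.2, e⟫) (m := M) hψ hψ' ?_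
  · simp only [map_neg, inner_neg_neg] at key
    linarith
  · have hfun : (fun τ : ℝ => doubled U V L M γ x₀ ξ (x + τ • e, y + τ • (-e))) =ᶠ[𝓝 0]
        (fun τ : ℝ => U (x + τ • e) + V (y + τ • (-e)) - L * (d + 2 * τ) ^ γ
        - (M * ‖x - x₀‖ ^ 2 + ⟪ξ.1, x⟫ + ⟪ξ.2, y⟫ +
          (2 * M * ⟪x - x₀, e⟫ + ⟪ξ.1, e⟫ - ⟪ξ.2, e⟫) * τ + M * τ ^ 2)) := by
      filter_upwards [hpos] with τ hτ
      have e1 : x + τ • e - (y + τ • (-e)) = (d + 2 * τ) • e := by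
        rw [add_smul, ← hxy, smul_neg]; module
      have e2 : x + τ • e - x₀ = x - x₀ + τ • e := by abel
      simp only [doubled]
      rw [e1, e2, norm_add_sq_real, norm_smul, norm_smul, mul_pow, Real.norm_of_nonneg hτ.le,
        Real.norm_eq_abs, sq_abs, he]
      simp only [inner_add_right, real_inner_smul_right, inner_neg_right]
      ring_nf
    refine IsLocalMax.congr ?_ hfun
    have h0 : (x + (0 : ℝ) • e, y + (0 : ℝ) • (-e)) = (x, y) := by simp
    filter_upwards [hc.eventually hmax] with τ hτ
    rwa [h0]

end Doubling

section Jets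

open Filter
open scoped Topology

variable {E : Type*} [NormedAddCommGroup E] [InnerProductSpace ℝ E]

/-- At a point where the envelope `U` is touched from above by a paraboloid of opening less than
`κ`, the value of `U` is attained at a point `b ∈ K`, where `u` inherits the second order
expansion of `U`. -/
theorem exists_contact_of_eventually_le {K : Set E} {u U : E → ℝ} {p : E → E} {X : E →L[ℝ] E}
    {x : E} {κ c : ℝ} (hκ : 0 < κ) (hle : ∀ b ∈ K, ∀ x, u b ≤ U x + κ * ‖x - b‖ ^ 2)
    (hU : ∀ x, HasFDerivAt U (innerSL ℝ (p x)) x)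
    (hcontact : ∀ x, (∀ e, (∀ τ ∈ Icc (0 : ℝ) 1,
        U (x + τ • e) = U x + τ * ⟪p x, e⟫ + κ * τ ^ 2 * ‖e‖ ^ 2) → e = 0) →
      x + (2 * κ)⁻¹ • p x ∈ K ∧ U x = u (x + (2 * κ)⁻¹ • p x) - ‖p x‖ ^ 2 / (4 * κ))
    (hX : HasFDerivAt p X x) (hc : c < κ)
    (htouch : ∀ᶠ v in 𝓝 (0 : E), U (x + v) ≤ U x + ⟪p x, v⟫ + c * ‖v‖ ^ 2) :
    ∃ b ∈ K, U x = u b - κ * ‖b - x‖ ^ 2 ∧ ∀ η > (0 : ℝ), ∀ᶠ w in 𝓝 b,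
      w ∈ K → u w ≤ u b + ⟪p x, w - b⟫ +
        ⟪(X + η • ContinuousLinearMap.id ℝ E) (w - b), w - b⟫ / 2 := by
  obtain ⟨hbK, hbU⟩ := hcontact x fun e he => by
    have ht : Tendsto (fun τ : ℝ => τ • e) (𝓝[>] 0) (𝓝 0) :=
      (Continuous.tendsto' (by fun_prop) _ _ (by simp)).mono_left nhdsWithin_le_nhds
    obtain ⟨τ, hτ1, hτ0, hτ2⟩ := ((ht.eventually htouch).and
      (Ioc_mem_nhdsGT (zero_lt_one' ℝ))).exists
    rw [he τ ⟨hτ0.le, hτ2⟩, real_inner_smul_right, norm_smul, mul_pow, Real.norm_eq_abs,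
      sq_abs] at hτ1
    have h1 : (κ - c) * (τ ^ 2 * ‖e‖ ^ 2) ≤ 0 := by linarith
    have h2 : τ ^ 2 * ‖e‖ ^ 2 ≤ 0 := nonpos_of_mul_nonpos_right h1 (sub_pos.2 hc)
    have h3 : ‖e‖ ^ 2 ≤ 0 := nonpos_of_mul_nonpos_right h2 (by positivity)
    have h4 : ‖e‖ = 0 := by simpa using le_antisymm h3 (sq_nonneg _)
    exact norm_eq_zero.1 h4
  set b := x + (2 * κ)⁻¹ • p x with hb
  have hbx : b - x = (2 * κ)⁻¹ • p x := by rw [hb]; abel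
  have hUb : U x = u b - κ * ‖b - x‖ ^ 2 := by
    rw [hbU, hbx, norm_smul, mul_pow, Real.norm_eq_abs, sq_abs]
    field_simp
    ring
  refine ⟨b, hbK, hUb, fun η hη => ?_⟩
  have ht : Tendsto (fun w : E => w - b) (𝓝 b) (𝓝 0) :=
    Continuous.tendsto' (by fun_prop) _ _ (by simp)
  filter_upwards [ht.eventually (eventually_le_taylor hU hX hη)] with w hw hwK
  have h1 := hle w hwK (x + (w - b))
  have e1 : x + (w - b) - w = -(b - x) := by abel
  rw [e1, norm_neg] at h1
  have e2 : ⟪(X + η • ContinuousLinearMap.id ℝ E) (w - b), w - b⟫ =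
      ⟪X (w - b), w - b⟫ + η * ‖w - b‖ ^ 2 := by
    simp [inner_add_left, real_inner_smul_left]
  rw [e2]
  linarith

theorem norm_sub_lt_of_mul_sq_lt {F : Type*} [SeminormedAddCommGroup F] {x y : F}
    {c a δ : ℝ} (hc : 0 ≤ c) (hδ : 0 ≤ δ) (h : c * ‖x - y‖ ^ 2 ≤ a) (ha : a < c * δ ^ 2) : ‖x - y‖ < δ :=
  lt_of_pow_lt_pow_left₀ 2 hδ (lt_of_mul_lt_mul_left (h.trans_lt ha) hc)

variable [FiniteDimensional ℝ E]

/-- If `u x - u y ≤ L |x - y|^γ + M |x - x₀|²` fails then there are test quadratics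
for `u` from above and below whose second derivatives are strongly negative in one direction. -/
theorem exists_jets {u : E → ℝ} {R r ρ Cu L M γ d₀ : ℝ} {x₀ x₁ y₁ : E}
    (hu : ContinuousOn u (closedBall 0 R)) (hR : R ≤ 1)
    (hub : ∀ x ∈ closedBall (0 : E) R, |u x| ≤ Cu) (hx₀ : ‖x₀‖ ≤ r) (hρ : 0 < ρ)
    (hrR : r + 3 * ρ ≤ R) (hL : 0 < L) (hM : 0 ≤ M) (hγ : γ ∈ Ioo (0 : ℝ) 1) (hd₀ : 0 < d₀)
    (hd₀ρ : d₀ ≤ ρ) (hLd : 2 * Cu ≤ L * d₀ ^ γ) (hMρ : 2 * Cu ≤ M * ρ ^ 2)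
    (hx₁ : x₁ ∈ closedBall (0 : E) R) (hy₁ : y₁ ∈ closedBall (0 : E) R)
    (hlt : L * ‖x₁ - y₁‖ ^ γ + M * ‖x₁ - x₀‖ ^ 2 < u x₁ - u y₁) :
    ∃ (b b' p q e : E) (A B : E →L[ℝ] E) (d : ℝ), b ∈ ball (0 : E) R ∧ b' ∈ ball (0 : E) R ∧
      0 < d ∧ d < d₀ ∧ ‖e‖ = 1 ∧ ‖p - (L * γ * d ^ (γ - 1)) • e‖ ≤ 2 * M + 1 ∧
      ‖q - (L * γ * d ^ (γ - 1)) • e‖ ≤ 2 * M + 1 ∧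
      (∀ v, ⟪A v + B v, v⟫ ≤ (2 * M + 1) * ‖v‖ ^ 2) ∧
      ⟪A e + B e, e⟫ ≤ (2 * M + 1) - 4 * (1 - γ) * (L * γ * d ^ (γ - 1)) / d ∧
      (∀ᶠ w in 𝓝 b, u w ≤ u b + (⟪p, w - b⟫ + ⟪A (w - b), w - b⟫ / 2)) ∧
      ∀ᶠ w in 𝓝 b', u b' + (⟪q, w - b'⟫ + ⟪-B (w - b'), w - b'⟫ / 2) ≤ u w := by
  obtain ⟨hγ0, hγ1⟩ := hγ
  set K := closedBall (0 : E) R with hKdef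
  have hK : IsCompact K := isCompact_closedBall 0 R
  set θ := u x₁ - u y₁ - L * ‖x₁ - y₁‖ ^ γ - M * ‖x₁ - x₀‖ ^ 2 with hθdef
  have hθ : 0 < θ := by rw [hθdef]; linarith
  obtain ⟨m, hm, hum⟩ := Metric.uniformContinuousOn_iff.1
    (hK.uniformContinuousOn_of_continuous hu) (θ / 2) (by positivity)
  obtain ⟨κ, hκ, hκm, hκd, hκρ⟩ : ∃ κ > 0, 2 * Cu < κ / 2 * (m / 4) ^ 2 ∧
      L * γ / 2 * (m / 2) ^ (γ - 2) + M < κ ∧ 2 * Cu < κ * ρ ^ 2 := by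
    have h1 : ∀ᶠ κ : ℝ in atTop, 2 * Cu < κ / 2 * (m / 4) ^ 2 :=
      ((tendsto_id.atTop_div_const two_pos).atTop_mul_const
        (by positivity)).eventually_gt_atTop _
    have h2 : ∀ᶠ κ : ℝ in atTop, 2 * Cu < κ * ρ ^ 2 :=
      (tendsto_id.atTop_mul_const (by positivity)).eventually_gt_atTop _
    obtain ⟨κ, h3, h4, h5, h6⟩ := ((eventually_gt_atTop 0).and
      (h1.and ((eventually_gt_atTop _).and h2))).exists
    exact ⟨κ, h3, h4, h5, h6⟩
  obtain ⟨U, p, hU1, hU2, hU3, hp, hU5⟩ := exists_regular_envelope hK ⟨x₁, hx₁⟩ hu hκ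
  obtain ⟨V, q, hV1, hV2, hV3, hq, hV5⟩ := exists_regular_envelope hK ⟨x₁, hx₁⟩ hu.neg hκ
  have hUd : ∀ x, HasFDerivAt U (innerSL ℝ (p x)) x := fun x => hasFDerivAt_of_abs_le_sq (hU3 x)
  have hVd : ∀ x, HasFDerivAt V (innerSL ℝ (q x)) x := fun x => hasFDerivAt_of_abs_le_sq (hV3 x)
  set G : E × E → E × E := fun z =>
    (p z.1 - ((L * γ * ‖z.1 - z.2‖ ^ (γ - 2)) • (z.1 - z.2) + (2 * M) • (z.1 - x₀)),
      q z.2 + (L * γ * ‖z.1 - z.2‖ ^ (γ - 2)) • (z.1 - z.2)) with hGdef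
  have hG : ∀ z ∈ {z : E × E | z.1 ≠ z.2}, ∃ C, ∃ t ∈ 𝓝 z, LipschitzOnWith C G t := by
    intro z hz
    obtain ⟨C, t, ht, hC⟩ := exists_lipschitzOnWith_rpow_smul (L * γ) (γ - 2) (sub_ne_zero.2 hz)
    have hsub : LipschitzWith (1 + 1) fun z : E × E => z.1 - z.2 :=
      LipschitzWith.prod_fst.sub LipschitzWith.prod_snd
    have hs : LipschitzOnWith (C * (1 + 1))
        (fun z : E × E => (L * γ * ‖z.1 - z.2‖ ^ (γ - 2)) • (z.1 - z.2))
        ((fun z : E × E => z.1 - z.2) ⁻¹' t) :=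
      hC.comp hsub.lipschitzOnWith (mapsTo_preimage _ _)
    have hM' : LipschitzWith (‖2 * M‖₊ * (1 + 0)) fun z : E × E => (2 * M) • (z.1 - x₀) :=
      (lipschitzWith_smul (2 * M)).comp (LipschitzWith.prod_fst.sub (LipschitzWith.const x₀))
    refine ⟨_, _, hsub.continuous.continuousAt.preimage_mem_nhds ht, LipschitzOnWith.prodMk
      ((hp.comp LipschitzWith.prod_fst).lipschitzOnWith.sub (hs.add hM'.lipschitzOnWith))
      ((hq.comp LipschitzWith.prod_snd).lipschitzOnWith.add hs)⟩
  obtain ⟨ξ, hξ, hGξ⟩ := exists_small_value_differentiableAt hp hq hG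
    (η := min 1 (θ / 8)) (by positivity)
  rw [mem_ball_zero_iff, lt_min_iff] at hξ
  have hξ1 : ‖ξ.1‖ ≤ ‖ξ‖ := norm_fst_le ξ
  have hξ2 : ‖ξ.2‖ ≤ ‖ξ‖ := norm_snd_le ξ
  obtain ⟨⟨x, y⟩, hxyK, hmax⟩ := (hK.prod hK).exists_isMaxOn ⟨(x₁, y₁), hx₁, hy₁⟩
    (f := doubled U V L M γ x₀ ξ) (by
      have hUc : Continuous U := continuous_iff_continuousAt.2 fun x => (hUd x).continuousAt
      have hVc : Continuous V := continuous_iff_continuousAt.2 fun x => (hVd x).continuousAt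
      have hnc : Continuous fun z : E × E => ‖z.1 - z.2‖ ^ γ :=
        (continuous_fst.sub continuous_snd).norm.rpow_const fun _ => Or.inr hγ0.le
      unfold doubled
      fun_prop)
  have hin : ∀ ζ : E, ‖ζ‖ ≤ ‖ξ‖ → ∀ z ∈ K, |⟪ζ, z⟫| ≤ θ / 8 := fun ζ hζ z hz => by
    have hz1 : ‖z‖ ≤ 1 := (mem_closedBall_zero_iff.1 hz).trans hR
    calc |⟪ζ, z⟫| ≤ ‖ζ‖ * ‖z‖ := abs_real_inner_le_norm _ _
      _ ≤ ‖ζ‖ * 1 := by gcongr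
      _ ≤ θ / 8 := by linarith
  have hval : θ / 2 ≤ U x + V y - L * ‖x - y‖ ^ γ - M * ‖x - x₀‖ ^ 2 := by
    have h0 : doubled U V L M γ x₀ ξ (x₁, y₁) ≤ doubled U V L M γ x₀ ξ (x, y) :=
      hmax (mem_prod.2 ⟨hx₁, hy₁⟩)
    simp only [doubled] at h0
    have h1 := hU1 x₁ hx₁ x₁
    have h2 := hV1 y₁ hy₁ y₁
    simp only [sub_self, norm_zero, Pi.neg_apply] at h1 h2
    have h3 := abs_le.1 (hin _ hξ1 x hxyK.1)
    have h4 := abs_le.1 (hin _ hξ2 y hxyK.2)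
    have h5 := abs_le.1 (hin _ hξ1 x₁ hx₁)
    have h6 := abs_le.1 (hin _ hξ2 y₁ hy₁)
    linarith
  obtain ⟨b₁, hb₁K, hb₁⟩ := hU2 x
  obtain ⟨b₂, hb₂K, hb₂⟩ := hV2 y
  simp only [Pi.neg_apply] at hb₂
  have hub1 := abs_le.1 (hub b₁ hb₁K)
  have hub2 := abs_le.1 (hub b₂ hb₂K)
  have hnn1 : 0 ≤ κ / 2 * ‖x - b₁‖ ^ 2 := by positivity
  have hnn2 : 0 ≤ κ / 2 * ‖y - b₂‖ ^ 2 := by positivity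
  have hnn3 : 0 ≤ L * ‖x - y‖ ^ γ := by positivity
  have hnn4 : 0 ≤ M * ‖x - x₀‖ ^ 2 := by positivity
  set d := ‖x - y‖ with hddef
  have hdd₀ : d < d₀ := by
    refine (Real.rpow_lt_rpow_iff (norm_nonneg _) hd₀.le hγ0).1 ?_
    exact lt_of_mul_lt_mul_left (by linarith : L * d ^ γ < L * d₀ ^ γ) hL.le
  have hxx₀ : ‖x - x₀‖ < ρ := norm_sub_lt_of_mul_sq_lt hM hρ.le
    (by linarith : M * ‖x - x₀‖ ^ 2 ≤ 2 * Cu - θ / 2) (by linarith)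
  have hx : ‖x‖ < r + ρ := by linarith [norm_le_norm_add_norm_sub' x x₀]
  have hy : ‖y‖ < r + 2 * ρ := by linarith [norm_le_norm_add_norm_sub x y]
  have hdm : m / 2 ≤ d := by
    have h1 : ‖x - b₁‖ < m / 4 := norm_sub_lt_of_mul_sq_lt (by positivity) (by positivity)
      (by linarith : κ / 2 * ‖x - b₁‖ ^ 2 ≤ 2 * Cu) hκm
    have h2 : ‖y - b₂‖ < m / 4 := norm_sub_lt_of_mul_sq_lt (by positivity) (by positivity)
      (by linarith : κ / 2 * ‖y - b₂‖ ^ 2 ≤ 2 * Cu) hκm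
    have h3 : m ≤ dist b₁ b₂ := by
      by_contra! hcon
      have := hum b₁ hb₁K b₂ hb₂K hcon
      rw [Real.dist_eq] at this
      linarith [(abs_lt.1 this).2]
    have h4 := dist_triangle4 b₁ x y b₂
    rw [dist_eq_norm y, dist_eq_norm x, dist_comm b₁ x, dist_eq_norm x] at h4
    linarith
  have hd : 0 < d := lt_of_lt_of_le (by positivity) hdm
  have hxy : x ≠ y := fun h => hd.ne' (by rw [hddef, h, sub_self, norm_zero])
  have hloc : IsLocalMax (doubled U V L M γ x₀ ξ) (x, y) := hmax.isLocalMax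
    (prod_mem_nhds (closedBall_mem_nhds_of_mem (mem_ball_zero_iff.2 (by linarith)))
      (closedBall_mem_nhds_of_mem (mem_ball_zero_iff.2 (by linarith))))
  have hfst := fst_le_of_isLocalMax hL.le hγ0.le hγ1.le hxy hloc
  have hsnd := snd_le_of_isLocalMax hL.le hγ0.le hγ1.le hxy hloc
  have hpx := eq_of_eventually_le_quadratic (hUd x) hfst
  have hqy := eq_of_eventually_le_quadratic (hVd y) hsnd
  rw [← hpx] at hfst
  rw [← hqy] at hsnd
  obtain ⟨hpX, hqY⟩ := hGξ (x, y) hxy (by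
    simp only [hGdef]
    rw [hpx, hqy]
    ext1
    · simp only; abel
    · simp only; abel)
  replace hpX := hpX.hasFDerivAt
  replace hqY := hqY.hasFDerivAt
  set X := fderiv ℝ p x
  set Y := fderiv ℝ q y
  have hdpow : L * γ / 2 * d ^ (γ - 2) ≤ L * γ / 2 * (m / 2) ^ (γ - 2) :=
    mul_le_mul_of_nonneg_left (Real.rpow_le_rpow_of_nonpos (by positivity) hdm (by linarith))
      (by positivity)
  obtain ⟨b, hbK, hbU, hb⟩ := exists_contact_of_eventually_le hκ hU1 hUd hU5 hpX
    (by linarith) hfst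
  obtain ⟨b', hbK', hbV, hb'⟩ := exists_contact_of_eventually_le hκ hV1 hVd hV5 hqY
    (by linarith) hsnd
  simp only [Pi.neg_apply] at hbV hb'
  have hubb := abs_le.1 (hub b hbK)
  have hubb' := abs_le.1 (hub b' hbK')
  have hbxρ : ‖b - x‖ < ρ := norm_sub_lt_of_mul_sq_lt hκ.le hρ.le
    (by linarith : κ * ‖b - x‖ ^ 2 ≤ 2 * Cu) hκρ
  have hbyρ : ‖b' - y‖ < ρ := norm_sub_lt_of_mul_sq_lt hκ.le hρ.le
    (by linarith : κ * ‖b' - y‖ ^ 2 ≤ 2 * Cu) hκρ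
  have hbR : b ∈ ball (0 : E) R := mem_ball_zero_iff.2 (by
    linarith [norm_le_norm_add_norm_sub' b x])
  have hbR' : b' ∈ ball (0 : E) R := mem_ball_zero_iff.2 (by
    linarith [norm_le_norm_add_norm_sub' b' y])
  have hxyd : x - y = d • (d⁻¹ • (x - y)) := by rw [smul_inv_smul₀ hd.ne']
  have he : ‖d⁻¹ • (x - y)‖ = 1 := by
    rw [norm_smul, norm_inv, Real.norm_of_nonneg hd.le, ← hddef, inv_mul_cancel₀ hd.ne']
  have hpow1 : d ^ (γ - 2) = d ^ (γ - 1) * d⁻¹ := by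
    rw [← Real.rpow_neg_one, ← Real.rpow_add hd]; ring_nf
  have hℓ : (L * γ * d ^ (γ - 1)) • d⁻¹ • (x - y) = (L * γ * d ^ (γ - 2)) • (x - y) := by
    rw [smul_smul, hpow1, mul_assoc]
  refine ⟨b, b', p x, -q y, d⁻¹ • (x - y), X + (1 / 2 : ℝ) • ContinuousLinearMap.id ℝ E,
    Y + (1 / 2 : ℝ) • ContinuousLinearMap.id ℝ E, d, hbR, hbR', hd, hdd₀, he, ?_, ?_, ?_, ?_,
    ?_, ?_⟩
  · rw [hℓ, hpx, add_assoc, add_sub_cancel_left]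
    have h1 : ‖(2 * M) • (x - x₀)‖ ≤ 2 * M := by
      rw [norm_smul, Real.norm_of_nonneg (by positivity)]
      exact mul_le_of_le_one_right (by positivity)
        (by linarith [norm_nonneg x₀])
    linarith [norm_add_le ((2 * M) • (x - x₀)) ξ.1]
  · rw [hℓ, hqy, neg_add, neg_neg, add_sub_cancel_left, norm_neg]
    linarith
  · intro v
    have := inner_add_inner_le_of_isLocalMax_doubled hUd hVd hpX hqY hloc v
    simp only [add_apply, smul_apply, ContinuousLinearMap.id_apply,
      inner_add_left, real_inner_smul_left, real_inner_self_eq_norm_sq]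
    linarith
  · have := inner_add_inner_le_of_isLocalMax_doubled_direction hUd hVd hpX hqY hloc hd he hxyd
    simp only [add_apply, smul_apply, ContinuousLinearMap.id_apply,
      inner_add_left (𝕜 := ℝ), real_inner_smul_left _ _ (1 / 2 : ℝ),
      real_inner_self_eq_norm_sq, he]
    rw [hpow1] at this
    rw [div_eq_mul_inv _ d]
    linarith
  · filter_upwards [hb (1 / 2) (by norm_num), closedBall_mem_nhds_of_mem hbR] with w hw hwK
    linarith [hw hwK]
  · filter_upwards [hb' (1 / 2) (by norm_num), closedBall_mem_nhds_of_mem hbR'] with w hw hwK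
    have := hw hwK
    rw [inner_neg_left, inner_neg_left]
    linarith

end Jets

section Comparison

open Filter
open scoped Topology

variable {N : ℕ}

theorem notLocallyConst_of_eventually_le_quadTest {u : Euc N → ℝ} {b p : Euc N}
    {A : Euc N →L[ℝ] Euc N} (hp : p ≠ 0)
    (h : (∀ᶠ w in 𝓝 b, u w ≤ u b + quadTest p A b w) ∨
      ∀ᶠ w in 𝓝 b, u b + quadTest p A b w ≤ u w) : NotLocallyConst u b := by
  intro δ hδ
  by_contra! hcon
  have hconst : ∀ᶠ w in 𝓝 b, u w = u b := by
    filter_upwards [ball_mem_nhds b hδ] with w hw using hcon w hw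
  have h0 : quadTest p A b b = 0 := by simp [quadTest]
  have hext : IsLocalExtr (quadTest p A b) b := by
    rcases h with h | h
    · left
      filter_upwards [h, hconst] with w hw hw'
      linarith
    · right
      filter_upwards [h, hconst] with w hw hw'
      linarith
  refine hp ?_
  rw [← gradient_quadTest p A b, gradient, hext.fderiv_eq_zero, map_zero]

theorem ViscSubSing.le_of_eventually_le {Ω : Set (Euc N)}
    {G : Euc N → Euc N → Matrix (Fin N) (Fin N) ℝ → ℝ} {f u : Euc N → ℝ}
    (hsub : ViscSubSing Ω G f u) {b p : Euc N} {A : Euc N →L[ℝ] Euc N} (hb : b ∈ Ω) (hp : p ≠ 0)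
    (h : ∀ᶠ w in 𝓝 b, u w ≤ u b + quadTest p A b w) : f b ≤ G b p (symMat A) := by
  have key := hsub b hb (notLocallyConst_of_eventually_le_quadTest hp (Or.inl h))
    (quadTest p A b) (contDiff_quadTest p A b) (by rwa [gradient_quadTest]) (by
      filter_upwards [h.filter_mono nhdsWithin_le_nhds] with w hw
      have h0 : quadTest p A b b = 0 := by simp [quadTest]
      linarith)
  rwa [gradient_quadTest, hess_quadTest] at key

theorem ViscSuperSing.le_of_eventually_le {Ω : Set (Euc N)}
    {G : Euc N → Euc N → Matrix (Fin N) (Fin N) ℝ → ℝ} {f u : Euc N → ℝ}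
    (hsuper : ViscSuperSing Ω G f u) {b p : Euc N} {A : Euc N →L[ℝ] Euc N} (hb : b ∈ Ω)
    (hp : p ≠ 0) (h : ∀ᶠ w in 𝓝 b, u b + quadTest p A b w ≤ u w) : G b p (symMat A) ≤ f b := by
  have key := hsuper b hb (notLocallyConst_of_eventually_le_quadTest hp (Or.inr h))
    (quadTest p A b) (contDiff_quadTest p A b) (by rwa [gradient_quadTest]) (by
      filter_upwards [h.filter_mono nhdsWithin_le_nhds] with w hw
      have h0 : quadTest p A b b = 0 := by simp [quadTest]
      linarith)
  rwa [gradient_quadTest, hess_quadTest] at key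

theorem abs_lower_order_le {α β₁ β₂ C CH Cf Ch s H₀ H f₀ g : ℝ} (hα : 0 ≤ α)
    (hβ₁ : β₁ ≤ 1 + α) (hβ₂ : β₂ ≤ 1 + α) (hC : 0 ≤ C) (hs : 1 ≤ s) (hH₀ : |H₀| ≤ CH)
    (hH : |H - H₀| ≤ C * (s ^ β₁ + s ^ β₂)) (hf : |f₀| ≤ Cf) (hg : |g| ≤ Ch * s) :
    |f₀ - s ^ α * g - H| ≤ s ^ α * (Cf + CH + (2 * C + Ch) * s) := by
  have hsα : 1 ≤ s ^ α := Real.one_le_rpow hs hα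
  have h1 : s ^ (1 + α) = s * s ^ α := by
    rw [Real.rpow_add (by linarith), Real.rpow_one]
  have h2 : s ^ β₁ ≤ s * s ^ α := h1 ▸ Real.rpow_le_rpow_of_exponent_le hs hβ₁
  have h3 : s ^ β₂ ≤ s * s ^ α := h1 ▸ Real.rpow_le_rpow_of_exponent_le hs hβ₂
  have h4 : |H| ≤ CH + C * (2 * (s * s ^ α)) :=
    calc |H| = |H₀ + (H - H₀)| := by ring_nf
      _ ≤ |H₀| + |H - H₀| := abs_add_le _ _
      _ ≤ CH + C * (2 * (s * s ^ α)) :=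
        add_le_add hH₀ (hH.trans (mul_le_mul_of_nonneg_left (by linarith) hC))
  have h5 : |s ^ α * g| ≤ s ^ α * (Ch * s) := by
    rw [abs_mul, abs_of_nonneg (by linarith : 0 ≤ s ^ α)]
    gcongr
  have h6 : Cf + CH ≤ s ^ α * (Cf + CH) := le_mul_of_one_le_left
    (add_nonneg ((abs_nonneg _).trans hf) ((abs_nonneg _).trans hH₀)) hsα
  calc |f₀ - s ^ α * g - H| ≤ |f₀| + |s ^ α * g| + |H| :=
        (abs_sub _ _).trans (add_le_add_left (abs_sub _ _) _)
    _ ≤ s ^ α * (Cf + CH + (2 * C + Ch) * s) := by linarith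

/-- Bounds on the second order term `a` of the equation when the gradient has size `s ≥ 1`. -/
theorem second_order_bounds {α β₁ β₂ C CH Cf Ch s H₀ H f₀ g : ℝ} (hα : 0 ≤ α)
    (hβ₁ : β₁ ≤ 1 + α) (hβ₂ : β₂ ≤ 1 + α) (hC : 0 ≤ C) (hs : 1 ≤ s) (hH₀ : |H₀| ≤ CH)
    (hH : |H - H₀| ≤ C * (s ^ β₁ + s ^ β₂)) (hf : |f₀| ≤ Cf) (hg : |g| ≤ Ch * s) (a : ℝ) :
    (f₀ ≤ s ^ α * (a + g) + H → -(Cf + CH + (2 * C + Ch) * s) ≤ a) ∧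
      (s ^ α * (a + g) + H ≤ f₀ → a ≤ Cf + CH + (2 * C + Ch) * s) := by
  have hsα : 0 < s ^ α := Real.rpow_pos_of_pos (by linarith) α
  have h1 := abs_le.1 (abs_lower_order_le hα hβ₁ hβ₂ hC hs hH₀ hH hf hg)
  constructor
  · intro h
    refine le_of_mul_le_mul_left ?_ hsα
    linarith
  · intro h
    refine le_of_mul_le_mul_left ?_ hsα
    linarith

/-- The one-sided estimate obtained by comparing the two test quadratics through ellipticity. -/
theorem sub_le_of_viscSolSing {lam Lam α γ r R ρ C β₁ β₂ Cu Cf CH Ch L M d₀ : ℝ}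
    {F : Matrix (Fin N) (Fin N) ℝ → ℝ} {h : Euc N → Euc N} {H : Euc N → Euc N → ℝ}
    {f u : Euc N → ℝ} {x₀ x y : Euc N} (hlam : 0 < lam) (hα : 0 ≤ α) (hγ : γ ∈ Ioo (0 : ℝ) 1)
    (hβ₁ : β₁ ≤ 1 + α) (hβ₂ : β₂ ≤ 1 + α) (hC : 0 ≤ C) (hCh : 0 ≤ Ch)
    (hF : UnifElliptic lam Lam F)
    (hh : ∀ x ∈ ball (0 : Euc N) 1, ‖h x‖ ≤ Ch)
    (hH₀ : ∀ x ∈ ball (0 : Euc N) 1, |H x 0| ≤ CH)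
    (hH : ∀ x q : Euc N, |H x q - H x 0| ≤ C * (‖q‖ ^ β₁ + ‖q‖ ^ β₂))
    (hf : ∀ x ∈ ball (0 : Euc N) 1, |f x| ≤ Cf)
    (hu : ContinuousOn u (ball 0 1)) (hub : ∀ x ∈ ball (0 : Euc N) 1, |u x| ≤ Cu)
    (hsol : ViscSolSing (ball 0 1)
      (fun x p M => ‖p‖ ^ α * (F M + ⟪h x, p⟫) + H x p) f u)
    (hx₀ : ‖x₀‖ ≤ r) (hρ : 0 < ρ) (hrR : r + 3 * ρ ≤ R) (hR : R < 1) (hL : 0 < L) (hM : 0 ≤ M)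
    (hd₀ : 0 < d₀) (hd₀ρ : d₀ ≤ ρ) (hLd : 2 * Cu ≤ L * d₀ ^ γ) (hMρ : 2 * Cu ≤ M * ρ ^ 2)
    (hd₀' : 2 * (2 * C + Ch) + 1 ≤ 4 * lam * (1 - γ) / d₀)
    (hLγ : Lam * ((2 * M + 1) * N) + 2 * (Cf + CH) + (2 * C + Ch) * (4 * M + 2) < L * γ)
    (hLγ' : 2 * M + 2 ≤ L * γ)
    (hx : x ∈ closedBall (0 : Euc N) R) (hy : y ∈ closedBall (0 : Euc N) R) :
    u x - u y ≤ L * ‖x - y‖ ^ γ + M * ‖x - x₀‖ ^ 2 := by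
  by_contra! hcon
  have hsubset : closedBall (0 : Euc N) R ⊆ ball 0 1 := closedBall_subset_ball hR
  obtain ⟨b, b', p, q, e, A, B, d, hb, hb', hd, hdd₀, he, hp, hq, hAB, hABe, htu, htu'⟩ :=
    exists_jets (hu.mono hsubset) hR.le (fun z hz => hub z (hsubset hz)) hx₀ hρ hrR hL hM hγ
      hd₀ hd₀ρ hLd hMρ hx hy hcon
  replace hb := hsubset (ball_subset_closedBall hb)
  replace hb' := hsubset (ball_subset_closedBall hb')
  obtain ⟨hγ0, hγ1⟩ := hγ
  have hr : 0 ≤ r := (norm_nonneg _).trans hx₀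
  set ℓ := L * γ * d ^ (γ - 1)
  have hℓL : L * γ ≤ ℓ := le_mul_of_one_le_right (by positivity)
    (Real.one_le_rpow_of_pos_of_le_one_of_nonpos hd (by linarith) (by linarith))
  clear_value ℓ
  have hℓ0 : 0 < ℓ := by linarith
  have hnorm : ‖ℓ • e‖ = ℓ := by rw [norm_smul, he, mul_one, Real.norm_of_nonneg hℓ0.le]
  have hbound : ∀ z : Euc N, ‖z - ℓ • e‖ ≤ 2 * M + 1 → 1 ≤ ‖z‖ ∧ ‖z‖ ≤ ℓ + (2 * M + 1) :=
    fun z hz => by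
      have h1 := norm_le_norm_add_norm_sub' z (ℓ • e)
      have h2 := norm_le_norm_add_norm_sub z (ℓ • e)
      rw [hnorm] at h1 h2
      constructor <;> linarith
  obtain ⟨hp1, hp2⟩ := hbound p hp
  obtain ⟨hq1, hq2⟩ := hbound q hq
  have hne : ∀ z : Euc N, 1 ≤ ‖z‖ → z ≠ 0 := fun z hz => norm_pos_iff.1 (by linarith)
  have hlow := fun (z : Euc N) (hz : z ∈ ball (0 : Euc N) 1) (w : Euc N) (hw : 1 ≤ ‖w‖) =>
    second_order_bounds hα hβ₁ hβ₂ hC hw (hH₀ z hz) (hH z w) (hf z hz)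
      ((abs_real_inner_le_norm (h z) w).trans
        (mul_le_mul_of_nonneg_right (hh z hz) (norm_nonneg w)))
  have h1 := (hlow b hb p hp1 (F (symMat A))).1 (hsol.1.le_of_eventually_le hb (hne p hp1) htu)
  have h2 := (hlow b' hb' q hq1 (F (symMat (-B)))).2
    (hsol.2.le_of_eventually_le hb' (hne q hq1) htu')
  have h3 := hF.sub_le hlam.le (by positivity) hAB he hABe
  have h4 : (2 * C + Ch) * ‖p‖ ≤ (2 * C + Ch) * (ℓ + (2 * M + 1)) := by gcongr
  have h5 : (2 * C + Ch) * ‖q‖ ≤ (2 * C + Ch) * (ℓ + (2 * M + 1)) := by gcongr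
  have h6 : 4 * lam * (1 - γ) / d₀ ≤ 4 * lam * (1 - γ) / d :=
    div_le_div_of_nonneg_left (mul_nonneg (by linarith) (by linarith)) hd hdd₀.le
  have h7 : (2 * (2 * C + Ch) + 1) * ℓ ≤ lam * (4 * (1 - γ) * ℓ / d) :=
    calc (2 * (2 * C + Ch) + 1) * ℓ ≤ 4 * lam * (1 - γ) / d * ℓ := by gcongr; linarith
      _ = lam * (4 * (1 - γ) * ℓ / d) := by ring
  linarith

end Comparison

/-- interior Hölder regularity for
`|∇u|^α (F(D²u) + h·∇u) + H(x,∇u) = f`, `α ≥ 0`. -/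
theorem holder_regularity_degenerate
    (N : ℕ) (lam Lam α γ r C β₁ β₂ Cu Cf CH Ch : ℝ) (Kh : NNReal)
    (hlam : 0 < lam) (hlL : lam ≤ Lam) (hα : 0 ≤ α)
    (hγ : γ ∈ Ioo (0 : ℝ) 1) (hr : r ∈ Ioo (0 : ℝ) 1)
    (hβ₁ : β₁ ∈ Ioc (0 : ℝ) (1 + α)) (hβ₂ : β₂ ∈ Ioc (0 : ℝ) (1 + α)) (hC : 0 < C) :
    ∃ K > (0 : ℝ),
      ∀ (F : Matrix (Fin N) (Fin N) ℝ → ℝ) (h : Euc N → Euc N)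
        (H : Euc N → Euc N → ℝ) (f u : Euc N → ℝ),
        UnifElliptic lam Lam F →
        LipschitzWith Kh h →
        (∀ x ∈ ball (0 : Euc N) 1, ‖h x‖ ≤ Ch) →
        (∀ x ∈ ball (0 : Euc N) 1, |H x 0| ≤ CH) →
        (∀ x q : Euc N, |H x q - H x 0| ≤ C * (‖q‖ ^ β₁ + ‖q‖ ^ β₂)) →
        ContinuousOn f (ball 0 1) →
        (∀ x ∈ ball (0 : Euc N) 1, |f x| ≤ Cf) →
        ContinuousOn u (ball 0 1) →
        (∀ x ∈ ball (0 : Euc N) 1, |u x| ≤ Cu) →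
        ViscSolSing (ball 0 1)
          (fun x p M => ‖p‖ ^ α * (F M + ⟪h x, p⟫) + H x p) f u →
        ∀ x ∈ ball (0 : Euc N) r, ∀ y ∈ ball (0 : Euc N) r,
          |u x - u y| ≤ K * ‖x - y‖ ^ γ := by
  obtain ⟨hγ0, hγ1⟩ := hγ
  obtain ⟨hr0, hr1⟩ := hr
  set ρ := (1 - r) / 8 with hρdef
  have hρ : 0 < ρ := by rw [hρdef]; linarith
  have hLam : 0 < Lam := hlam.trans_le hlL
  set M := 2 * |Cu| / ρ ^ 2 with hMdef
  have hM : 0 ≤ M := by positivity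
  set T := 2 * (2 * C + |Ch|) + 1
  have hT : 0 < T := by positivity
  set d₀ := min ρ (4 * lam * (1 - γ) / T)
  have hd₀ : 0 < d₀ :=
    lt_min hρ (div_pos (mul_pos (by positivity) (sub_pos.2 hγ1)) hT)
  set B := Lam * ((2 * M + 1) * N) + 2 * (|Cf| + |CH|) + (2 * C + |Ch|) * (4 * M + 2) with hB
  have hB0 : 0 ≤ B := by positivity
  set L := 2 * |Cu| / d₀ ^ γ + (B + (2 * M + 3)) / γ with hLdef
  have hLγ : B + (2 * M + 3) ≤ L * γ := by
    rw [hLdef, add_mul, div_mul_cancel₀ _ hγ0.ne']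
    exact le_add_of_nonneg_left (by positivity)
  have hLd : 2 * |Cu| ≤ L * d₀ ^ γ := by
    rw [hLdef, add_mul, div_mul_cancel₀ _ (by positivity)]
    exact le_add_of_nonneg_right (by positivity)
  have hL : 0 < L := by positivity
  refine ⟨L, hL, fun F h H f u hF _ hh hH₀ hH _ hf hu hub hsol => ?_⟩
  have key : ∀ x ∈ ball (0 : Euc N) r, ∀ y ∈ ball (0 : Euc N) r,
      u x - u y ≤ L * ‖x - y‖ ^ γ := fun x hx y hy => by
    have hball : ball (0 : Euc N) r ⊆ closedBall 0 ((1 + r) / 2) :=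
      ball_subset_closedBall.trans (closedBall_subset_closedBall (by linarith))
    have := sub_le_of_viscSolSing (x₀ := x) (R := (1 + r) / 2) (ρ := ρ) (L := L) (M := M)
      (d₀ := d₀) (Cu := |Cu|) (Cf := |Cf|) (CH := |CH|) (Ch := |Ch|) hlam hα ⟨hγ0, hγ1⟩
      hβ₁.2 hβ₂.2 hC.le (abs_nonneg _) hF (fun z hz => (hh z hz).trans (le_abs_self _))
      (fun z hz => (hH₀ z hz).trans (le_abs_self _)) hH
      (fun z hz => (hf z hz).trans (le_abs_self _)) hu
      (fun z hz => (hub z hz).trans (le_abs_self _)) hsol (mem_ball_zero_iff.1 hx).le hρ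
      (by rw [hρdef]; linarith) (by linarith) hL hM hd₀ (min_le_left _ _) hLd
      (by rw [hMdef, div_mul_cancel₀ _ (by positivity)])
      ((le_div_comm₀ hT hd₀).2 (min_le_right _ _)) (by rw [← hB]; linarith) (by linarith)
      (hball hx) (hball hy)
    simpa using this
  intro x hx y hy
  refine abs_sub_le_iff.2 ⟨key x hx y hy, ?_⟩
  rw [norm_sub_rev]
  exact key y hy x hx
end
end

section
/- Let α ≥ 0, let F : S^N → ℝ be uniformly elliptic with constants 0 < λ ≤ Λ, let h be Lipschitz continuous on B₁, f continuous and bounded on B₁, and let e ∈ ℝ^N with |e| = 1. Let H : B₁ × ℝ^N → ℝ be such that H(·,0) is bounded and there exist β₁, β₂ ∈ (0,1] and C > 0 with |H(x,q) − H(x,0)| ≤ C(|q|^{β₁} + |q|^{β₂}) for all x, q. Then there exist a₀ > 0 and C₀ > 0 (small, depending on N, λ, Λ, α, h, ‖f‖_∞, ‖H(·,0)‖_∞) such that for all a < a₀ and C ≤ C₀, every bounded viscosity solution u of |e + a∇u|^α(F(D²u) + h(x)·∇u) + H(x,∇u) = f(x) in B₁ is Lipschitz continuous on B_r for each r < 1.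 -/
open Metric Set Real
open scoped RealInnerProductSpace

noncomputable section

open MeasureTheory


/-- Regularisation of the family `x ↦ u y - A ‖x - y‖²`, `y ∈ K`: there is a smallest function of
class `C^{1,1}` whose graph is an envelope of paraboloids of opening `B` lying above the family. -/
theorem exists_paraboloid_envelope {E : Type*} [NormedAddCommGroup E] [InnerProductSpace ℝ E]
    [FiniteDimensional ℝ E] {u : E → ℝ} {K : Set E} (hK : IsCompact K) (hne : K.Nonempty)
    (hu : ContinuousOn u K) {A B : ℝ} (hA : 0 < A) (hB : 0 < B) :
    ∃ (U : E → ℝ) (g : E → E), (∃ c, LipschitzWith c g) ∧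
      (∃ c, ∀ x y, |U y - U x - ⟪g x, y - x⟫| ≤ c * ‖y - x‖ ^ 2) ∧
      (∀ x, ∀ y ∈ K, u y - A * ‖x - y‖ ^ 2 ≤ U x) ∧
      ∀ (x₀ k : E) (c : ℝ),
        (∀ x, ∀ y ∈ K, u y - A * ‖x - y‖ ^ 2 ≤ c + ⟪k, x - x₀⟫ + B * ‖x - x₀‖ ^ 2) →
        U x₀ ≤ c := by
  obtain ⟨y₀, hy₀⟩ := hne
  set D := A + B with hD
  have hDpos : 0 < D := by positivity
  -- the conjugate function is `‖k‖² / (4 D)` plus a supremum of affine functions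
  let aff : E → E → ℝ := fun k y =>
    (4 * A * ⟪k, y⟫ + 4 * A ^ 2 * ‖y‖ ^ 2) / (4 * D) - A * ‖y‖ ^ 2 + u y
  have haff : ∀ k, ContinuousOn (aff k) K := by
    intro k
    have : ContinuousOn (fun y : E => (4 * A * ⟪k, y⟫ + 4 * A ^ 2 * ‖y‖ ^ 2) / (4 * D)
      - A * ‖y‖ ^ 2) K := by fun_prop
    exact this.add hu
  let s : E → ℝ := fun k => sSup (aff k '' K)
  have hbdd : ∀ k, BddAbove (aff k '' K) := fun k => (hK.image_of_continuousOn (haff k)).bddAbove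
  have hle : ∀ k, ∀ y ∈ K, aff k y ≤ s k := fun k y hy => le_csSup (hbdd k) ⟨y, hy, rfl⟩
  have hsle : ∀ k c, (∀ y ∈ K, aff k y ≤ c) → s k ≤ c := by
    intro k c h
    refine csSup_le ⟨_, y₀, hy₀, rfl⟩ ?_
    rintro _ ⟨y, hy, rfl⟩
    exact h y hy
  obtain ⟨R, hR⟩ : ∃ R, ∀ y ∈ K, ‖y‖ ≤ R := hK.isBounded.exists_norm_le
  have hR0 : 0 ≤ R := (norm_nonneg _).trans (hR y₀ hy₀)
  have hslip : ∀ k k', s k ≤ s k' + (A * R / D) * ‖k - k'‖ := by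
    intro k k'
    refine hsle _ _ fun y hy => ?_
    have h1 := hle k' y hy
    have h2 : aff k y = aff k' y + A / D * ⟪k - k', y⟫ := by
      simp only [aff, inner_sub_left]; field_simp; ring
    have h3 : ⟪k - k', y⟫ ≤ ‖k - k'‖ * R :=
      (real_inner_le_norm _ _).trans (by gcongr; exact hR y hy)
    have h4 : A / D * ⟪k - k', y⟫ ≤ A / D * (‖k - k'‖ * R) := by gcongr
    have h5 : A / D * (‖k - k'‖ * R) = (A * R / D) * ‖k - k'‖ := by ring
    linarith
  have hscont : Continuous s := by
    have : LipschitzWith (Real.toNNReal (A * R / D)) s := by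
      refine LipschitzWith.of_dist_le_mul fun k k' => ?_
      rw [Real.coe_toNNReal _ (by positivity), Real.dist_eq, dist_eq_norm, abs_le]
      have h1 := hslip k k'
      have h2 := hslip k' k
      rw [norm_sub_rev] at h2
      constructor <;> linarith
    exact this.continuous
  have hsmid : ∀ k k', s ((1 / 2 : ℝ) • (k + k')) ≤ (s k + s k') / 2 := by
    intro k k'
    refine hsle _ _ fun y hy => ?_
    have h1 := hle k y hy
    have h2 := hle k' y hy
    have h3 : aff ((1 / 2 : ℝ) • (k + k')) y = (aff k y + aff k' y) / 2 := by
      simp only [aff, inner_smul_left, inner_add_left]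
      simp
      ring
    linarith
  -- the strongly concave functional whose supremum over `k` is the biconjugate
  let Θ : E → E → ℝ := fun x k => ⟪k, x⟫ - ‖k‖ ^ 2 / (4 * D) - s k
  have hΘcont : ∀ x, Continuous (Θ x) := by
    intro x
    have : Continuous fun k : E => ⟪k, x⟫ - ‖k‖ ^ 2 / (4 * D) := by fun_prop
    exact this.sub hscont
  have hex : ∀ x, ∃ k, ∀ k', Θ x k' ≤ Θ x k := by
    intro x
    apply (hΘcont x).exists_forall_ge
    obtain ⟨b, hb⟩ : ∃ b, ∀ k, Θ x k ≤ (‖x‖ + A * R / D) * ‖k‖ + b - ‖k‖ ^ 2 / (4 * D) := by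
      refine ⟨- s 0, fun k => ?_⟩
      have h1 := hslip 0 k
      have h2 := real_inner_le_norm k x
      simp only [zero_sub, norm_neg] at h1
      simp only [Θ]
      nlinarith
    rw [Filter.tendsto_atBot]
    intro c
    have hq : Filter.Tendsto (fun t : ℝ => (‖x‖ + A * R / D) * t + b - t ^ 2 / (4 * D))
        Filter.atTop Filter.atBot := by
      have : (fun t : ℝ => (‖x‖ + A * R / D) * t + b - t ^ 2 / (4 * D)) =
          fun t : ℝ => t * ((‖x‖ + A * R / D) + (- (4 * D)⁻¹) * t) + b := by
        funext t; field_simp; ring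
      rw [this]
      apply Filter.tendsto_atBot_add_const_right
      apply Filter.Tendsto.atTop_mul_atBot₀ Filter.tendsto_id
      apply Filter.tendsto_atBot_add_const_left
      exact (Filter.tendsto_const_mul_atBot_of_neg (by simpa using hDpos)).2 Filter.tendsto_id
    have := (hq.comp (tendsto_norm_cocompact_atTop (E := E))).eventually (Filter.eventually_le_atBot c)
    filter_upwards [this] with k hk
    exact (hb k).trans hk
  choose κ hκ using hex
  have hstrong : ∀ x k, Θ x k ≤ Θ x (κ x) - ‖k - κ x‖ ^ 2 / (8 * D) := by
    intro x k
    have h1 := hκ x ((1 / 2 : ℝ) • (k + κ x))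
    have h2 := hsmid k (κ x)
    have h3 : ‖(1 / 2 : ℝ) • (k + κ x)‖ ^ 2 = (‖k‖ ^ 2 + ‖κ x‖ ^ 2) / 2 - ‖k - κ x‖ ^ 2 / 4 := by
      rw [norm_smul, mul_pow, norm_add_sq_real, norm_sub_sq_real]
      norm_num
      ring
    have h4 : ⟪(1 / 2 : ℝ) • (k + κ x), x⟫ = (⟪k, x⟫ + ⟪κ x, x⟫) / 2 := by
      simp only [inner_smul_left, inner_add_left]; simp; ring
    simp only [Θ] at h1 ⊢
    rw [h3, h4] at h1
    have h5 : ((‖k‖ ^ 2 + ‖κ x‖ ^ 2) / 2 - ‖k - κ x‖ ^ 2 / 4) / (4 * D) =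
      (‖k‖ ^ 2 / (4 * D) + ‖κ x‖ ^ 2 / (4 * D)) / 2 - ‖k - κ x‖ ^ 2 / (8 * D) / 2 := by
      field_simp; ring
    linarith
  have hΘsub : ∀ x y k, Θ y k = Θ x k + ⟪k, y - x⟫ := by
    intro x y k
    simp only [Θ, inner_sub_right]; ring
  have hκlip : ∀ x y, ‖κ x - κ y‖ ≤ 4 * D * ‖x - y‖ := by
    intro x y
    have h1 := hstrong x (κ y)
    have h2 := hstrong y (κ x)
    rw [hΘsub x y, hΘsub x y (κ y)] at h2
    rw [norm_sub_rev (κ y)] at h1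
    have h3 : ⟪κ x, y - x⟫ - ⟪κ y, y - x⟫ = - ⟪κ x - κ y, x - y⟫ := by
      rw [← inner_sub_left, ← neg_sub x y, inner_neg_right]
    have h4 := real_inner_le_norm (κ x - κ y) (x - y)
    have h5 : ‖κ x - κ y‖ ^ 2 / (8 * D) * 2 = ‖κ x - κ y‖ ^ 2 / (4 * D) := by
      field_simp; ring
    have h6 : ‖κ x - κ y‖ ^ 2 / (4 * D) ≤ ‖κ x - κ y‖ * ‖x - y‖ := by linarith
    rw [div_le_iff₀ (by positivity)] at h6
    by_contra! hcon
    have : 0 < ‖κ x - κ y‖ := lt_of_le_of_lt (by positivity) hcon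
    nlinarith
  refine ⟨fun x => B * ‖x‖ ^ 2 - Θ x (κ x), fun x => (2 * B) • x - κ x,
    ⟨Real.toNNReal (2 * B + 4 * D), ?_⟩, ⟨B + 4 * D, ?_⟩, ?_, ?_⟩
  · refine LipschitzWith.of_dist_le_mul fun x y => ?_
    rw [Real.coe_toNNReal _ (by positivity), dist_eq_norm, dist_eq_norm]
    have : (2 * B) • x - κ x - ((2 * B) • y - κ y) = (2 * B) • (x - y) - (κ x - κ y) := by
      module
    rw [this]
    refine (norm_sub_le _ _).trans ?_
    rw [norm_smul, Real.norm_of_nonneg (by positivity)]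
    linarith [hκlip x y]
  · intro x y
    have h1 := hκ y (κ x)
    have h2 := hκ x (κ y)
    rw [hΘsub x y] at h1
    have h3 := hΘsub x y (κ y)
    have h4 : ⟪κ y, y - x⟫ - ⟪κ x, y - x⟫ ≤ 4 * D * ‖y - x‖ ^ 2 := by
      rw [← inner_sub_left]
      calc _ ≤ ‖κ y - κ x‖ * ‖y - x‖ := real_inner_le_norm _ _
        _ ≤ (4 * D * ‖y - x‖) * ‖y - x‖ := by gcongr; exact hκlip y x
        _ = _ := by ring
    have h5 : B * ‖y‖ ^ 2 - B * ‖x‖ ^ 2 - ⟪(2 * B) • x, y - x⟫ = B * ‖y - x‖ ^ 2 := by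
      rw [norm_sub_sq_real, inner_smul_left, inner_sub_right, real_inner_self_eq_norm_sq,
        real_inner_comm x y]
      simp
      ring
    rw [inner_sub_left, abs_le]
    have h6 : 0 ≤ B * ‖y - x‖ ^ 2 := by positivity
    have h7 : 0 ≤ D * ‖y - x‖ ^ 2 := by positivity
    constructor <;> linarith
  · intro x y hy
    have h1 := hle (κ x) y hy
    have h2 : 0 ≤ ‖κ x + (2 * A) • y - (2 * D) • x‖ ^ 2 / (4 * D) := by positivity
    have h3 : ‖κ x + (2 * A) • y - (2 * D) • x‖ ^ 2 / (4 * D) = ‖κ x‖ ^ 2 / (4 * D)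
        + (4 * A * ⟪κ x, y⟫ + 4 * A ^ 2 * ‖y‖ ^ 2) / (4 * D) - ⟪κ x, x⟫
        - 2 * A * ⟪x, y⟫ + D * ‖x‖ ^ 2 := by
      rw [norm_sub_sq_real, norm_add_sq_real, norm_smul, norm_smul, inner_add_left,
        inner_smul_left, inner_smul_right, inner_smul_right, inner_smul_right,
        Real.norm_of_nonneg (by positivity), Real.norm_of_nonneg (by positivity),
        real_inner_comm x y]
      simp
      field_simp
      ring
    have h4 := norm_sub_sq_real x y
    simp only [Θ, aff] at h1 ⊢
    rw [h4]
    rw [h3] at h2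
    rw [hD] at h2
    rw [hD] at h1
    rw [hD]
    linarith
  · intro x₀ k' c h
    set k := (2 * B) • x₀ - k' with hk
    have h1 : s k + ‖k‖ ^ 2 / (4 * D) ≤ c - B * ‖x₀‖ ^ 2 + ⟪k, x₀⟫ := by
      rw [← le_sub_iff_add_le]
      refine hsle _ _ fun y hy => ?_
      set x := (2 * D)⁻¹ • (k + (2 * A) • y) with hx
      have h2 := h x y hy
      have hk' : k' = (2 * B) • x₀ - k := by rw [hk]; abel
      have h3 : c + ⟪k', x - x₀⟫ + B * ‖x - x₀‖ ^ 2 =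
          c + B * ‖x‖ ^ 2 - B * ‖x₀‖ ^ 2 - ⟪k, x⟫ + ⟪k, x₀⟫ := by
        rw [hk', norm_sub_sq_real, inner_sub_left, inner_sub_right, inner_sub_right,
          inner_smul_left, inner_smul_left, real_inner_self_eq_norm_sq, real_inner_comm x₀ x]
        simp
        ring
      rw [h3, norm_sub_sq_real] at h2
      have hky : k + (2 * A) • y = (2 * D) • x := by
        rw [hx, smul_smul, mul_inv_cancel₀ (by positivity), one_smul]
      have h4 : ⟪k, x⟫ + 2 * A * ⟪x, y⟫ = 2 * D * ‖x‖ ^ 2 := by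
        have := congrArg (fun w => ⟪w, x⟫) hky
        simp only [inner_add_left, inner_smul_left, real_inner_self_eq_norm_sq] at this
        rw [real_inner_comm x y] at this
        simpa using this
      have h5 : ‖k‖ ^ 2 / (4 * D) + (4 * A * ⟪k, y⟫ + 4 * A ^ 2 * ‖y‖ ^ 2) / (4 * D)
          = D * ‖x‖ ^ 2 := by
        have := congrArg (fun w => ‖w‖ ^ 2) hky
        simp only [norm_add_sq_real, norm_smul, inner_smul_right] at this
        rw [Real.norm_of_nonneg (by positivity), Real.norm_of_nonneg (by positivity)] at this
        rw [← add_div, div_eq_iff (by positivity)]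
        linarith
      simp only [aff]
      have h6 : D * ‖x‖ ^ 2 = A * ‖x‖ ^ 2 + B * ‖x‖ ^ 2 := by rw [hD]; ring
      linarith
    have h2 := hκ x₀ k
    simp only [Θ] at h2 ⊢
    linarith

/-- A two-sided quadratic error bound gives differentiability. -/
theorem hasFDerivAt_of_quadratic_bound {E : Type*} [NormedAddCommGroup E] [InnerProductSpace ℝ E]
    {U : E → ℝ} {g : E → E} {c : ℝ}
    (hU : ∀ x y, |U y - U x - ⟪g x, y - x⟫| ≤ c * ‖y - x‖ ^ 2) (x : E) :
    HasFDerivAt U (innerSL ℝ (g x)) x := by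
  rw [hasFDerivAt_iff_isLittleO]
  have h1 : (fun y => U y - U x - innerSL ℝ (g x) (y - x)) =O[nhds x]
      fun y => ‖y - x‖ ^ 2 := by
    refine Asymptotics.IsBigO.of_bound c (Filter.Eventually.of_forall fun y => ?_)
    simpa using hU x y
  refine h1.trans_isLittleO ?_
  have := Asymptotics.isLittleO_norm_pow_id (E' := E) (n := 2) (by norm_num)
  have h2 : Filter.Tendsto (fun y => y - x) (nhds x) (nhds 0) := by
    have : Continuous fun y : E => y - x := by fun_prop
    simpa using this.tendsto x
  exact this.comp_tendsto h2

/-- Second order Taylor expansion at a point of differentiability of the gradient. -/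
theorem eventually_taylor_two {E : Type*} [NormedAddCommGroup E] [InnerProductSpace ℝ E]
    {U : E → ℝ} {g : E → E} {c : ℝ}
    (hU : ∀ x y, |U y - U x - ⟪g x, y - x⟫| ≤ c * ‖y - x‖ ^ 2) {X : E →L[ℝ] E} {a : E}
    (hX : HasFDerivAt g X a) {δ : ℝ} (hδ : 0 < δ) :
    ∀ᶠ h in nhds (0 : E),
      |U (a + h) - U a - ⟪g a, h⟫ - 1 / 2 * ⟪X h, h⟫| ≤ δ * ‖h‖ ^ 2 := by
  have h1 := hasFDerivAt_iff_isLittleO_nhds_zero.1 hX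
  have h2 := h1.def hδ
  obtain ⟨r, hr, hball⟩ := Metric.eventually_nhds_iff_ball.1 h2
  filter_upwards [Metric.ball_mem_nhds 0 hr] with h hh
  set φ : ℝ → ℝ := fun t => U (a + t • h) - t * ⟪g a, h⟫ - t ^ 2 / 2 * ⟪X h, h⟫ with hφ
  have hder : ∀ t ∈ Icc (0 : ℝ) 1, HasDerivWithinAt φ
      (⟪g (a + t • h), h⟫ - 1 * ⟪g a, h⟫ - (2 * t ^ 1 * 1) / 2 * ⟪X h, h⟫) (Icc 0 1) t := by
    intro t _
    refine HasDerivAt.hasDerivWithinAt ?_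
    have e1 : HasDerivAt (fun t : ℝ => a + t • h) ((1 : ℝ) • h) t :=
      ((hasDerivAt_id t).smul_const h).const_add a
    have e2 := (hasFDerivAt_of_quadratic_bound hU (a + t • h)).comp_hasDerivAt t e1
    rw [one_smul] at e2
    have e3 : HasDerivAt (fun t : ℝ => t * ⟪g a, h⟫) (1 * ⟪g a, h⟫) t :=
      (hasDerivAt_id t).mul_const _
    have e4 : HasDerivAt (fun t : ℝ => t ^ 2 / 2 * ⟪X h, h⟫)
        ((2 * t ^ 1 * 1) / 2 * ⟪X h, h⟫) t := by
      have := (((hasDerivAt_id t).pow 2).div_const 2).mul_const ⟪X h, h⟫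
      simpa using this
    exact (e2.sub e3).sub e4
  have hbound : ∀ t ∈ Ico (0 : ℝ) 1,
      ‖⟪g (a + t • h), h⟫ - 1 * ⟪g a, h⟫ - (2 * t ^ 1 * 1) / 2 * ⟪X h, h⟫‖ ≤ δ * ‖h‖ ^ 2 := by
    intro t ht
    have e1 : ‖t • h‖ ≤ ‖h‖ := by
      rw [norm_smul, Real.norm_of_nonneg ht.1]
      exact mul_le_of_le_one_left (norm_nonneg _) ht.2.le
    have e2 := hball (t • h) (by
      rw [mem_ball_zero_iff] at hh ⊢
      exact e1.trans_lt hh)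
    have e3 : ⟪g (a + t • h), h⟫ - 1 * ⟪g a, h⟫ - (2 * t ^ 1 * 1) / 2 * ⟪X h, h⟫ =
        ⟪g (a + t • h) - g a - X (t • h), h⟫ := by
      rw [map_smul, inner_sub_left, inner_sub_left, inner_smul_left]
      simp
    rw [e3]
    calc _ ≤ ‖g (a + t • h) - g a - X (t • h)‖ * ‖h‖ := norm_inner_le_norm _ _
      _ ≤ (δ * ‖h‖) * ‖h‖ := by
        gcongr
        exact e2.trans (by gcongr)
      _ = _ := by ring
  have := norm_image_sub_le_of_norm_deriv_le_segment_01' hder hbound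
  simp only [hφ, Real.norm_eq_abs] at this
  simp only [one_smul, zero_smul, add_zero] at this
  convert this using 2
  ring

/-- The Lipschitz image of a null set omits points arbitrarily close to the origin. -/
theorem LipschitzWith.exists_mem_ball_notMem_image {E : Type*} [NormedAddCommGroup E]
    [NormedSpace ℝ E] [FiniteDimensional ℝ E] [MeasurableSpace E] [BorelSpace E]
    (μ : Measure E) [μ.IsAddHaarMeasure] {G : E → E} {c : NNReal} (hG : LipschitzWith c G)
    {S : Set E} (hS : μ S = 0) {r : ℝ} (hr : 0 < r) : ∃ p ∈ ball (0 : E) r, p ∉ G '' S := by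
  by_contra! hcon
  have h1 : Measure.hausdorffMeasure (Module.finrank ℝ E : ℝ) S = 0 :=
    (Measure.absolutelyContinuous_isAddHaarMeasure _ μ) hS
  have h2 : Measure.hausdorffMeasure (Module.finrank ℝ E : ℝ) (G '' S) = 0 := by
    refine le_antisymm ?_ (zero_le)
    refine (hG.hausdorffMeasure_image_le (by positivity) S).trans ?_
    rw [h1, mul_zero]
  have h3 : Measure.hausdorffMeasure (Module.finrank ℝ E : ℝ) (ball (0 : E) r) = 0 :=
    measure_mono_null hcon h2
  exact (measure_ball_pos _ (0 : E) hr).ne' h3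

theorem eq_zero_of_inner_le_sq {E : Type*} [NormedAddCommGroup E] [InnerProductSpace ℝ E]
    {v : E} {c : ℝ} (h : ∀ x, ⟪v, x⟫ ≤ c * ‖x‖ ^ 2) : v = 0 := by
  by_contra hv
  have hpos : 0 < ‖v‖ ^ 2 := by positivity
  have h1 := h ((1 / (|c| + 1) : ℝ) • v)
  rw [inner_smul_right, real_inner_self_eq_norm_sq, norm_smul, mul_pow,
    Real.norm_of_nonneg (by positivity)] at h1
  have h2 : (1 / (|c| + 1)) * ‖v‖ ^ 2 ≤ (c / (|c| + 1)) * ((1 / (|c| + 1)) * ‖v‖ ^ 2) := by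
    refine h1.trans (le_of_eq ?_)
    ring
  have h3 : c / (|c| + 1) < 1 := by
    rw [div_lt_one (by positivity)]
    linarith [le_abs_self c]
  have h4 : 0 < (1 / (|c| + 1)) * ‖v‖ ^ 2 := by positivity
  nlinarith

/-- A quadratic form at a shifted point is controlled by the form itself and a large multiple of
the squared shift. -/
theorem exists_quadratic_shift_bound {E : Type*} [NormedAddCommGroup E] [InnerProductSpace ℝ E]
    (T : E →L[ℝ] E) (hT : ∀ x y, ⟪T x, y⟫ = ⟪x, T y⟫) {M : ℝ} (hM : 0 ≤ M) {η : ℝ} (hη : 0 < η) :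
    ∃ A > (1 : ℝ), ∀ a b z w : E,
      ⟪T (z - w), z - w⟫ + M * (‖z‖ ^ 2 + ‖w‖ ^ 2) - A * ‖a - z‖ ^ 2 - A * ‖b - w‖ ^ 2 ≤
        ⟪T (a - b), a - b⟫ + (M + η) * (‖a‖ ^ 2 + ‖b‖ ^ 2)
          - (‖a - z‖ ^ 2 + ‖b - w‖ ^ 2) := by
  set t := ‖T‖
  have ht : 0 ≤ t := norm_nonneg _
  refine ⟨8 * t ^ 2 / η + 2 * t + M + 2 * M ^ 2 / η + 2, ?_, ?_⟩
  · have : 0 ≤ 8 * t ^ 2 / η + 2 * t + M + 2 * M ^ 2 / η := by positivity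
    linarith
  intro a b z w
  obtain ⟨α, rfl⟩ : ∃ α, z = a + α := ⟨z - a, by abel⟩
  obtain ⟨β, rfl⟩ : ∃ β, w = b + β := ⟨w - b, by abel⟩
  have e1 : a + α - (b + β) = (a - b) + (α - β) := by abel
  have e2 : a - (a + α) = -α := by abel
  have e3 : b - (b + β) = -β := by abel
  rw [e1, e2, e3, norm_neg, norm_neg, map_add, inner_add_left, inner_add_right, inner_add_right,
    norm_add_sq_real, norm_add_sq_real, hT (α - β) (a - b),
    real_inner_comm (T (a - b)) (α - β)]
  set d := a - b
  set δ := α - β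
  have young : ∀ x y s : ℝ, 2 * s * x * y ≤ η / 4 * x ^ 2 + 4 * s ^ 2 / η * y ^ 2 := by
    intro x y s
    have : 0 ≤ η / 4 * (x - 4 * s / η * y) ^ 2 := by positivity
    have h : η / 4 * (x - 4 * s / η * y) ^ 2 =
      η / 4 * x ^ 2 + 4 * s ^ 2 / η * y ^ 2 - 2 * s * x * y := by
      field_simp; ring
    linarith
  have hδ : ‖δ‖ ^ 2 ≤ 2 * (‖α‖ ^ 2 + ‖β‖ ^ 2) := by
    have := norm_sub_sq_real α β
    have h2 := norm_add_sq_real α β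
    nlinarith [sq_nonneg ‖α + β‖]
  have hd : ‖d‖ ^ 2 ≤ 2 * (‖a‖ ^ 2 + ‖b‖ ^ 2) := by
    have := norm_sub_sq_real a b
    have h2 := norm_add_sq_real a b
    nlinarith [sq_nonneg ‖a + b‖]
  have f1 : 2 * ⟪T d, δ⟫ ≤ η / 2 * (‖a‖ ^ 2 + ‖b‖ ^ 2)
      + 8 * t ^ 2 / η * (‖α‖ ^ 2 + ‖β‖ ^ 2) := by
    have g1 : ⟪T d, δ⟫ ≤ t * ‖d‖ * ‖δ‖ :=
      (real_inner_le_norm _ _).trans (by gcongr; exact T.le_opNorm d)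
    have g2 := young ‖d‖ ‖δ‖ t
    have g3 : η / 4 * ‖d‖ ^ 2 ≤ η / 4 * (2 * (‖a‖ ^ 2 + ‖b‖ ^ 2)) := by gcongr
    have g4 : 4 * t ^ 2 / η * ‖δ‖ ^ 2 ≤ 4 * t ^ 2 / η * (2 * (‖α‖ ^ 2 + ‖β‖ ^ 2)) := by gcongr
    have g5 : 4 * t ^ 2 / η * (2 * (‖α‖ ^ 2 + ‖β‖ ^ 2)) =
      8 * t ^ 2 / η * (‖α‖ ^ 2 + ‖β‖ ^ 2) := by ring
    linarith
  have f2 : ⟪T δ, δ⟫ ≤ 2 * t * (‖α‖ ^ 2 + ‖β‖ ^ 2) := by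
    have g1 : ⟪T δ, δ⟫ ≤ t * ‖δ‖ * ‖δ‖ :=
      (real_inner_le_norm _ _).trans (by gcongr; exact T.le_opNorm δ)
    have g2 : t * ‖δ‖ ^ 2 ≤ t * (2 * (‖α‖ ^ 2 + ‖β‖ ^ 2)) := by gcongr
    linarith
  have f3 : ∀ x y : E, M * (2 * ⟪x, y⟫) ≤ η / 2 * ‖x‖ ^ 2 + 2 * M ^ 2 / η * ‖y‖ ^ 2 := by
    intro x y
    have g1 : M * ⟪x, y⟫ ≤ M * (‖x‖ * ‖y‖) := by gcongr; exact real_inner_le_norm _ _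
    have g2 : 0 ≤ η / 2 * (‖x‖ - 2 * M / η * ‖y‖) ^ 2 := by positivity
    have h : η / 2 * (‖x‖ - 2 * M / η * ‖y‖) ^ 2 =
      η / 2 * ‖x‖ ^ 2 + 2 * M ^ 2 / η * ‖y‖ ^ 2 - 2 * M * ‖x‖ * ‖y‖ := by
      field_simp; ring
    linarith
  have f4 := f3 a α
  have f5 := f3 b β
  have f6 : 0 ≤ ‖α‖ ^ 2 + ‖β‖ ^ 2 := by positivity
  linarith

set_option maxHeartbeats 1000000 in
/-- Theorem on sums for a quadratic penalisation. -/
theorem exists_touching_quadratics {E : Type*} [NormedAddCommGroup E] [InnerProductSpace ℝ E]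
    [FiniteDimensional ℝ E] {u v : E → ℝ} {ρ : ℝ} (hρ : 0 < ρ)
    (hu : ContinuousOn u (closedBall 0 ρ)) (hv : ContinuousOn v (closedBall 0 ρ))
    (T : E →L[ℝ] E) (hT : ∀ x y, ⟪T x, y⟫ = ⟪x, T y⟫) {M : ℝ} (hM : 0 ≤ M)
    (hle : ∀ x ∈ closedBall (0 : E) ρ, ∀ y ∈ closedBall (0 : E) ρ,
      u x - v y ≤ ⟪T (x - y), x - y⟫ + M * (‖x‖ ^ 2 + ‖y‖ ^ 2))
    (h0 : u 0 = v 0) {η : ℝ} (hη : 0 < η) :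
    ∃ (z w p q : E) (X Y : E →L[ℝ] E), ‖z‖ < η ∧ ‖w‖ < η ∧ ‖p‖ < η ∧ ‖q‖ < η ∧
      (∀ᶠ h in nhds (0 : E), u (z + h) ≤ u z + ⟪p, h⟫ + 1 / 2 * ⟪X h, h⟫ + η * ‖h‖ ^ 2) ∧
      (∀ᶠ h in nhds (0 : E), v w + ⟪q, h⟫ + 1 / 2 * ⟪Y h, h⟫ - η * ‖h‖ ^ 2 ≤ v (w + h)) ∧
      ∀ a b, 1 / 2 * ⟪X a, a⟫ - 1 / 2 * ⟪Y b, b⟫ ≤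
        ⟪T (a - b), a - b⟫ + (M + η) * (‖a‖ ^ 2 + ‖b‖ ^ 2) := by
  set K := closedBall (0 : E) ρ with hKdef
  have hK : IsCompact K := isCompact_closedBall _ _
  have h0K : (0 : E) ∈ K := by simp [hKdef, hρ.le]
  set η₁ := η / 2 with hη₁
  have hη₁pos : 0 < η₁ := by positivity
  obtain ⟨A, hA1, hshift⟩ := exists_quadratic_shift_bound T hT hM hη₁pos
  have hA : 0 < A := by linarith
  set t := ‖T‖ with ht
  have ht0 : 0 ≤ t := norm_nonneg _
  have hTle : ∀ h, ⟪T h, h⟫ ≤ t * ‖h‖ ^ 2 := fun h => by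
    calc ⟪T h, h⟫ ≤ ‖T h‖ * ‖h‖ := real_inner_le_norm _ _
      _ ≤ (t * ‖h‖) * ‖h‖ := by gcongr; exact T.le_opNorm h
      _ = _ := by ring
  have hB : 0 < t + (M + η) := by positivity
  obtain ⟨U, gU, ⟨cU, hgU⟩, ⟨CU, hU⟩, hUge, hUle⟩ :=
    exists_paraboloid_envelope hK ⟨0, h0K⟩ hu hA hB
  obtain ⟨V, gV, ⟨cV, hgV⟩, ⟨CV, hV⟩, hVge, hVle⟩ :=
    exists_paraboloid_envelope (u := fun x => - v x) hK ⟨0, h0K⟩ hv.neg hA hB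
  set Q : E → E → ℝ := fun a b => ⟪T (a - b), a - b⟫ + (M + η) * (‖a‖ ^ 2 + ‖b‖ ^ 2) with hQ
  have hQ_left : ∀ a b h, Q (a + h) b =
      Q a b + ⟪(2 : ℝ) • T (a - b) + (2 * (M + η)) • a, h⟫ + Q h 0 := by
    intro a b h
    have e1 : a + h - b = (a - b) + h := by abel
    simp only [hQ]
    rw [e1, map_add, inner_add_left, inner_add_right, inner_add_right, hT h (a - b),
      real_inner_comm (T (a - b)) h, norm_add_sq_real, inner_add_left, inner_smul_left,
      inner_smul_left]
    simp
    ring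
  have hQ_symm : ∀ a b, Q a b = Q b a := by
    intro a b
    have : b - a = - (a - b) := by abel
    simp only [hQ]
    rw [this, map_neg, inner_neg_neg, add_comm (‖a‖ ^ 2)]
  have hQ_right : ∀ a b h, Q a (b + h) =
      Q a b + ⟪(2 : ℝ) • T (b - a) + (2 * (M + η)) • b, h⟫ + Q 0 h := by
    intro a b h
    rw [hQ_symm, hQ_left, hQ_symm b a, hQ_symm h 0]
  have hQh : ∀ h, Q h 0 ≤ (t + (M + η)) * ‖h‖ ^ 2 := by
    intro h
    have := hTle h
    simp only [hQ, sub_zero, norm_zero]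
    linarith
  have hQ_expand : ∀ a b h k, Q (a + h) (b + k) = Q a b
      + ⟪(2 : ℝ) • T (a - b) + (2 * (M + η)) • a, h⟫
      + ⟪(2 : ℝ) • T (b - a) + (2 * (M + η)) • b, k⟫ + Q h k := by
    intro a b h k
    have e1 : a + h - (b + k) = (a - b) + (h - k) := by abel
    have e2 : b - a = - (a - b) := by abel
    simp only [hQ]
    rw [e1, e2, map_add, map_neg, inner_add_left, inner_add_right, inner_add_right,
      hT (h - k) (a - b), real_inner_comm (T (a - b)) (h - k), norm_add_sq_real,
      norm_add_sq_real, inner_add_left, inner_add_left]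
    simp only [inner_smul_left, inner_neg_left, inner_sub_right, smul_neg]
    simp
    ring
  -- the perturbed maximum points
  have hcontact : ∀ σ > 0, ∀ p q : E, ‖p‖ < σ → ‖q‖ < σ → ∃ a b z w m, z ∈ K ∧ w ∈ K ∧
      ‖a‖ + ‖b‖ ≤ 2 * σ / η₁ ∧ ‖a - z‖ ^ 2 + ‖b - w‖ ^ 2 ≤ σ * (2 * σ / η₁) ∧
      (∀ x y, U x + V y ≤ Q x y + ⟪p, x⟫ + ⟪q, y⟫ + m) ∧
      u z - A * ‖a - z‖ ^ 2 - v w - A * ‖b - w‖ ^ 2 = Q a b + ⟪p, a⟫ + ⟪q, b⟫ + m := by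
    intro σ hσ p q hp hq
    set R := 2 * σ / η₁ with hR
    have hR0 : 0 < R := by positivity
    let Ψ : (E × E) × (E × E) → ℝ := fun s =>
      u s.2.1 - A * ‖s.1.1 - s.2.1‖ ^ 2 - v s.2.2 - A * ‖s.1.2 - s.2.2‖ ^ 2
        - (Q s.1.1 s.1.2 + ⟪p, s.1.1⟫ + ⟪q, s.1.2⟫)
    have hΨle : ∀ a b, ∀ z ∈ K, ∀ w ∈ K, Ψ ((a, b), (z, w)) ≤
        - η₁ * (‖a‖ ^ 2 + ‖b‖ ^ 2) + σ * (‖a‖ + ‖b‖) - (‖a - z‖ ^ 2 + ‖b - w‖ ^ 2) := by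
      intro a b z hz w hw
      have e1 := hshift a b z w
      have e2 := hle z hz w hw
      have e3 : -⟪p, a⟫ ≤ σ * ‖a‖ := by
        rw [← inner_neg_left]
        refine (real_inner_le_norm _ _).trans ?_
        rw [norm_neg]; gcongr
      have e4 : -⟪q, b⟫ ≤ σ * ‖b‖ := by
        rw [← inner_neg_left]
        refine (real_inner_le_norm _ _).trans ?_
        rw [norm_neg]; gcongr
      have e5 : η = 2 * η₁ := by rw [hη₁]; ring
      simp only [Ψ, hQ]
      rw [e5]
      linarith
    have hΨ0 : Ψ ((0, 0), (0, 0)) = 0 := by simp [Ψ, hQ, h0]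
    set D := (closedBall (0 : E) R ×ˢ closedBall (0 : E) R) ×ˢ (K ×ˢ K) with hD
    have hDc : IsCompact D :=
      ((isCompact_closedBall _ _).prod (isCompact_closedBall _ _)).prod (hK.prod hK)
    have hΨc : ContinuousOn Ψ D := by
      have c1 : ContinuousOn (fun s : (E × E) × (E × E) => u s.2.1) D :=
        hu.comp (by fun_prop) fun s hs => hs.2.1
      have c2 : ContinuousOn (fun s : (E × E) × (E × E) => v s.2.2) D :=
        hv.comp (by fun_prop) fun s hs => hs.2.2
      have c3 : ContinuousOn (fun s : (E × E) × (E × E) => A * ‖s.1.1 - s.2.1‖ ^ 2) D := by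
        fun_prop
      have c4 : ContinuousOn (fun s : (E × E) × (E × E) => A * ‖s.1.2 - s.2.2‖ ^ 2) D := by
        fun_prop
      have c5 : ContinuousOn
          (fun s : (E × E) × (E × E) => Q s.1.1 s.1.2 + ⟪p, s.1.1⟫ + ⟪q, s.1.2⟫) D := by
        simp only [hQ]
        fun_prop
      exact (((c1.sub c3).sub c2).sub c4).sub c5
    have h0D : (((0, 0), (0, 0)) : (E × E) × (E × E)) ∈ D := by
      simp [hD, h0K, hR0.le]
    obtain ⟨⟨⟨a, b⟩, ⟨z, w⟩⟩, hsD, hmax⟩ := hDc.exists_isMaxOn ⟨_, h0D⟩ hΨc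
    have hmax' : ∀ s ∈ D, Ψ s ≤ Ψ ((a, b), (z, w)) := fun s hs => hmax hs
    have hm0 : 0 ≤ Ψ ((a, b), (z, w)) := hΨ0 ▸ hmax' _ h0D
    obtain ⟨-, hz, hw⟩ := hsD
    have hsq : ∀ a b : E, (‖a‖ + ‖b‖) ^ 2 / 2 ≤ ‖a‖ ^ 2 + ‖b‖ ^ 2 := fun a b => by
      nlinarith [sq_nonneg (‖a‖ - ‖b‖)]
    have hSbound : ∀ a b, ∀ z ∈ K, ∀ w ∈ K, 0 ≤ Ψ ((a, b), (z, w)) → ‖a‖ + ‖b‖ ≤ R := by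
      intro a b z hz w hw h
      have e1 := hΨle a b z hz w hw
      have e2 := hsq a b
      by_contra! hcon
      have e3 : 2 * σ < (‖a‖ + ‖b‖) * η₁ := by
        rwa [hR, div_lt_iff₀ hη₁pos] at hcon
      have e4 : 0 < ‖a‖ + ‖b‖ := hR0.trans hcon
      have e5 : 0 ≤ ‖a - z‖ ^ 2 + ‖b - w‖ ^ 2 := by positivity
      nlinarith
    have hglob : ∀ a' b', ∀ z' ∈ K, ∀ w' ∈ K, Ψ ((a', b'), (z', w')) ≤ Ψ ((a, b), (z, w)) := by
      intro a' b' z' hz' w' hw'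
      by_contra! hcon
      have e1 := hSbound a' b' z' hz' w' hw' (hm0.trans hcon.le)
      have e2 := hmax' ((a', b'), (z', w')) ⟨⟨by
        rw [mem_closedBall_zero_iff]; linarith [norm_nonneg b'], by
        rw [mem_closedBall_zero_iff]; linarith [norm_nonneg a']⟩, hz', hw'⟩
      linarith
    have hS := hSbound a b z hz w hw hm0
    refine ⟨a, b, z, w, Ψ ((a, b), (z, w)), hz, hw, hS, ?_, ?_, by simp only [Ψ]; ring⟩
    · have e1 := hΨle a b z hz w hw
      have e2 : σ * (‖a‖ + ‖b‖) ≤ σ * R := by gcongr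
      have e3 : 0 ≤ η₁ * (‖a‖ ^ 2 + ‖b‖ ^ 2) := by positivity
      linarith
    · set m := Ψ ((a, b), (z, w))
      intro x₀ y₀
      have step : ∀ y, ∀ y' ∈ K,
          U x₀ ≤ Q x₀ y + ⟪p, x₀⟫ + ⟪q, y⟫ + m + v y' + A * ‖y - y'‖ ^ 2 := by
        intro y y' hy'
        refine hUle x₀ ((2 : ℝ) • T (x₀ - y) + (2 * (M + η)) • x₀ + p) _ fun x x' hx' => ?_
        have e1 := hglob x y x' hx' y' hy'
        have e2 := hQ_left x₀ y (x - x₀)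
        have e3 := hQh (x - x₀)
        rw [add_sub_cancel] at e2
        simp only [Ψ] at e1
        rw [inner_add_left, inner_sub_right p]
        linarith
      have : V y₀ ≤ Q x₀ y₀ + ⟪p, x₀⟫ + ⟪q, y₀⟫ + m - U x₀ := by
        refine hVle y₀ ((2 : ℝ) • T (y₀ - x₀) + (2 * (M + η)) • y₀ + q) _ fun y y' hy' => ?_
        have e1 := step y y' hy'
        have e2 := hQ_right x₀ y₀ (y - y₀)
        have e3 := hQh (y - y₀)
        rw [hQ_symm] at e3
        rw [add_sub_cancel] at e2
        rw [inner_add_left, inner_sub_right q]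
        linarith
      linarith
  -- choice of the perturbation, outside the image of the exceptional null set
  let _ : MeasurableSpace E := borel E
  have : BorelSpace E := ⟨rfl⟩
  let G : E × E → E × E := fun s =>
    (gU s.1 - ((2 : ℝ) • T (s.1 - s.2) + (2 * (M + η)) • s.1),
      gV s.2 - ((2 : ℝ) • T (s.2 - s.1) + (2 * (M + η)) • s.2))
  obtain ⟨cG, hG⟩ : ∃ c, LipschitzWith c G := by
    let L₁ : E × E →L[ℝ] E := (2 : ℝ) • T.comp (ContinuousLinearMap.fst ℝ E E -
      ContinuousLinearMap.snd ℝ E E) + (2 * (M + η)) • ContinuousLinearMap.fst ℝ E E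
    let L₂ : E × E →L[ℝ] E := (2 : ℝ) • T.comp (ContinuousLinearMap.snd ℝ E E -
      ContinuousLinearMap.fst ℝ E E) + (2 * (M + η)) • ContinuousLinearMap.snd ℝ E E
    have l₁ := (hgU.comp (LipschitzWith.prod_fst (α := E) (β := E))).sub L₁.lipschitz
    have l₂ := (hgV.comp (LipschitzWith.prod_snd (α := E) (β := E))).sub L₂.lipschitz
    exact ⟨_, l₁.prodMk l₂⟩
  let μ : Measure E := Measure.addHaar
  let S : Set (E × E) := {s | ¬ (DifferentiableAt ℝ gU s.1 ∧ DifferentiableAt ℝ gV s.2)}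
  have hS : (μ.prod μ) S = 0 := by
    have h1 : ∀ᵐ x ∂μ, DifferentiableAt ℝ gU x := hgU.ae_differentiableAt
    have h2 : ∀ᵐ x ∂μ, DifferentiableAt ℝ gV x := hgV.ae_differentiableAt
    exact (Measure.quasiMeasurePreserving_fst.ae h1).and (Measure.quasiMeasurePreserving_snd.ae h2)
  set Z := 2 / η₁ + 2 / η₁ + 1 + (2 * t + 2 * (M + η)) * (2 / η₁) + 1 with hZ
  have hZ1 : 1 ≤ Z := by
    have : 0 ≤ 2 / η₁ + 2 / η₁ + 1 + (2 * t + 2 * (M + η)) * (2 / η₁) := by positivity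
    linarith
  set r₀ := min η ρ with hr₀
  have hr₀pos : 0 < r₀ := lt_min hη hρ
  set σ := r₀ / (2 * Z) with hσ
  have hσpos : 0 < σ := by positivity
  have hσZ : Z * σ < r₀ := by
    have : Z * σ = r₀ / 2 := by rw [hσ]; field_simp
    linarith
  obtain ⟨⟨p, q⟩, hpq, hnot⟩ := hG.exists_mem_ball_notMem_image (μ.prod μ) hS hσpos
  rw [mem_ball_zero_iff, Prod.norm_def, max_lt_iff] at hpq
  obtain ⟨a, b, z, w, m, hz, hw, hab, hazbw, hUV, heq⟩ := hcontact σ hσpos p q hpq.1 hpq.2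
  have hUa := hUge a z hz
  have hVb := hVge b w hw
  have hUVab := hUV a b
  have hUa' : U a = u z - A * ‖a - z‖ ^ 2 := by linarith
  have hVb' : V b = - v w - A * ‖b - w‖ ^ 2 := by linarith
  have hgUa : gU a - ((2 : ℝ) • T (a - b) + (2 * (M + η)) • a) = p := by
    rw [← sub_eq_zero]
    refine eq_zero_of_inner_le_sq (c := CU + (t + (M + η))) fun h => ?_
    have e1 := hUV (a + h) b
    have e2 := (abs_le.1 (hU a (a + h))).1
    rw [hQ_left, inner_add_right] at e1
    rw [add_sub_cancel_left] at e2
    have e3 := hQh h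
    rw [inner_sub_left, inner_sub_left]
    linarith
  have hgVb : gV b - ((2 : ℝ) • T (b - a) + (2 * (M + η)) • b) = q := by
    rw [← sub_eq_zero]
    refine eq_zero_of_inner_le_sq (c := CV + (t + (M + η))) fun h => ?_
    have e1 := hUV a (b + h)
    have e2 := (abs_le.1 (hV b (b + h))).1
    rw [hQ_right, inner_add_right] at e1
    rw [add_sub_cancel_left] at e2
    have e3 := hQh h
    rw [hQ_symm] at e3
    rw [inner_sub_left, inner_sub_left]
    linarith
  have hdiff : DifferentiableAt ℝ gU a ∧ DifferentiableAt ℝ gV b := by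
    by_contra hcon
    exact hnot ⟨(a, b), hcon, Prod.ext hgUa hgVb⟩
  obtain ⟨⟨X, hX⟩, ⟨Y, hY⟩⟩ := hdiff
  -- smallness
  have hR : 2 * σ / η₁ = (2 / η₁) * σ := by ring
  rw [hR] at hab hazbw
  have hsmall : ∀ x : E, ‖x‖ ^ 2 ≤ σ * (2 / η₁ * σ) → ‖x‖ ≤ (2 / η₁ + 1) * σ := by
    intro x hx
    have e1 : σ * (2 / η₁ * σ) ≤ ((2 / η₁ + 1) * σ) ^ 2 := by
      have : 0 < 2 / η₁ := by positivity
      nlinarith [sq_nonneg σ, sq_nonneg (2 / η₁ * σ), mul_pos this (mul_pos hσpos hσpos)]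
    exact abs_le_of_sq_le_sq' (hx.trans e1) (by positivity) |>.2
  have haz := hsmall (a - z) (by linarith [sq_nonneg ‖b - w‖])
  have hbw := hsmall (b - w) (by linarith [sq_nonneg ‖a - z‖])
  have ha : ‖a‖ ≤ 2 / η₁ * σ := by linarith [norm_nonneg b]
  have hb : ‖b‖ ≤ 2 / η₁ * σ := by linarith [norm_nonneg a]
  have hZσ : Z * σ = 2 / η₁ * σ + (2 / η₁ + 1) * σ +
      ((2 * t + 2 * (M + η)) * (2 / η₁ * σ) + σ) := by rw [hZ]; ring
  have hpos1 : 0 < 2 / η₁ * σ := by positivity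
  have hpos2 : 0 ≤ (2 * t + 2 * (M + η)) * (2 / η₁ * σ) := by positivity
  have hpos3 : 0 < (2 / η₁ + 1) * σ := by positivity
  have hznorm : ‖z‖ < r₀ := by
    have : ‖z‖ ≤ ‖a‖ + ‖a - z‖ := by
      have := norm_sub_le a (a - z)
      rwa [sub_sub_cancel] at this
    linarith
  have hwnorm : ‖w‖ < r₀ := by
    have : ‖w‖ ≤ ‖b‖ + ‖b - w‖ := by
      have := norm_sub_le b (b - w)
      rwa [sub_sub_cancel] at this
    linarith
  have hgrad : ∀ x y p : E, ‖x‖ + ‖y‖ ≤ 2 / η₁ * σ → ‖p‖ < σ →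
      ‖(2 : ℝ) • T (x - y) + (2 * (M + η)) • x + p‖ < r₀ := by
    intro x y p hxy hp
    have e1 : ‖(2 : ℝ) • T (x - y)‖ ≤ 2 * t * (2 / η₁ * σ) := by
      rw [norm_smul, Real.norm_of_nonneg (by norm_num), mul_assoc]
      gcongr
      refine (T.le_opNorm _).trans ?_
      gcongr
      exact (norm_sub_le _ _).trans hxy
    have e2 : ‖(2 * (M + η)) • x‖ ≤ 2 * (M + η) * (2 / η₁ * σ) := by
      rw [norm_smul, Real.norm_of_nonneg (by positivity)]
      gcongr
      linarith [norm_nonneg y]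
    have e3 := norm_add₃_le (a := (2 : ℝ) • T (x - y)) (b := (2 * (M + η)) • x) (c := p)
    linarith
  have hgUnorm : ‖gU a‖ < r₀ := by
    rw [eq_add_of_sub_eq' hgUa]
    exact hgrad a b p hab hpq.1
  have hgVnorm : ‖gV b‖ < r₀ := by
    rw [eq_add_of_sub_eq' hgVb]
    exact hgrad b a q (by linarith) hpq.2
  have hnear : ∀ x : E, ‖x‖ < r₀ → ∀ᶠ h in nhds (0 : E), x + h ∈ K := by
    intro x hx
    have hc : Continuous fun h : E => x + h := by fun_prop
    have : ball (0 : E) ρ ∈ nhds (x + 0) := by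
      rw [add_zero]
      exact isOpen_ball.mem_nhds (by simpa using hx.trans_le (min_le_right _ _))
    filter_upwards [hc.continuousAt.preimage_mem_nhds this] with h hh
    exact ball_subset_closedBall hh
  refine ⟨z, w, gU a, - gV b, X, - Y, hznorm.trans_le (min_le_left _ _),
    hwnorm.trans_le (min_le_left _ _), hgUnorm.trans_le (min_le_left _ _),
    by rw [norm_neg]; exact hgVnorm.trans_le (min_le_left _ _), ?_, ?_, ?_⟩
  · filter_upwards [eventually_taylor_two hU hX hη, hnear z hznorm] with h h1 h2
    have e1 := hUge (a + h) (z + h) h2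
    have e2 := (abs_le.1 h1).2
    rw [add_sub_add_right_eq_sub] at e1
    linarith
  · filter_upwards [eventually_taylor_two hV hY hη, hnear w hwnorm] with h h1 h2
    have e1 := hVge (b + h) (w + h) h2
    have e2 := (abs_le.1 h1).2
    rw [add_sub_add_right_eq_sub] at e1
    simp only [neg_apply, inner_neg_left]
    linarith
  · intro h k
    have key : ∀ δ > 0, 1 / 2 * ⟪X h, h⟫ + 1 / 2 * ⟪Y k, k⟫ ≤
        Q h k + δ * (‖h‖ ^ 2 + ‖k‖ ^ 2) := by
      intro δ hδ
      have tend : ∀ x : E, Filter.Tendsto (fun s : ℝ => s • x) (nhdsWithin 0 (Ioi 0)) (nhds 0) := by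
        intro x
        have hc : Continuous fun s : ℝ => s • x := by fun_prop
        have := hc.tendsto 0
        rw [zero_smul] at this
        exact this.mono_left nhdsWithin_le_nhds
      obtain ⟨s, ⟨h1, h2⟩, hs⟩ := (((tend h).eventually (eventually_taylor_two hU hX hδ)).and
        ((tend k).eventually (eventually_taylor_two hV hY hδ))).and self_mem_nhdsWithin |>.exists
      have hs' : 0 < s := hs
      have e1 := (abs_le.1 h1).1
      have e2 := (abs_le.1 h2).1
      have e3 := hUV (a + s • h) (b + s • k)
      rw [hQ_expand] at e3
      have e4 : Q (s • h) (s • k) = s ^ 2 * Q h k := by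
        simp only [hQ, ← smul_sub, map_smul, inner_smul_left, inner_smul_right, norm_smul, mul_pow]
        simp
        ring
      have e5 : ⟪gU a, s • h⟫ =
          ⟪(2 : ℝ) • T (a - b) + (2 * (M + η)) • a, s • h⟫ + ⟪p, s • h⟫ := by
        rw [← inner_add_left, eq_add_of_sub_eq' hgUa]
      have e6 : ⟪gV b, s • k⟫ =
          ⟪(2 : ℝ) • T (b - a) + (2 * (M + η)) • b, s • k⟫ + ⟪q, s • k⟫ := by
        rw [← inner_add_left, eq_add_of_sub_eq' hgVb]
      rw [e4, inner_add_right p, inner_add_right q] at e3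
      have e7 : ⟪X (s • h), s • h⟫ = s ^ 2 * ⟪X h, h⟫ := by
        rw [map_smul, inner_smul_left, inner_smul_right]; simp; ring
      have e8 : ⟪Y (s • k), s • k⟫ = s ^ 2 * ⟪Y k, k⟫ := by
        rw [map_smul, inner_smul_left, inner_smul_right]; simp; ring
      rw [e7, norm_smul, mul_pow, Real.norm_eq_abs, sq_abs] at e1
      rw [e8, norm_smul, mul_pow, Real.norm_eq_abs, sq_abs] at e2
      have e9 : s ^ 2 * (1 / 2 * ⟪X h, h⟫ + 1 / 2 * ⟪Y k, k⟫) ≤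
          s ^ 2 * (Q h k + δ * (‖h‖ ^ 2 + ‖k‖ ^ 2)) := by linarith
      exact le_of_mul_le_mul_left e9 (by positivity)
    have : 1 / 2 * ⟪X h, h⟫ + 1 / 2 * ⟪Y k, k⟫ ≤ Q h k := by
      refine le_of_forall_pos_le_add fun ε hε => ?_
      refine (key (ε / (‖h‖ ^ 2 + ‖k‖ ^ 2 + 1)) (by positivity)).trans ?_
      gcongr
      rw [div_mul_eq_mul_div, div_le_iff₀ (by positivity)]
      nlinarith
    simp only [neg_apply, inner_neg_left]
    linarith

theorem Matrix.PosSemidef.dotProduct_mulVec_le_trace {n : Type*} [Fintype n] [DecidableEq n]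
    {P : Matrix n n ℝ} (hP : P.PosSemidef) {ξ : n → ℝ} (hξ : ξ ⬝ᵥ ξ = 1) :
    ξ ⬝ᵥ P.mulVec ξ ≤ P.trace := by
  set R : Matrix n n ℝ := 1 - Matrix.vecMulVec ξ ξ with hR
  have hRR : R * R = R := by
    rw [hR, sub_mul, one_mul, mul_sub, mul_one, Matrix.vecMulVec_mul_vecMulVec, hξ]
    simp
  have hRT : R.conjTranspose = R := by
    ext i j
    simp [hR, Matrix.vecMulVec_apply, Matrix.one_apply, mul_comm, eq_comm]
  have h1 := (hP.conjTranspose_mul_mul_same R).trace_nonneg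
  rw [hRT, Matrix.trace_mul_cycle, hRR, Matrix.trace_mul_comm, hR, mul_sub, mul_one,
    Matrix.trace_sub, Matrix.mul_vecMulVec, Matrix.trace_vecMulVec, dotProduct_comm] at h1
  linarith

/-- A uniformly elliptic operator strictly decreases if one matrix is not much larger than another
and much smaller in one direction. -/
theorem UnifElliptic.sub_le_s13 {N : ℕ} {lam Lam : ℝ} {F : Matrix (Fin N) (Fin N) ℝ → ℝ}
    (hF : UnifElliptic lam Lam F) (hlam : 0 ≤ lam) {X Y : Matrix (Fin N) (Fin N) ℝ}
    (hX : X.IsSymm) (hY : Y.IsSymm) {m c : ℝ} (hm : 0 ≤ m)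
    (hXY : ∀ v, v ⬝ᵥ (X - Y).mulVec v ≤ m * (v ⬝ᵥ v)) {ξ : Fin N → ℝ} (hξ : ξ ⬝ᵥ ξ = 1)
    (hξXY : ξ ⬝ᵥ (X - Y).mulVec ξ ≤ m - c) : F X - F Y ≤ Lam * (m * N) - lam * c := by
  set P : Matrix (Fin N) (Fin N) ℝ := m • 1 - (X - Y) with hPdef
  have hquad : ∀ v, v ⬝ᵥ P.mulVec v = m * (v ⬝ᵥ v) - v ⬝ᵥ (X - Y).mulVec v := by
    intro v
    rw [hPdef, Matrix.sub_mulVec, dotProduct_sub, Matrix.smul_mulVec, Matrix.one_mulVec,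
      dotProduct_smul, smul_eq_mul]
  have hPsymm : P.IsHermitian := by
    have : P.IsSymm := ((Matrix.isSymm_one).smul m).sub (hX.sub hY)
    rw [Matrix.IsHermitian, Matrix.conjTranspose_eq_transpose_of_trivial]
    exact this
  have hP : P.PosSemidef := by
    refine .of_dotProduct_mulVec_nonneg hPsymm fun v => ?_
    rw [star_trivial, hquad]
    linarith [hXY v]
  have hm1 : (m • (1 : Matrix (Fin N) (Fin N) ℝ)).PosSemidef := Matrix.PosSemidef.one.smul hm
  have h1 := (hF Y _ hY hm1).2
  have h2 := (hF X P hX hP).1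
  have h3 : X + P = Y + m • 1 := by rw [hPdef]; abel
  have h4 := hP.dotProduct_mulVec_le_trace hξ
  rw [hquad, hξ] at h4
  have h5 : lam * c ≤ lam * P.trace := by gcongr; linarith
  rw [h3] at h2
  rw [Matrix.trace_smul, Matrix.trace_one, Fintype.card_fin, smul_eq_mul] at h1
  linarith

/-- The matrix of the symmetric part of an operator. -/
def symmMatrix {N : ℕ} (X : Euc N →L[ℝ] Euc N) : Matrix (Fin N) (Fin N) ℝ :=
  Matrix.of fun i j =>
    1 / 2 * (⟪X (EuclideanSpace.single i (1 : ℝ)), EuclideanSpace.single j (1 : ℝ)⟫ +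
      ⟪X (EuclideanSpace.single j (1 : ℝ)), EuclideanSpace.single i (1 : ℝ)⟫)

theorem symmMatrix_isSymm {N : ℕ} (X : Euc N →L[ℝ] Euc N) : (symmMatrix X).IsSymm := by
  ext i j
  simp [symmMatrix, add_comm]

theorem dotProduct_symmMatrix_mulVec {N : ℕ} (X : Euc N →L[ℝ] Euc N) (v : Euc N) :
    v.ofLp ⬝ᵥ (symmMatrix X).mulVec v.ofLp = ⟪X v, v⟫ := by
  have hv : v = ∑ i, v i • EuclideanSpace.single i (1 : ℝ) := by
    ext j
    simp [Finset.sum_apply, Pi.single_apply]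
  have h1 : ⟪X v, v⟫ = ∑ i, ∑ j, v i * v j *
      ⟪X (EuclideanSpace.single i (1 : ℝ)), EuclideanSpace.single j (1 : ℝ)⟫ := by
    conv_lhs => rw [hv]
    rw [map_sum, sum_inner]
    refine Finset.sum_congr rfl fun i _ => ?_
    rw [inner_sum]
    refine Finset.sum_congr rfl fun j _ => ?_
    rw [map_smul, real_inner_smul_left, real_inner_smul_right]
    ring
  have h2 : ⟪X v, v⟫ = ∑ i, ∑ j, v i * v j *
      ⟪X (EuclideanSpace.single j (1 : ℝ)), EuclideanSpace.single i (1 : ℝ)⟫ := by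
    rw [h1, Finset.sum_comm]
    refine Finset.sum_congr rfl fun i _ => Finset.sum_congr rfl fun j _ => by ring
  have h3 : v.ofLp ⬝ᵥ (symmMatrix X).mulVec v.ofLp = 1 / 2 * (⟪X v, v⟫ + ⟪X v, v⟫) := by
    conv_rhs => rw [h1]
    rw [← h1]
    nth_rewrite 1 [h1]
    rw [h2, ← Finset.sum_add_distrib, Finset.mul_sum]
    simp only [dotProduct, Matrix.mulVec, symmMatrix, Matrix.of_apply]
    refine Finset.sum_congr rfl fun i _ => ?_
    rw [← Finset.sum_add_distrib, Finset.mul_sum, Finset.mul_sum]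
    refine Finset.sum_congr rfl fun j _ => by ring
  rw [h3]; ring

/-- The quadratic polynomial centred at `x₀` with gradient `p` and Hessian the symmetric part
of `X`. -/
def quadPoly {N : ℕ} (x₀ p : Euc N) (X : Euc N →L[ℝ] Euc N) (x : Euc N) : ℝ :=
  ⟪p, x - x₀⟫ + 1 / 2 * ⟪X (x - x₀), x - x₀⟫

theorem contDiff_quadPoly {N : ℕ} (x₀ p : Euc N) (X : Euc N →L[ℝ] Euc N) :
    ContDiff ℝ 2 (quadPoly x₀ p X) := by
  unfold quadPoly
  have h : ContDiff ℝ 2 fun x : Euc N => x - x₀ := by fun_prop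
  exact (contDiff_const.inner ℝ h).add (contDiff_const.mul ((X.contDiff.comp h).inner ℝ h))

/-- The bilinear form `(x, y) ↦ ⟪X x, y⟫`. -/
def innerForm {N : ℕ} (X : Euc N →L[ℝ] Euc N) : Euc N →L[ℝ] Euc N →L[ℝ] ℝ :=
  (isBoundedBilinearMap_inner (𝕜 := ℝ) (E := Euc N)).toContinuousLinearMap.comp X

theorem innerForm_apply {N : ℕ} (X : Euc N →L[ℝ] Euc N) (x y : Euc N) :
    innerForm X x y = ⟪X x, y⟫ := rfl

theorem hasFDerivAt_quadPoly {N : ℕ} (x₀ p : Euc N) (X : Euc N →L[ℝ] Euc N) (x : Euc N) :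
    HasFDerivAt (quadPoly x₀ p X) (innerSL ℝ p + (1 / 2 : ℝ) •
      (innerForm X (x - x₀) + (innerForm X).flip (x - x₀))) x := by
  have h : HasFDerivAt (fun x : Euc N => x - x₀) (ContinuousLinearMap.id ℝ (Euc N)) x :=
    (hasFDerivAt_id x).sub_const x₀
  have h1 := (innerSL ℝ p).hasFDerivAt.comp x h
  have h2 := ((X.hasFDerivAt.comp x h).inner ℝ h).const_mul (1 / 2 : ℝ)
  refine (h1.add h2).congr_fderiv ?_
  ext y
  simp [innerForm_apply, real_inner_comm, inner_sub_left, inner_sub_right]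
  ring

theorem gradient_quadPoly {N : ℕ} (x₀ p : Euc N) (X : Euc N →L[ℝ] Euc N) :
    gradient (quadPoly x₀ p X) x₀ = p := by
  apply HasGradientAt.gradient
  rw [hasGradientAt_iff_hasFDerivAt]
  refine (hasFDerivAt_quadPoly x₀ p X x₀).congr_fderiv ?_
  ext y
  simp

theorem hess_quadPoly {N : ℕ} (x₀ p : Euc N) (X : Euc N →L[ℝ] Euc N) :
    hess (quadPoly x₀ p X) x₀ = symmMatrix X := by
  have h1 : fderiv ℝ (quadPoly x₀ p X) = fun x => innerSL ℝ p + (1 / 2 : ℝ) •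
      (innerForm X (x - x₀) + (innerForm X).flip (x - x₀)) :=
    funext fun x => (hasFDerivAt_quadPoly x₀ p X x).fderiv
  have h : HasFDerivAt (fun x : Euc N => x - x₀) (ContinuousLinearMap.id ℝ (Euc N)) x₀ :=
    (hasFDerivAt_id x₀).sub_const x₀
  have h2 : HasFDerivAt (fun x => innerSL ℝ p + (1 / 2 : ℝ) •
      (innerForm X (x - x₀) + (innerForm X).flip (x - x₀)))
      ((1 / 2 : ℝ) • (innerForm X + (innerForm X).flip)) x₀ := by
    have e1 := (innerForm X).hasFDerivAt.comp x₀ h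
    have e2 := (innerForm X).flip.hasFDerivAt.comp x₀ h
    exact ((e1.add e2).const_smul (1 / 2 : ℝ)).const_add _
  ext i j
  simp only [hess, symmMatrix, Matrix.of_apply]
  rw [iteratedFDeriv_two_apply, h1, h2.fderiv]
  rfl

/-- Second order upper bound for the norm away from the origin. -/
theorem norm_add_le_of_norm_le_half {E : Type*} [NormedAddCommGroup E] [InnerProductSpace ℝ E]
    {D δ : E} (hD : D ≠ 0) (hδ : ‖δ‖ ≤ ‖D‖ / 2) :
    ‖D + δ‖ ≤ ‖D‖ + ⟪‖D‖⁻¹ • D, δ⟫ + (‖δ‖ ^ 2 - ⟪‖D‖⁻¹ • D, δ⟫ ^ 2) / ‖D‖ := by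
  have hs : 0 < ‖D‖ := norm_pos_iff.2 hD
  have hinner : ⟪D, δ⟫ = ‖D‖ * ⟪‖D‖⁻¹ • D, δ⟫ := by
    rw [real_inner_smul_left, mul_inv_cancel_left₀ hs.ne']
  have hcabs : |⟪‖D‖⁻¹ • D, δ⟫| ≤ ‖δ‖ := by
    refine (abs_real_inner_le_norm _ _).trans_eq ?_
    rw [norm_smul, norm_inv, norm_norm, inv_mul_cancel₀ hs.ne', one_mul]
  have hsq := norm_add_sq_real D δ
  rw [hinner] at hsq
  set c := ⟪‖D‖⁻¹ • D, δ⟫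
  set s := ‖D‖
  have hq : 0 ≤ ‖δ‖ ^ 2 - c ^ 2 := by
    have := sq_le_sq' (by linarith [abs_le.1 hcabs]) (abs_le.1 hcabs).2
    linarith
  have hc : 0 ≤ s + 2 * c := by linarith [(abs_le.1 hcabs).1]
  have hqs : 0 ≤ (‖δ‖ ^ 2 - c ^ 2) / s := by positivity
  have hqs' : (‖δ‖ ^ 2 - c ^ 2) = s * ((‖δ‖ ^ 2 - c ^ 2) / s) := by field_simp
  refine abs_le_of_sq_le_sq' ?_ (by linarith) |>.2
  set k := (‖δ‖ ^ 2 - c ^ 2) / s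
  nlinarith [mul_nonneg hc hqs, sq_nonneg k]

/-- Jets at a maximum of the doubled function with the penalisation
`L (‖x - y‖ - κ / 2 * ‖x - y‖ ^ 2) + M ‖x - x₀‖ ^ 2`. -/
theorem exists_jets_of_isLocalMax_doubled {E : Type*} [NormedAddCommGroup E]
    [InnerProductSpace ℝ E] [FiniteDimensional ℝ E] {Ω : Set E} (hΩ : IsOpen Ω) {u : E → ℝ}
    (hu : ContinuousOn u Ω) {L κ M : ℝ} (hL : 0 ≤ L) (hM : 0 ≤ M) {x₀ x y : E}
    (hx : x ∈ Ω) (hy : y ∈ Ω) (hxy : x - y ≠ 0)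
    (hmax : IsLocalMax (fun z : E × E => u z.1 - u z.2
      - L * (‖z.1 - z.2‖ - κ / 2 * ‖z.1 - z.2‖ ^ 2) - M * ‖z.1 - x₀‖ ^ 2) (x, y))
    {η : ℝ} (hη : 0 < η) :
    ∃ (x' y' p q : E) (X Y : E →L[ℝ] E), x' ∈ Ω ∧ y' ∈ Ω ∧
      ‖p - ((L * (1 - κ * ‖x - y‖)) • (‖x - y‖⁻¹ • (x - y)) + (2 * M) • (x - x₀))‖ < η ∧
      ‖q - (L * (1 - κ * ‖x - y‖)) • (‖x - y‖⁻¹ • (x - y))‖ < η ∧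
      (∀ᶠ h in nhds (0 : E), u (x' + h) ≤ u x' + ⟪p, h⟫ + 1 / 2 * ⟪X h, h⟫) ∧
      (∀ᶠ h in nhds (0 : E), u y' + ⟪q, h⟫ + 1 / 2 * ⟪Y h, h⟫ ≤ u (y' + h)) ∧
      (∀ v, ⟪X v, v⟫ - ⟪Y v, v⟫ ≤ 4 * (M + η) * ‖v‖ ^ 2) ∧
      ⟪X (‖x - y‖⁻¹ • (x - y)), ‖x - y‖⁻¹ • (x - y)⟫
        - ⟪Y (‖x - y‖⁻¹ • (x - y)), ‖x - y‖⁻¹ • (x - y)⟫ ≤ 4 * (M + η) - 4 * L * κ := by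
  have hs : 0 < ‖x - y‖ := norm_pos_iff.2 hxy
  have hnorm : ∀ δ : E, ‖δ‖ ≤ ‖x - y‖ / 2 → _ := fun δ => norm_add_le_of_norm_le_half hxy
  have hinner : ∀ δ : E, ⟪x - y, δ⟫ = ‖x - y‖ * ⟪‖x - y‖⁻¹ • (x - y), δ⟫ := fun δ => by
    rw [real_inner_smul_left, mul_inv_cancel_left₀ hs.ne']
  have hξ : ‖‖x - y‖⁻¹ • (x - y)‖ = 1 := by
    rw [norm_smul, norm_inv, norm_norm, inv_mul_cancel₀ hs.ne']
  set s := ‖x - y‖ with hsdef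
  set ξ := s⁻¹ • (x - y) with hξdef
  clear_value ξ
  set p₂ := (L * (1 - κ * s)) • ξ with hp₂
  set p₁ := p₂ + (2 * M) • (x - x₀) with hp₁
  obtain ⟨ρ, hρ, hρs, hball⟩ : ∃ ρ > 0, ρ ≤ s / 4 ∧ ∀ a ∈ closedBall (0 : E) ρ,
      ∀ b ∈ closedBall (0 : E) ρ, x + a ∈ Ω ∧ y + b ∈ Ω ∧
      u (x + a) - u (y + b) - L * (‖x + a - (y + b)‖ - κ / 2 * ‖x + a - (y + b)‖ ^ 2)
        - M * ‖x + a - x₀‖ ^ 2 ≤ u x - u y - L * (s - κ / 2 * s ^ 2) - M * ‖x - x₀‖ ^ 2 := by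
    have h1 : ∀ᶠ z : E × E in nhds (x, y), z ∈ Ω ×ˢ Ω :=
      prod_mem_nhds (hΩ.mem_nhds hx) (hΩ.mem_nhds hy)
    obtain ⟨ε, hε, hε'⟩ := Metric.eventually_nhds_iff_ball.1 (h1.and hmax)
    refine ⟨min (ε / 2) (s / 4), by positivity, min_le_right _ _, fun a ha b hb => ?_⟩
    rw [mem_closedBall_zero_iff] at ha hb
    have h2 : (x + a, y + b) ∈ ball (x, y) ε := by
      rw [← ball_prod_same, Set.mem_prod]
      simp only [mem_ball, dist_self_add_left]
      have := min_le_left (ε / 2) (s / 4)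
      constructor <;> linarith
    have := hε' _ h2
    exact ⟨this.1.1, this.1.2, this.2⟩
  set T : E →L[ℝ] E := (L / s - L * κ / 2) • ContinuousLinearMap.id ℝ E
    - (L / s) • (innerSL ℝ ξ).smulRight ξ with hT
  have hTapp : ∀ δ δ' : E, ⟪T δ, δ'⟫ = (L / s - L * κ / 2) * ⟪δ, δ'⟫
      - L / s * (⟪ξ, δ⟫ * ⟪ξ, δ'⟫) := by
    intro δ δ'
    simp [hT, inner_sub_left, real_inner_smul_left]
  have hcu : ContinuousOn (fun a => u (x + a) - u x - ⟪p₁, a⟫) (closedBall 0 ρ) := by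
    have : ContinuousOn (fun a => u (x + a)) (closedBall 0 ρ) :=
      hu.comp (by fun_prop) fun a ha => (hball a ha 0 (mem_closedBall_self hρ.le)).1
    exact (this.sub continuousOn_const).sub (by fun_prop)
  have hcv : ContinuousOn (fun a => u (y + a) - u y - ⟪p₂, a⟫) (closedBall 0 ρ) := by
    have : ContinuousOn (fun a => u (y + a)) (closedBall 0 ρ) :=
      hu.comp (by fun_prop) fun a ha => (hball 0 (mem_closedBall_self hρ.le) a ha).2.1
    exact (this.sub continuousOn_const).sub (by fun_prop)
  have hle : ∀ a ∈ closedBall (0 : E) ρ, ∀ b ∈ closedBall (0 : E) ρ,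
      (u (x + a) - u x - ⟪p₁, a⟫) - (u (y + b) - u y - ⟪p₂, b⟫)
        ≤ ⟪T (a - b), a - b⟫ + M * (‖a‖ ^ 2 + ‖b‖ ^ 2) := by
    intro a ha b hb
    have h1 := (hball a ha b hb).2.2
    rw [mem_closedBall_zero_iff] at ha hb
    have h2 : ‖a - b‖ ≤ s / 2 := by linarith [norm_sub_le a b]
    have h3 := hnorm _ h2
    have h4 : x + a - (y + b) = x - y + (a - b) := by abel
    have h5 : x + a - x₀ = x - x₀ + a := by abel
    have h6 := norm_add_sq_real (x - y) (a - b)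
    rw [hinner, ← hsdef] at h6
    have h7 := norm_add_sq_real (x - x₀) a
    rw [h4, h5, h6, h7] at h1
    rw [hTapp, real_inner_self_eq_norm_sq, hp₁, inner_add_left, hp₂, real_inner_smul_left,
      real_inner_smul_left, real_inner_smul_left]
    have h8 : ⟪ξ, a - b⟫ = ⟪ξ, a⟫ - ⟪ξ, b⟫ := inner_sub_right _ _ _
    have h9 := mul_le_mul_of_nonneg_left h3 hL
    have h10 : L * (s + ⟪ξ, a - b⟫ + (‖a - b‖ ^ 2 - ⟪ξ, a - b⟫ ^ 2) / s)
      = L * s + L * ⟪ξ, a - b⟫ + L / s * (‖a - b‖ ^ 2 - ⟪ξ, a - b⟫ ^ 2) := by ring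
    rw [h10] at h9
    rw [h8] at h1 h9 ⊢
    have h11 : 0 ≤ M * ‖b‖ ^ 2 := by positivity
    nlinarith
  obtain ⟨z, w, p, q, X, Y, hz, hw, hp, hq, hX, hY, hXY⟩ := exists_touching_quadratics hρ hcu hcv T
    (fun a b => by rw [hTapp, real_inner_comm (T b), hTapp, real_inner_comm a b]; ring) hM hle
    (by simp) (η := min ρ (η / 2)) (by positivity)
  have hηρ := min_le_left ρ (η / 2)
  have hηη := min_le_right ρ (η / 2)
  have hη0 : 0 < min ρ (η / 2) := by positivity
  set ε := min ρ (η / 2)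
  have hz' : z ∈ closedBall (0 : E) ρ := by rw [mem_closedBall_zero_iff]; linarith
  have hw' : w ∈ closedBall (0 : E) ρ := by rw [mem_closedBall_zero_iff]; linarith
  have hX' : ∀ v, ⟪(X + (2 * ε) • ContinuousLinearMap.id ℝ E) v, v⟫
      = ⟪X v, v⟫ + 2 * ε * ‖v‖ ^ 2 := by
    intro v; simp [inner_add_left, real_inner_smul_left]
  have hY' : ∀ v, ⟪(Y - (2 * ε) • ContinuousLinearMap.id ℝ E) v, v⟫
      = ⟪Y v, v⟫ - 2 * ε * ‖v‖ ^ 2 := by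
    intro v; simp [inner_sub_left, real_inner_smul_left]
  refine ⟨x + z, y + w, p₁ + p, p₂ + q, X + (2 * ε) • ContinuousLinearMap.id ℝ E,
    Y - (2 * ε) • ContinuousLinearMap.id ℝ E, (hball z hz' w hw').1, (hball z hz' w hw').2.1,
    by rw [add_sub_cancel_left]; linarith, by rw [add_sub_cancel_left]; linarith, ?_, ?_, ?_, ?_⟩
  · filter_upwards [hX] with h hh
    rw [hX', inner_add_left, add_assoc x z h]
    rw [inner_add_right] at hh
    linarith
  · filter_upwards [hY] with h hh
    rw [hY', inner_add_left, add_assoc y w h]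
    rw [inner_add_right] at hh
    linarith
  · intro v
    have h1 := hXY v v
    rw [hX', hY']
    simp only [sub_self, inner_zero_right] at h1
    nlinarith [sq_nonneg ‖v‖]
  · have h1 := hXY ξ (-ξ)
    rw [hX', hY', hξ]
    rw [hTapp, map_neg, inner_neg_neg, norm_neg, sub_neg_eq_add] at h1
    simp only [inner_add_right, inner_add_left, real_inner_self_eq_norm_sq, hξ] at h1
    nlinarith

/-- If the Lipschitz bound fails near `x₀`, the doubled function has an interior maximum off the
diagonal. -/
theorem exists_isLocalMax_doubled {E : Type*} [NormedAddCommGroup E] [InnerProductSpace ℝ E]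
    [FiniteDimensional ℝ E] {u : E → ℝ} {x₀ y₀ : E} {b t L κ M Cu : ℝ}
    (hu : ContinuousOn u (closedBall x₀ (2 * b))) (hCu : ∀ x ∈ closedBall x₀ (2 * b), |u x| ≤ Cu)
    (hb : 0 < b) (htb : t ≤ b) (hκ : 0 ≤ κ) (hκt : κ * t ≤ 1 / 2) (hL : 0 ≤ L)
    (hLt : 4 * Cu ≤ L * t) (hM : 2 * Cu < M * b ^ 2) (hM0 : 0 ≤ M) (hy : ‖x₀ - y₀‖ ≤ t)
    (hfail : L * ‖x₀ - y₀‖ < u x₀ - u y₀) :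
    ∃ x y : E, ‖x - x₀‖ < b ∧ ‖x - y‖ < t ∧ x - y ≠ 0 ∧
      IsLocalMax (fun z : E × E => u z.1 - u z.2
      - L * (‖z.1 - z.2‖ - κ / 2 * ‖z.1 - z.2‖ ^ 2) - M * ‖z.1 - x₀‖ ^ 2) (x, y) := by
  set Φ : E × E → ℝ := fun z => u z.1 - u z.2
      - L * (‖z.1 - z.2‖ - κ / 2 * ‖z.1 - z.2‖ ^ 2) - M * ‖z.1 - x₀‖ ^ 2 with hΦ
  set K : Set (E × E) := {z | ‖z.1 - x₀‖ ≤ b ∧ ‖z.1 - z.2‖ ≤ t} with hK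
  have hKb : ∀ z ∈ K, z.1 ∈ closedBall x₀ (2 * b) ∧ z.2 ∈ closedBall x₀ (2 * b) := by
    rintro z ⟨h1, h2⟩
    rw [mem_closedBall_iff_norm, mem_closedBall_iff_norm]
    refine ⟨by linarith, ?_⟩
    have h3 : z.2 - x₀ = (z.1 - x₀) - (z.1 - z.2) := by abel
    rw [h3]
    linarith [norm_sub_le (z.1 - x₀) (z.1 - z.2)]
  have hKc : IsCompact K := by
    refine ((isCompact_closedBall x₀ (2 * b)).prod
      (isCompact_closedBall x₀ (2 * b))).of_isClosed_subset ?_ hKb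
    have h1 : Continuous fun z : E × E => ‖z.1 - x₀‖ := by fun_prop
    have h2 : Continuous fun z : E × E => ‖z.1 - z.2‖ := by fun_prop
    exact (isClosed_le h1 continuous_const).inter (isClosed_le h2 continuous_const)
  have hΦc : ContinuousOn Φ K := by
    have h1 : ContinuousOn (fun z : E × E => u z.1) K :=
      hu.comp continuousOn_fst fun z hz => (hKb z hz).1
    have h2 : ContinuousOn (fun z : E × E => u z.2) K :=
      hu.comp continuousOn_snd fun z hz => (hKb z hz).2
    exact ((h1.sub h2).sub (by fun_prop)).sub (by fun_prop)
  have hmem : (x₀, y₀) ∈ K := ⟨by simpa using hb.le, hy⟩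
  obtain ⟨⟨x, y⟩, hxyK, hmax⟩ := hKc.exists_isMaxOn ⟨_, hmem⟩ hΦc
  have hpos : 0 < Φ (x, y) := by
    refine lt_of_lt_of_le ?_ (hmax hmem)
    simp only [hΦ, sub_self, norm_zero]
    have : 0 ≤ L * (κ / 2 * ‖x₀ - y₀‖ ^ 2) := by positivity
    nlinarith
  have hux := abs_le.1 (hCu x (hKb _ hxyK).1)
  have huy := abs_le.1 (hCu y (hKb _ hxyK).2)
  have hxb : ‖x - x₀‖ ≤ b := hxyK.1
  have hxyt : ‖x - y‖ ≤ t := hxyK.2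
  have hg : L * ‖x - y‖ * (3 / 4) ≤ L * (‖x - y‖ - κ / 2 * ‖x - y‖ ^ 2) := by
    have h1 : κ * ‖x - y‖ ≤ 1 / 2 := (mul_le_mul_of_nonneg_left hxyt hκ).trans hκt
    have h2 : 0 ≤ L * ‖x - y‖ := by positivity
    nlinarith
  have hg0 : 0 ≤ L * ‖x - y‖ := by positivity
  have hM2 : 0 ≤ M * ‖x - x₀‖ ^ 2 := by positivity
  have hpos' : 0 < u x - u y - L * (‖x - y‖ - κ / 2 * ‖x - y‖ ^ 2) - M * ‖x - x₀‖ ^ 2 := hpos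
  have hx' : ‖x - x₀‖ < b := by
    refine hxb.lt_of_ne fun h => ?_
    rw [h] at hpos'
    linarith
  have hxy' : ‖x - y‖ < t := by
    refine hxyt.lt_of_ne fun h => ?_
    rw [h] at hg hpos'
    linarith
  refine ⟨x, y, hx', hxy', fun h => ?_, ?_⟩
  · rw [sub_eq_zero.1 h] at hpos' hM2
    simp only [sub_self, norm_zero] at hpos'
    linarith
  · have h1 : ∀ᶠ z : E × E in nhds (x, y), ‖z.1 - x₀‖ < b ∧ ‖z.1 - z.2‖ < t := by
      have h2 : ContinuousAt (fun z : E × E => ‖z.1 - x₀‖) (x, y) := by fun_prop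
      have h3 : ContinuousAt (fun z : E × E => ‖z.1 - z.2‖) (x, y) := by fun_prop
      exact (h2.eventually_lt continuousAt_const hx').and
        (h3.eventually_lt continuousAt_const hxy')
    filter_upwards [h1] with z hz
    exact hmax ⟨hz.1.le, hz.2.le⟩

/-- Testing a subsolution with a quadratic polynomial. -/
theorem ViscSub.le_of_eventually_le {N : ℕ} {Ω : Set (Euc N)}
    {G : Euc N → Euc N → Matrix (Fin N) (Fin N) ℝ → ℝ} {f u : Euc N → ℝ} (hu : ViscSub Ω G f u)
    {x p : Euc N} {X : Euc N →L[ℝ] Euc N} (hx : x ∈ Ω)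
    (h : ∀ᶠ h in nhds (0 : Euc N), u (x + h) ≤ u x + ⟪p, h⟫ + 1 / 2 * ⟪X h, h⟫) :
    f x ≤ G x p (symmMatrix X) := by
  have key := hu x hx (quadPoly x p X) (contDiff_quadPoly x p X) ?_
  · rwa [gradient_quadPoly, hess_quadPoly] at key
  · have h1 : Filter.Tendsto (fun y => y - x) (nhds x) (nhds 0) := by
      have : ContinuousAt (fun y => y - x) x := by fun_prop
      simpa [ContinuousAt] using this
    refine Filter.Eventually.filter_mono nhdsWithin_le_nhds ?_
    filter_upwards [h1.eventually h] with y hy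
    rw [add_sub_cancel] at hy
    simp only [quadPoly, sub_self, inner_zero_right]
    linarith

/-- Testing a supersolution with a quadratic polynomial. -/
theorem ViscSuper.le_of_eventually_le {N : ℕ} {Ω : Set (Euc N)}
    {G : Euc N → Euc N → Matrix (Fin N) (Fin N) ℝ → ℝ} {f u : Euc N → ℝ} (hu : ViscSuper Ω G f u)
    {x p : Euc N} {X : Euc N →L[ℝ] Euc N} (hx : x ∈ Ω)
    (h : ∀ᶠ h in nhds (0 : Euc N), u x + ⟪p, h⟫ + 1 / 2 * ⟪X h, h⟫ ≤ u (x + h)) :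
    G x p (symmMatrix X) ≤ f x := by
  have key := hu x hx (quadPoly x p X) (contDiff_quadPoly x p X) ?_
  · rwa [gradient_quadPoly, hess_quadPoly] at key
  · have h1 : Filter.Tendsto (fun y => y - x) (nhds x) (nhds 0) := by
      have : ContinuousAt (fun y => y - x) x := by fun_prop
      simpa [ContinuousAt] using this
    refine Filter.Eventually.filter_mono nhdsWithin_le_nhds ?_
    filter_upwards [h1.eventually h] with y hy
    rw [add_sub_cancel] at hy
    simp only [quadPoly, sub_self, inner_zero_right]
    linarith

/-- The degenerate weight is at least one for large gradients. -/
theorem one_le_norm_add_smul_rpow {E : Type*} [NormedAddCommGroup E] [NormedSpace ℝ E] {e p : E}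
    {a α : ℝ} (ha : 0 ≤ a) (hα : 0 ≤ α) (he : ‖e‖ = 1) (hp : 2 / a ≤ ‖p‖) :
    1 ≤ ‖e + a • p‖ ^ α := by
  refine Real.one_le_rpow ?_ hα
  rcases ha.eq_or_lt with rfl | ha
  · simp [he]
  · have h1 : 2 ≤ ‖a • p‖ := by
      rw [norm_smul, Real.norm_of_nonneg ha.le]
      rwa [div_le_iff₀' ha] at hp
    have h2 := norm_sub_norm_le (a • p) (-e)
    rw [norm_neg, he, sub_neg_eq_add, add_comm] at h2
    linarith

theorem Real.rpow_le_one_add {x β : ℝ} (hx : 0 ≤ x) (hβ0 : 0 < β) (hβ1 : β ≤ 1) :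
    x ^ β ≤ 1 + x := by
  rcases le_total x 1 with h | h
  · linarith [Real.rpow_le_one hx h hβ0.le]
  · have := Real.rpow_le_rpow_of_exponent_le h hβ1
    rw [Real.rpow_one] at this
    linarith

theorem abs_le_of_mul_of_one_le {w A B : ℝ} (hw : 1 ≤ w) (hB : 0 ≤ B) :
    (-B ≤ w * A → -B ≤ A) ∧ (w * A ≤ B → A ≤ B) := by
  constructor <;> intro h <;> by_contra! hA <;> nlinarith

/-- Operator form of `UnifElliptic.sub_le`. -/
theorem UnifElliptic.symmMatrix_sub_le {N : ℕ} {lam Lam : ℝ}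
    {F : Matrix (Fin N) (Fin N) ℝ → ℝ} (hF : UnifElliptic lam Lam F) (hlam : 0 ≤ lam)
    {X Y : Euc N →L[ℝ] Euc N} {m c : ℝ} (hm : 0 ≤ m)
    (hXY : ∀ v, ⟪X v, v⟫ - ⟪Y v, v⟫ ≤ m * ‖v‖ ^ 2) {ξ : Euc N} (hξ : ‖ξ‖ = 1)
    (hξXY : ⟪X ξ, ξ⟫ - ⟪Y ξ, ξ⟫ ≤ m - c) :
    F (symmMatrix X) - F (symmMatrix Y) ≤ Lam * (m * N) - lam * c := by
  have hdot : ∀ w : Euc N, w.ofLp ⬝ᵥ w.ofLp = ‖w‖ ^ 2 := fun w => by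
    rw [EuclideanSpace.real_norm_sq_eq]
    exact Finset.sum_congr rfl fun i _ => (sq _).symm
  have hquad : ∀ w : Euc N, w.ofLp ⬝ᵥ (symmMatrix X - symmMatrix Y).mulVec w.ofLp
      = ⟪X w, w⟫ - ⟪Y w, w⟫ := fun w => by
    rw [Matrix.sub_mulVec, dotProduct_sub, dotProduct_symmMatrix_mulVec,
      dotProduct_symmMatrix_mulVec]
  refine hF.sub_le_s13 hlam (symmMatrix_isSymm X) (symmMatrix_isSymm Y) hm (fun w => ?_)
    (ξ := ξ.ofLp) (by rw [hdot, hξ, one_pow]) (by rw [hquad]; exact hξXY)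
  have := hXY (WithLp.toLp 2 w)
  rwa [← hquad, ← hdot] at this

/-- For gradients which are large compared with `1 / a`, the second order part of the tilted
equation is controlled by the gradient. -/
theorem ViscSol.jet_bounds {N : ℕ} {α Cf CH Hh a C β₁ β₂ : ℝ} {h : Euc N → Euc N} {e : Euc N}
    {F : Matrix (Fin N) (Fin N) ℝ → ℝ} {H : Euc N → Euc N → ℝ} {f u : Euc N → ℝ}
    {Ω : Set (Euc N)} (hα : 0 ≤ α) (hh : ∀ x ∈ Ω, ‖h x‖ ≤ Hh)
    (ha : 0 ≤ a) (hC : 0 < C) (he : ‖e‖ = 1)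
    (hβ₁ : β₁ ∈ Ioc (0 : ℝ) 1) (hβ₂ : β₂ ∈ Ioc (0 : ℝ) 1) (hH0 : ∀ x ∈ Ω, |H x 0| ≤ CH)
    (hH : ∀ x q : Euc N, |H x q - H x 0| ≤ C * (‖q‖ ^ β₁ + ‖q‖ ^ β₂))
    (hf : ∀ x ∈ Ω, |f x| ≤ Cf)
    (hsol : ViscSol Ω (fun x p M => ‖e + a • p‖ ^ α * (F M + ⟪h x, p⟫) + H x p) f u)
    {x p : Euc N} {X : Euc N →L[ℝ] Euc N} (hx : x ∈ Ω) (hp : 2 / a ≤ ‖p‖) :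
    ((∀ᶠ h in nhds (0 : Euc N), u (x + h) ≤ u x + ⟪p, h⟫ + 1 / 2 * ⟪X h, h⟫) →
      -((Cf + CH + 2 * C) + (2 * C + Hh) * ‖p‖) ≤ F (symmMatrix X)) ∧
    ((∀ᶠ h in nhds (0 : Euc N), u x + ⟪p, h⟫ + 1 / 2 * ⟪X h, h⟫ ≤ u (x + h)) →
      F (symmMatrix X) ≤ (Cf + CH + 2 * C) + (2 * C + Hh) * ‖p‖) := by
  have h1 := abs_le.1 (hH x p)
  have h2 := abs_le.1 (hH0 x hx)
  have h3 := Real.rpow_le_one_add (norm_nonneg p) hβ₁.1 hβ₁.2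
  have h4 := Real.rpow_le_one_add (norm_nonneg p) hβ₂.1 hβ₂.2
  have h5 : C * (‖p‖ ^ β₁ + ‖p‖ ^ β₂) ≤ C * ((1 + ‖p‖) + (1 + ‖p‖)) := by gcongr
  have h6 : |⟪h x, p⟫| ≤ Hh * ‖p‖ :=
    (abs_real_inner_le_norm _ _).trans (by gcongr; exact hh x hx)
  have h7 := abs_le.1 h6
  have h8 := abs_le.1 (hf x hx)
  have h9 : 0 ≤ C * (1 + ‖p‖) := by positivity
  have hB : 0 ≤ Cf + CH + 2 * C * (1 + ‖p‖) := by linarith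
  have hw := abs_le_of_mul_of_one_le (A := F (symmMatrix X) + ⟪h x, p⟫)
    (one_le_norm_add_smul_rpow ha hα he hp) hB
  refine ⟨fun hX => ?_, fun hX => ?_⟩
  · have h10 := hsol.1.le_of_eventually_le hx hX
    have h11 := hw.1 (by linarith)
    linarith
  · have h10 := hsol.2.le_of_eventually_le hx hX
    have h11 := hw.2 (by linarith)
    linarith

/-- Size of gradients close to a vector `v` or to `v + k`. -/
theorem norm_bounds_of_norm_sub_lt_one {E : Type*} [NormedAddCommGroup E] {p v k : E} {K : ℝ}
    (hk : ‖k‖ ≤ K) (hp : ‖p - (v + k)‖ < 1) : ‖v‖ - K - 1 ≤ ‖p‖ ∧ ‖p‖ ≤ ‖v‖ + K + 1 := by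
  have h1 : v = p - (p - (v + k)) - k := by abel
  have h2 : p = p - (v + k) + v + k := by abel
  constructor
  · have h3 := norm_sub_le (p - (p - (v + k))) k
    have h4 := norm_sub_le p (p - (v + k))
    rw [← h1] at h3
    linarith
  · have h3 := norm_add₃_le (a := p - (v + k)) (b := v) (c := k)
    rw [← h2] at h3
    linarith

/-- A priori bounds for large gradients. -/
theorem ViscSol.exists_lipschitz_estimate {N : ℕ} {lam Lam α Cf CH Hh a C β₁ β₂ Cu r : ℝ}
    {h : Euc N → Euc N} {e : Euc N} {F : Matrix (Fin N) (Fin N) ℝ → ℝ}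
    {H : Euc N → Euc N → ℝ} {f u : Euc N → ℝ}
    (hlam : 0 < lam) (hα : 0 ≤ α) (hh : ∀ x ∈ ball (0 : Euc N) 1, ‖h x‖ ≤ Hh)
    (ha : 0 ≤ a) (hC : 0 < C) (he : ‖e‖ = 1)
    (hβ₁ : β₁ ∈ Ioc (0 : ℝ) 1) (hβ₂ : β₂ ∈ Ioc (0 : ℝ) 1) (hF : UnifElliptic lam Lam F)
    (hH0 : ∀ x ∈ ball (0 : Euc N) 1, |H x 0| ≤ CH)
    (hH : ∀ x q : Euc N, |H x q - H x 0| ≤ C * (‖q‖ ^ β₁ + ‖q‖ ^ β₂))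
    (hf : ∀ x ∈ ball (0 : Euc N) 1, |f x| ≤ Cf) (huc : ContinuousOn u (ball 0 1))
    (hu : ∀ x ∈ ball (0 : Euc N) 1, |u x| ≤ Cu)
    (hsol : ViscSol (ball 0 1)
      (fun x p M => ‖e + a • p‖ ^ α * (F M + ⟪h x, p⟫) + H x p) f u)
    (hr0 : 0 ≤ r) (hr1 : r < 1) :
    ∃ L > 0, ∃ t > 0, 2 * Cu ≤ L * t ∧ ∀ x ∈ ball (0 : Euc N) r, ∀ y, ‖x - y‖ ≤ t →
      u x - u y ≤ L * ‖x - y‖ := by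
  have h0 : (0 : Euc N) ∈ ball (0 : Euc N) 1 := mem_ball_self one_pos
  have hCf : 0 ≤ Cf := (abs_nonneg _).trans (hf 0 h0)
  have hCH : 0 ≤ CH := (abs_nonneg _).trans (hH0 0 h0)
  have hCu : 0 ≤ Cu := (abs_nonneg _).trans (hu 0 h0)
  have hHh : 0 ≤ Hh := (norm_nonneg _).trans (hh 0 h0)
  obtain ⟨b, hb⟩ : ∃ b, b = (1 - r) / 4 := ⟨_, rfl⟩
  have hb0 : 0 < b := by linarith
  have hb1 : b ≤ 1 := by linarith
  obtain ⟨M, hM⟩ : ∃ M, M = (2 * Cu + 1) / b ^ 2 := ⟨_, rfl⟩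
  have hM0 : 0 ≤ M := by rw [hM]; positivity
  have hMb : 2 * Cu < M * b ^ 2 := by rw [hM, div_mul_cancel₀ _ (by positivity)]; linarith
  obtain ⟨κ, hκ⟩ : ∃ κ, κ = (2 * (2 * C + Hh) + 1) / (4 * lam) := ⟨_, rfl⟩
  have hκ0 : 0 < κ := by rw [hκ]; positivity
  have hκlam : lam * (4 * κ) = 2 * (2 * C + Hh) + 1 := by rw [hκ]; field_simp
  obtain ⟨t, ht⟩ : ∃ t, t = min b (1 / (2 * κ)) := ⟨_, rfl⟩
  have ht0 : 0 < t := by rw [ht]; positivity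
  have htb : t ≤ b := by rw [ht]; exact min_le_left _ _
  have hκt : κ * t ≤ 1 / 2 := by
    have : t ≤ 1 / (2 * κ) := by rw [ht]; exact min_le_right _ _
    calc κ * t ≤ κ * (1 / (2 * κ)) := by gcongr
      _ = 1 / 2 := by field_simp
  obtain ⟨L, hL⟩ : ∃ L, L = 1 + max (4 * Cu / t) (max (2 * (2 / a + 2 * M + 1))
      (Lam * (4 * (M + 1) * N) + 2 * (Cf + CH + 2 * C) + 2 * (2 * C + Hh) * (2 * M + 1))) :=
    ⟨_, rfl⟩
  have hL1 : 4 * Cu / t ≤ L - 1 := by rw [hL]; simp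
  have hL2 : 2 * (2 / a + 2 * M + 1) ≤ L - 1 := by rw [hL]; simp
  have hL3 : Lam * (4 * (M + 1) * N) + 2 * (Cf + CH + 2 * C) + 2 * (2 * C + Hh) * (2 * M + 1)
      ≤ L - 1 := by rw [hL]; simp
  have hL0 : 0 < L := by
    have : 0 ≤ 4 * Cu / t := by positivity
    linarith
  have hLt : 4 * Cu ≤ L * t := by
    rw [← div_le_iff₀ ht0]
    linarith
  refine ⟨L, hL0, t, ht0, by linarith, fun x₀ hx₀ y₀ hy₀ => ?_⟩
  by_contra! hfail
  have hsub : closedBall x₀ (2 * b) ⊆ ball (0 : Euc N) 1 := by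
    intro x hx
    rw [mem_closedBall_iff_norm] at hx
    rw [mem_ball_zero_iff] at hx₀ ⊢
    have := norm_add_le (x - x₀) x₀
    rw [sub_add_cancel] at this
    linarith
  obtain ⟨x, y, hx, hxy, hne, hmax⟩ := exists_isLocalMax_doubled (huc.mono hsub)
    (fun x hx => hu x (hsub hx)) hb0 htb hκ0.le hκt hL0.le hLt hMb hM0 hy₀ hfail
  have hxb : x ∈ ball (0 : Euc N) 1 := hsub (by rw [mem_closedBall_iff_norm]; linarith)
  have hyb : y ∈ ball (0 : Euc N) 1 := hsub (by
    rw [mem_closedBall_iff_norm]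
    have h1 : y - x₀ = (x - x₀) - (x - y) := by abel
    rw [h1]
    linarith [norm_sub_le (x - x₀) (x - y)])
  obtain ⟨x', y', p, q, X, Y, hx', hy', hp, hq, hX, hY, hXY, hXYξ⟩ :=
    exists_jets_of_isLocalMax_doubled isOpen_ball huc hL0.le hM0 hxb hyb hne hmax one_pos
  have hs : 0 < ‖x - y‖ := norm_pos_iff.2 hne
  have hξ : ‖‖x - y‖⁻¹ • (x - y)‖ = 1 := by
    rw [norm_smul, norm_inv, norm_norm, inv_mul_cancel₀ hs.ne']
  generalize ‖x - y‖⁻¹ • (x - y) = ξ at *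
  have hk1 : κ * ‖x - y‖ ≤ 1 / 2 := (mul_le_mul_of_nonneg_left hxy.le hκ0.le).trans hκt
  have hk2 : 0 ≤ κ * ‖x - y‖ := by positivity
  have hnorm : ‖(L * (1 - κ * ‖x - y‖)) • ξ‖ = L * (1 - κ * ‖x - y‖) := by
    rw [norm_smul, hξ, mul_one, Real.norm_of_nonneg (mul_nonneg hL0.le (by linarith))]
  generalize (L * (1 - κ * ‖x - y‖)) • ξ = v at *
  have hv1 : L / 2 ≤ ‖v‖ := by
    have := mul_le_mul_of_nonneg_left hk1 hL0.le
    linarith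
  have hv2 : ‖v‖ ≤ L := by
    have := mul_nonneg hL0.le hk2
    linarith
  have hMx : ‖(2 * M) • (x - x₀)‖ ≤ 2 * M := by
    rw [norm_smul, Real.norm_of_nonneg (by positivity)]
    exact mul_le_of_le_one_right (by positivity) (by linarith)
  have hp12 := norm_bounds_of_norm_sub_lt_one hMx hp
  have hq12 := norm_bounds_of_norm_sub_lt_one (p := q) (v := v) (k := 0) norm_zero.le
    (by rwa [add_zero])
  have hFX := (hsol.jet_bounds hα hh ha hC he hβ₁ hβ₂ hH0 hH hf hx' (by linarith)).1 hX
  have hFY := (hsol.jet_bounds hα hh ha hC he hβ₁ hβ₂ hH0 hH hf hy' (by linarith)).2 hY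
  have hFXY := hF.symmMatrix_sub_le hlam.le (by positivity) hXY hξ hXYξ
  have h1 : (2 * C + Hh) * (‖p‖ + ‖q‖) ≤ (2 * C + Hh) * (2 * L + 2 * (2 * M + 1)) :=
    mul_le_mul_of_nonneg_left (by linarith) (by positivity)
  have h2 : lam * (4 * L * κ) = L * (2 * (2 * C + Hh) + 1) := by rw [← hκlam]; ring
  rw [h2] at hFXY
  linarith
/-- Lipschitz regularity for
`|e + a ∇u|^α (F(D²u) + h·∇u) + H(x,∇u) = f`, `α ≥ 0`, for `a` and `C` small. -/
theorem lipschitz_regularity_tilted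
    (N : ℕ) (lam Lam α Cf CH : ℝ) (Kh : NNReal) (h : Euc N → Euc N)
    (hlam : 0 < lam) (hlL : lam ≤ Lam) (hα : 0 ≤ α) (hh : LipschitzWith Kh h) :
    ∃ a₀ > (0 : ℝ), ∃ C₀ > (0 : ℝ),
      ∀ (a C β₁ β₂ Cu : ℝ) (e : Euc N) (F : Matrix (Fin N) (Fin N) ℝ → ℝ)
        (H : Euc N → Euc N → ℝ) (f u : Euc N → ℝ),
        0 ≤ a → a < a₀ → 0 < C → C ≤ C₀ → ‖e‖ = 1 →
        β₁ ∈ Ioc (0 : ℝ) 1 → β₂ ∈ Ioc (0 : ℝ) 1 →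
        UnifElliptic lam Lam F →
        (∀ x ∈ ball (0 : Euc N) 1, |H x 0| ≤ CH) →
        (∀ x q : Euc N, |H x q - H x 0| ≤ C * (‖q‖ ^ β₁ + ‖q‖ ^ β₂)) →
        ContinuousOn f (ball 0 1) →
        (∀ x ∈ ball (0 : Euc N) 1, |f x| ≤ Cf) →
        ContinuousOn u (ball 0 1) →
        (∀ x ∈ ball (0 : Euc N) 1, |u x| ≤ Cu) →
        ViscSol (ball 0 1)
          (fun x p M => ‖e + a • p‖ ^ α * (F M + ⟪h x, p⟫) + H x p) f u →
        ∀ r ∈ Ioo (0 : ℝ) 1, ∃ K : NNReal, LipschitzOnWith K u (ball 0 r) := by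
  refine ⟨1, one_pos, 1, one_pos, ?_⟩
  intro a C β₁ β₂ Cu e F H f u ha _ hC _ he hβ₁ hβ₂ hF hH0 hH _ hf huc hu hsol r hr
  have hhb : ∀ x ∈ ball (0 : Euc N) 1, ‖h x‖ ≤ ‖h 0‖ + Kh := by
    intro x hx
    rw [mem_ball_zero_iff] at hx
    have h1 := hh.dist_le_mul x 0
    rw [dist_eq_norm, dist_zero_right] at h1
    have h2 := norm_add_le (h x - h 0) (h 0)
    rw [sub_add_cancel] at h2
    nlinarith [Kh.2]
  obtain ⟨L, hL, t, ht, hCu, key⟩ := hsol.exists_lipschitz_estimate hlam hα hhb ha hC he hβ₁ hβ₂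
    hF hH0 hH hf huc hu hr.1.le hr.2
  have hle : ∀ x ∈ ball (0 : Euc N) r, ∀ y ∈ ball (0 : Euc N) r, u x - u y ≤ L * ‖x - y‖ := by
    intro x hx y hy
    rcases le_total ‖x - y‖ t with hxy | hxy
    · exact key x hx y hxy
    · have h1 := abs_le.1 (hu x (ball_subset_ball hr.2.le hx))
      have h2 := abs_le.1 (hu y (ball_subset_ball hr.2.le hy))
      have h3 := mul_le_mul_of_nonneg_left hxy hL.le
      linarith
  refine ⟨L.toNNReal, LipschitzOnWith.of_dist_le_mul fun x hx y hy => ?_⟩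
  rw [Real.coe_toNNReal L hL.le, Real.dist_eq, dist_eq_norm, abs_sub_le_iff]
  refine ⟨hle x hx y hy, ?_⟩
  rw [norm_sub_rev]
  exact hle y hy x hx
end
end
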